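/- arXiv:2112.12111 — 5 statements merged into one kernel-verified Lean document; each statement's English description precedes it below -/
import Mathlib

section
/- Let A be the companion matrix of f(x) = (x−1)⁶ and B the companion matrix of g(x) = (x+1)⁴(x²−x+1), regarded as elements of GL₆(ℚ), and set T = B·A⁻¹. Then T and B generate a free group of rank 2: the group homomorphism from the free group on two generators to GL₆(ℚ) sending the first generator to T and the second generator to B is injective. (This is the hypergeometric monodromy group of case A-4, with α = (0,0,0,0,0,0) and β = (1/2,1/2,1/2,1/2,1/6,5/6); in particular this group is isomorphic to ℤ ∗ ℤ.) -/
open Matrix Polynomial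

/-- The companion matrix of a (monic degree `n`) polynomial `p`:
the `n × n` matrix with subdiagonal entries `1`, last column
`(-c₀, …, -c_{n-1})ᵀ`, and `0` elsewhere. -/
def companionMatrix {K : Type*} [CommRing K] (n : ℕ) (p : Polynomial K) :
    Matrix (Fin n) (Fin n) K :=
  Matrix.of fun i j =>
    if (j : ℕ) + 1 = n then -p.coeff i
    else if (i : ℕ) = (j : ℕ) + 1 then 1 else 0

namespace HypergeometricA4

/-! ### The matrices -/

/-- The companion matrix of `(x - 1) ^ 6`. -/
def matA : Matrix (Fin 6) (Fin 6) ℚ :=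
  !![0, 0, 0, 0, 0, -1;
     1, 0, 0, 0, 0, 6;
     0, 1, 0, 0, 0, -15;
     0, 0, 1, 0, 0, 20;
     0, 0, 0, 1, 0, -15;
     0, 0, 0, 0, 1, 6]

/-- The companion matrix of `(x + 1) ^ 4 * (x ^ 2 - x + 1)`. -/
def matB : Matrix (Fin 6) (Fin 6) ℚ :=
  !![0, 0, 0, 0, 0, -1;
     1, 0, 0, 0, 0, -3;
     0, 1, 0, 0, 0, -3;
     0, 0, 1, 0, 0, -2;
     0, 0, 0, 1, 0, -3;
     0, 0, 0, 0, 1, -3]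

/-- The transvection `B * A⁻¹`. -/
def matT : Matrix (Fin 6) (Fin 6) ℚ :=
  !![1, 0, 0, 0, 0, 0;
     9, 1, 0, 0, 0, 0;
     -12, 0, 1, 0, 0, 0;
     22, 0, 0, 1, 0, 0;
     -12, 0, 0, 0, 1, 0;
     9, 0, 0, 0, 0, 1]

/-- An involution conjugating both `matT` and `matB` to their inverses. -/
def matJ : Matrix (Fin 6) (Fin 6) ℚ :=
  !![1, 0, 0, 0, 0, 0;
     3, 0, 0, 0, 0, -1;
     3, 0, 0, 0, -1, 0;
     2, 0, 0, -1, 0, 0;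
     3, 0, -1, 0, 0, 0;
     3, -1, 0, 0, 0, 0]

/-- The direction of the transvection `matT`. -/
def vecV : Fin 6 → ℚ := ![0, 9, -12, 22, -12, 9]

/-- A vector fixed by `matJ` and moved by `matT`. -/
def vecU : Fin 6 → ℚ := ![1, 3/2, 3/2, 1, 3/2, 3/2]

theorem vecV_zero : vecV 0 = 0 := by simp [vecV]

theorem companionMatrix_matA : companionMatrix 6 ((X - 1) ^ 6 : ℚ[X]) = matA := by
  have h : ((X - 1) ^ 6 : ℚ[X]) =
      X ^ 6 + C (-6) * X ^ 5 + C 15 * X ^ 4 + C (-20) * X ^ 3 + C 15 * X ^ 2 + C (-6) * X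
        + C 1 := by
    simp only [map_neg, map_one, map_ofNat]
    ring
  rw [h]
  ext i j
  fin_cases i <;> fin_cases j <;>
    simp [companionMatrix, matA, coeff_X, coeff_one]

theorem companionMatrix_matB :
    companionMatrix 6 ((X + 1) ^ 4 * (X ^ 2 - X + 1) : ℚ[X]) = matB := by
  have h : ((X + 1) ^ 4 * (X ^ 2 - X + 1) : ℚ[X]) =
      X ^ 6 + C 3 * X ^ 5 + C 3 * X ^ 4 + C 2 * X ^ 3 + C 3 * X ^ 2 + C 3 * X + C 1 := by
    simp only [map_one, map_ofNat]
    ring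
  rw [h]
  ext i j
  fin_cases i <;> fin_cases j <;>
    simp [companionMatrix, matB, coeff_X, coeff_one]

theorem matT_mul_matA : matT * matA = matB := by decide +kernel

theorem matJ_mul_matJ : matJ * matJ = 1 := by decide +kernel

theorem matJ_conj_matT : matJ * matT * matJ * matT = 1 := by decide +kernel

theorem matJ_conj_matB : matJ * matB * matJ * matB = 1 := by decide +kernel

theorem matJ_mulVec_vecV : matJ *ᵥ vecV = -vecV := by decide +kernel

theorem matJ_mulVec_vecU : matJ *ᵥ vecU = vecU := by decide +kernel

theorem matJ_mulVec_matJ_mulVec (x : Fin 6 → ℚ) : matJ *ᵥ matJ *ᵥ x = x := by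
  rw [mulVec_mulVec, matJ_mul_matJ, one_mulVec]

theorem matJ_mulVec_zero (x : Fin 6 → ℚ) : (matJ *ᵥ x) 0 = x 0 := by
  simp [matJ, mulVec, dotProduct, Fin.sum_univ_succ]

theorem matT_mulVec (x : Fin 6 → ℚ) : matT *ᵥ x = x + x 0 • vecV := by
  ext i
  fin_cases i <;> simp [matT, vecV, mulVec, dotProduct, Fin.sum_univ_succ] <;> ring

theorem matT_mulVec_vecV : matT *ᵥ vecV = vecV := by decide +kernel

/-! ### The invariant cone -/

/-- The generators of the cone, as columns. -/
def gens : Matrix (Fin 6) (Fin 9) ℚ :=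
  !![1, 1, 1, 3, 1, 8, 33, 11, 181;
     2, 4, 2, 6, 4, 23, 91, 44, 594;
     1, 3, 6, 11, -2, 30, 76, -14, 230;
     1, 1, 0, 3, 12, 8, 36, 108, 1128;
     2, 4, 1, 6, -7, 26, 91, -53, -435;
     1, 3, 6, 11, 8, 33, 73, 80, 1198]

/-- The cone spanned by the columns of `gens`, without its apex. -/
def cone : Set (Fin 6 → ℚ) := {x | ∃ c : Fin 9 → ℚ, 0 ≤ c ∧ c ≠ 0 ∧ gens *ᵥ c = x}

/-- A positive functional is positive at a nonzero nonnegative vector. -/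
theorem dotProduct_pos_of_pos {ι : Type*} [Fintype ι] {r c : ι → ℚ} (hr : ∀ i, 0 < r i)
    (hc : 0 ≤ c) (hc' : c ≠ 0) : 0 < r ⬝ᵥ c := by
  obtain ⟨i, hi⟩ := Function.ne_iff.mp hc'
  exact Finset.sum_pos' (fun j _ => mul_nonneg (hr j).le (hc j))
    ⟨i, Finset.mem_univ i, mul_pos (hr i) (lt_of_le_of_ne (hc i) (Ne.symm hi))⟩

theorem cone_zero_pos {x : Fin 6 → ℚ} (hx : x ∈ cone) : 0 < x 0 := by
  obtain ⟨c, hc, hc', rfl⟩ := hx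
  exact dotProduct_pos_of_pos (r := gens 0) (by decide +kernel) hc hc'

/-- A matrix mapping `cone` into itself. -/
def ConePreserving (M : Matrix (Fin 6) (Fin 6) ℚ) : Prop := ∀ x ∈ cone, M *ᵥ x ∈ cone

theorem ConePreserving.of_mul_eq {M : Matrix (Fin 6) (Fin 6) ℚ} (N : Matrix (Fin 9) (Fin 9) ℚ)
    (hN : ∀ p : Fin 9 × Fin 9, 0 ≤ N p.1 p.2) (hpos : ∀ j, 0 < (M * gens) 0 j)
    (h : M * gens = gens * N) :
    ConePreserving M := by
  rintro x ⟨c, hc, hc', rfl⟩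
  have hx : M *ᵥ gens *ᵥ c = gens *ᵥ N *ᵥ c := by rw [mulVec_mulVec, h, ← mulVec_mulVec]
  refine ⟨N *ᵥ c, fun i => dotProduct_nonneg_of_nonneg (fun j => hN (i, j)) hc,
    fun h0 => ?_, hx.symm⟩
  have h1 : 0 < (M *ᵥ gens *ᵥ c) 0 := by
    rw [mulVec_mulVec]
    exact dotProduct_pos_of_pos hpos hc hc'
  rw [hx, h0, mulVec_zero] at h1
  exact lt_irrefl _ h1

/-- The action of `-matB` on the generators of the cone. -/
def certificate_neg_B : Matrix (Fin 9) (Fin 9) ℚ :=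
  !![1, 2, 2, 7/3, 22/23, 0, 50, 134/69, 106;
     0, 1, 4/3, 4/3, 44/69, 0, 20, 28/69, 196/3;
     0, 0, 0, 1/2, 45/92, 0, 3, 221/92, 27;
     0, 0, 0, 0, 0, 0, 0, 0, 0;
     0, 0, 0, 0, 0, 0, 0, 0, 0;
     0, 0, 1/3, 1/6, 31/138, 0, 0, 93/46, 109/3;
     0, 0, 0, 1/6, 3/46, 1, 0, 173/138, 16;
     0, 0, 0, 0, 0, 0, 0, 0, 0;
     0, 0, 0, 0, 1/92, 0, 0, 9/92, 1]

theorem conePres_neg_B : ConePreserving (-matB) :=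
  .of_mul_eq certificate_neg_B (by decide +kernel) (by decide +kernel) (by decide +kernel)

/-- The action of `-(matB * matT)` on the generators of the cone. -/
def certificate_neg_BT : Matrix (Fin 9) (Fin 9) ℚ :=
  !![745/786, 92/47, 92/47, 143/69, 20/23, 0, 1084/23, 26/23, 2076/23;
     0, 137/141, 184/141, 80/69, 40/69, 0, 416/23, 0, 3784/69;
     0, 0, 0, 10/23, 43/92, 1/6, 105/46, 195/92, 1061/46;
     7/262, 0, 0, 0, 0, 0, 0, 2/23, 0;
     0, 2/47, 2/47, 0, 0, 2/3, 0, 0, 0;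
     179/1572, 17/141, 64/141, 71/138, 47/138, 1, 88/23, 151/46, 3955/69;
     199/1572, 6/47, 6/47, 77/138, 9/46, 2, 99/23, 123/46, 911/23;
     1/131, 0, 0, 0, 0, 0, 0, 0, 0;
     11/524, 1/47, 1/47, 3/46, 3/92, 1/6, 33/46, 31/92, 227/46]

theorem conePres_neg_BT : ConePreserving (-(matB * matT)) :=
  .of_mul_eq certificate_neg_BT (by decide +kernel) (by decide +kernel) (by decide +kernel)

/-- The action of `matB * matJ * matT * matJ` on the generators of the cone. -/
def certificate_BJTJ : Matrix (Fin 9) (Fin 9) ℚ :=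
  !![0, 0, 0, 0, 0, 0, 0, 0, 0;
     1444/1137, 1/3, 0, 2/9, 0, 0, 344/9, 0, 0;
     0, 1, 1, 203/288, 0, 1/6, 10/9, 4, 60;
     147/379, 0, 0, 0, 0, 0, 16, 0, 0;
     160/379, 2, 2, 179/72, 1, 2/3, 226/9, 4, 124;
     221/2274, 1/3, 0, 65/144, 0, 1, 35/9, 0, 0;
     29/758, 0, 0, 1/16, 0, 0, 0, 0, 0;
     0, 0, 0, 0, 0, 0, 0, 1, 6;
     13/758, 0, 0, 11/288, 0, 1/6, 4/9, 0, 1]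

theorem conePres_BJTJ : ConePreserving (matB * matJ * matT * matJ) :=
  .of_mul_eq certificate_BJTJ (by decide +kernel) (by decide +kernel) (by decide +kernel)

/-- The action of `-(matB * matT * matJ)` on the generators of the cone. -/
def certificate_neg_BTJ : Matrix (Fin 9) (Fin 9) ℚ :=
  !![745/786, 1109/1416, 0, 0, 22/23, 0, 3327/118, 1697/138, 11738/69;
     0, 0, 28/345, 28/379, 44/69, 4688/1137, 0, 480/23, 22444/69;
     0, 0, 219/230, 0, 45/92, 0, 0, 0, 695/46;
     7/262, 145/472, 6/115, 397/379, 0, 2304/379, 597/118, 401/46, 3448/23;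
     0, 81/236, 0, 66/379, 0, 2384/379, 375/59, 0, 0;
     179/1572, 289/2832, 37/345, 136/379, 31/138, 680/1137, 1103/236, 37/276, 0;
     199/1572, 161/2832, 14/115, 141/379, 3/46, 235/379, 719/236, 17/276, 181/69;
     1/131, 0, 0, 0, 0, 0, 0, 0, 0;
     11/524, 17/944, 1/46, 24/379, 1/92, 40/379, 153/236, 13/92, 135/46]

theorem conePres_neg_BTJ : ConePreserving (-(matB * matT * matJ)) :=
  .of_mul_eq certificate_neg_BTJ (by decide +kernel) (by decide +kernel) (by decide +kernel)

/-- The action of `matB * matJ * matT` on the generators of the cone. -/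
def certificate_BJT : Matrix (Fin 9) (Fin 9) ℚ :=
  !![0, 0, 2/9, 361/141, 0, 6298/401, 0, 5170/401, 91086/401;
     1444/1137, 1, 0, 460/141, 0, 6496/401, 13924/379, 8756/401, 421732/1203;
     0, 1/48, 0, 0, 1/48, 0, 0, 0, 0;
     147/379, 0, 0, 0, 0, 118/401, 2454/379, 3652/401, 54076/401;
     160/379, 1/12, 1/2, 52/47, 13/12, 0, 2934/379, 0, 0;
     221/2274, 1/8, 2/9, 85/282, 1/8, 361/401, 981/379, 33/401, 6877/1203;
     29/758, 1/8, 1/9, 43/282, 1/8, 0, 1031/379, 0, 0;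
     0, 0, 1/6, 0, 0, 28/401, 0, 819/401, 14422/401;
     13/758, 1/48, 0, 5/94, 1/48, 67/401, 240/379, 55/401, 568/401]

theorem conePres_BJT : ConePreserving (matB * matJ * matT) :=
  .of_mul_eq certificate_BJT (by decide +kernel) (by decide +kernel) (by decide +kernel)

theorem neg_matB_mulVec_vecV_mem : -(matB *ᵥ vecV) ∈ cone :=
  ⟨![0, 0, 1/48, 0, 1/12, 1/8, 1/8, 0, 1/48],
    fun i => by revert i; decide +kernel, by decide +kernel, by decide +kernel⟩

theorem cone_add_smul {x y : Fin 6 → ℚ} (hx : x ∈ cone) (hy : y ∈ cone) {t : ℚ} (ht : 0 ≤ t) :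
    x + t • y ∈ cone := by
  obtain ⟨c, hc, hc', rfl⟩ := hx
  obtain ⟨d, hd, -, rfl⟩ := hy
  refine ⟨c + t • d, add_nonneg hc (smul_nonneg ht hd), fun h => hc' (le_antisymm ?_ hc), ?_⟩
  · rw [← h]
    exact le_add_of_nonneg_right (smul_nonneg ht hd)
  · rw [mulVec_add, mulVec_smul]

/-! ### The ping-pong sets -/

/-- The set containing the images of vectors under words that start with `B`. -/
def setB : Set (Fin 6 → ℚ) := {x | x ∈ cone ∨ -x ∈ cone}

/-- The set containing the images of vectors under words that start with `T`. -/
def setT : Set (Fin 6 → ℚ) :=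
  {x | ∃ y, ∃ t : ℚ, (y ∈ cone ∨ matJ *ᵥ y ∈ cone) ∧ 0 ≤ t ∧
    (x = matT *ᵥ y + t • vecV ∨ x = -(matT *ᵥ y + t • vecV))}

theorem setB_neg {x : Fin 6 → ℚ} (hx : x ∈ setB) : -x ∈ setB := by
  rcases hx with h | h
  · exact Or.inr (by rwa [neg_neg])
  · exact Or.inl h

theorem setB_zero_ne {x : Fin 6 → ℚ} (hx : x ∈ setB) : x 0 ≠ 0 := by
  rcases hx with h | h
  · exact (cone_zero_pos h).ne'
  · simpa using (cone_zero_pos h).ne'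

theorem setT_zero_ne {x : Fin 6 → ℚ} (hx : x ∈ setT) : x 0 ≠ 0 := by
  obtain ⟨y, t, hy, -, hx⟩ := hx
  have h0 : 0 < y 0 := by
    rcases hy with h | h
    · exact cone_zero_pos h
    · simpa [matJ_mulVec_zero] using cone_zero_pos h
  rw [matT_mulVec] at hx
  rcases hx with rfl | rfl <;> simp [vecV_zero, h0.ne']

theorem matB_mulVec_vecV_mem : matB *ᵥ vecV ∈ setB := Or.inr neg_matB_mulVec_vecV_mem

theorem matB_mulVec_mem_of_mem_setB {x : Fin 6 → ℚ} (hx : x ∈ setB) : matB *ᵥ x ∈ setB := by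
  rcases hx with h | h
  · exact Or.inr (by simpa [neg_mulVec] using conePres_neg_B _ h)
  · exact Or.inl (by simpa [neg_mulVec, mulVec_neg] using conePres_neg_B _ h)

theorem matB_mulVec_mem_of_mem_setT {x : Fin 6 → ℚ} (hx : x ∈ setT) : matB *ᵥ x ∈ setB := by
  obtain ⟨y, t, hy, ht, hx⟩ := hx
  have h1 : -(matB *ᵥ matT *ᵥ y) ∈ cone := by
    rcases hy with h | h
    · simpa [neg_mulVec, mulVec_mulVec] using conePres_neg_BT _ h
    · have := conePres_neg_BTJ _ h
      rwa [neg_mulVec, ← mulVec_mulVec, matJ_mulVec_matJ_mulVec, ← mulVec_mulVec] at this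
  have h2 : matB *ᵥ (matT *ᵥ y + t • vecV) ∈ setB := by
    refine Or.inr ?_
    convert cone_add_smul h1 neg_matB_mulVec_vecV_mem ht using 1
    rw [mulVec_add, mulVec_smul, smul_neg, neg_add]
  rcases hx with rfl | rfl
  · exact h2
  · rw [mulVec_neg]
    exact setB_neg h2

theorem matB_mulVec_matJ_mulVec_mem_of_mem_setT {x : Fin 6 → ℚ} (hx : x ∈ setT) :
    matB *ᵥ matJ *ᵥ x ∈ setB := by
  obtain ⟨y, t, hy, ht, hx⟩ := hx
  have h1 : matB *ᵥ matJ *ᵥ matT *ᵥ y ∈ cone := by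
    rcases hy with h | h
    · simpa [mulVec_mulVec, Matrix.mul_assoc] using conePres_BJT _ h
    · have := conePres_BJTJ _ h
      rwa [← mulVec_mulVec, matJ_mulVec_matJ_mulVec, ← mulVec_mulVec, ← mulVec_mulVec] at this
  have h2 : matB *ᵥ matJ *ᵥ (matT *ᵥ y + t • vecV) ∈ setB := by
    refine Or.inl ?_
    convert cone_add_smul h1 neg_matB_mulVec_vecV_mem ht using 1
    rw [mulVec_add, mulVec_add, mulVec_smul, mulVec_smul, matJ_mulVec_vecV, mulVec_neg]
  rcases hx with rfl | rfl
  · exact h2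
  · rw [mulVec_neg, mulVec_neg]
    exact setB_neg h2

theorem matT_mulVec_mem_of_mem_setB {x : Fin 6 → ℚ} (hx : x ∈ setB) : matT *ᵥ x ∈ setT := by
  rcases hx with h | h
  · exact ⟨x, 0, Or.inl h, le_rfl, Or.inl (by simp)⟩
  · exact ⟨-x, 0, Or.inl h, le_rfl, Or.inr (by simp [mulVec_neg])⟩

theorem matT_mulVec_matJ_mulVec_mem_of_mem_setB {x : Fin 6 → ℚ} (hx : x ∈ setB) :
    matT *ᵥ matJ *ᵥ x ∈ setT := by
  rcases hx with h | h
  · exact ⟨matJ *ᵥ x, 0, Or.inr (by rwa [matJ_mulVec_matJ_mulVec]), le_rfl, Or.inl (by simp)⟩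
  · exact ⟨matJ *ᵥ -x, 0, Or.inr (by rwa [matJ_mulVec_matJ_mulVec]), le_rfl,
      Or.inr (by simp [mulVec_neg])⟩

theorem matT_mulVec_mem_of_mem_setT {x : Fin 6 → ℚ} (hx : x ∈ setT) : matT *ᵥ x ∈ setT := by
  obtain ⟨y, t, hy, ht, hx⟩ := hx
  have h0 : 0 ≤ y 0 := by
    rcases hy with h | h
    · exact (cone_zero_pos h).le
    · simpa [matJ_mulVec_zero] using (cone_zero_pos h).le
  have h1 : matT *ᵥ (matT *ᵥ y + t • vecV) = matT *ᵥ y + (y 0 + t) • vecV := by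
    rw [mulVec_add, mulVec_smul, matT_mulVec_vecV, matT_mulVec y, mulVec_add, mulVec_smul,
      matT_mulVec_vecV, matT_mulVec y, add_smul, add_assoc _ _ (t • vecV)]
  refine ⟨y, y 0 + t, hy, add_nonneg h0 ht, ?_⟩
  rcases hx with rfl | rfl
  · exact Or.inl h1
  · exact Or.inr (by rw [mulVec_neg, h1])

/-! ### The state of a reduced word -/

/-- The state of a matrix after a letter `T`. It includes the nontrivial powers of `T`, which fix
`vecV` and are detected on `vecU` instead. -/
def StateT (W : Matrix (Fin 6) (Fin 6) ℚ) : Prop :=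
  W *ᵥ vecV ∈ setT ∨
    ((W *ᵥ vecV = vecV ∨ W *ᵥ vecV = -vecV) ∧ ∃ n : ℚ, 0 < n ∧ W *ᵥ vecU = vecU + n • vecV)

/-- The state of a matrix after a letter `B`. -/
def StateB (W : Matrix (Fin 6) (Fin 6) ℚ) : Prop := W *ᵥ vecV ∈ setB

/-- The state of a matrix after a letter. -/
def State (i : Fin 2) : Matrix (Fin 6) (Fin 6) ℚ → Prop := ![StateT, StateB] i

/-- The matrix of a generator. -/
def letter (i : Fin 2) : Matrix (Fin 6) (Fin 6) ℚ := ![matT, matB] i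

/-- The involution exchanging a generator with its inverse, as a power of `matJ`. -/
def flip (b : Bool) : Matrix (Fin 6) (Fin 6) ℚ := cond b 1 matJ

theorem flip_mul_flip (b : Bool) : flip b * flip b = 1 := by
  cases b <;> simp [flip, matJ_mul_matJ]

theorem flip_mul_flip_of_ne {b b' : Bool} (h : b ≠ b') : flip b * flip b' = matJ := by
  cases b <;> cases b' <;> simp_all [flip]

theorem flip_mulVec_vecV (b : Bool) : flip b *ᵥ vecV = vecV ∨ flip b *ᵥ vecV = -vecV := by
  cases b <;> simp [flip, matJ_mulVec_vecV]

theorem flip_mulVec_vecU (b : Bool) : flip b *ᵥ vecU = vecU := by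
  cases b <;> simp [flip, matJ_mulVec_vecU]

theorem matB_mulVec_mem_of_eq {x : Fin 6 → ℚ} (hx : x = vecV ∨ x = -vecV) :
    matB *ᵥ x ∈ setB := by
  rcases hx with rfl | rfl
  · exact matB_mulVec_vecV_mem
  · rw [mulVec_neg]
    exact setB_neg matB_mulVec_vecV_mem

theorem matT_mulVec_of_eq {x : Fin 6 → ℚ} (hx : x = vecV ∨ x = -vecV) : matT *ᵥ x = x := by
  rcases hx with rfl | rfl <;> simp [mulVec_neg, matT_mulVec_vecV]

theorem matJ_mulVec_of_eq {x : Fin 6 → ℚ} (hx : x = vecV ∨ x = -vecV) :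
    matJ *ᵥ x = vecV ∨ matJ *ᵥ x = -vecV := by
  rcases hx with rfl | rfl <;> simp [mulVec_neg, matJ_mulVec_vecV]

theorem matT_mulVec_vecU_add (n : ℚ) :
    matT *ᵥ (vecU + n • vecV) = vecU + (n + 1) • vecV := by
  have h : vecU 0 = 1 := by simp [vecU]
  rw [mulVec_add, mulVec_smul, matT_mulVec_vecV, matT_mulVec, h, add_smul]
  abel

theorem state_letter_mul_flip (i : Fin 2) (b : Bool) : State i (letter i * flip b) := by
  fin_cases i
  · refine Or.inr ⟨?_, 1, one_pos, ?_⟩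
    · simpa [letter, ← mulVec_mulVec, matT_mulVec_of_eq (flip_mulVec_vecV b)] using
        flip_mulVec_vecV b
    · simpa [letter, ← mulVec_mulVec, flip_mulVec_vecU] using matT_mulVec_vecU_add 0
  · simpa [State, StateB, letter, ← mulVec_mulVec] using
      matB_mulVec_mem_of_eq (flip_mulVec_vecV b)

theorem State.letter_mul {i j : Fin 2} {W : Matrix (Fin 6) (Fin 6) ℚ} (h : State j W) :
    State i (letter i * W) := by
  fin_cases i <;> fin_cases j
  · change StateT (matT * W)
    rcases h with h | ⟨h, n, hn, hu⟩
    · exact Or.inl (by simpa [← mulVec_mulVec] using matT_mulVec_mem_of_mem_setT h)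
    · refine Or.inr ⟨?_, n + 1, by positivity, ?_⟩
      · simpa [← mulVec_mulVec, matT_mulVec_of_eq h] using h
      · rw [← mulVec_mulVec, hu, matT_mulVec_vecU_add]
  · exact Or.inl (by simpa [letter, ← mulVec_mulVec] using matT_mulVec_mem_of_mem_setB h)
  · change (matB * W) *ᵥ vecV ∈ setB
    rw [← mulVec_mulVec]
    rcases h with h | ⟨h, -⟩
    · exact matB_mulVec_mem_of_mem_setT h
    · exact matB_mulVec_mem_of_eq h
  · change (matB * W) *ᵥ vecV ∈ setB
    rw [← mulVec_mulVec]
    exact matB_mulVec_mem_of_mem_setB h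

theorem State.letter_mul_matJ_mul {i j : Fin 2} (hij : i ≠ j)
    {W : Matrix (Fin 6) (Fin 6) ℚ} (h : State j W) : State i (letter i * (matJ * W)) := by
  fin_cases i <;> fin_cases j
  · exact absurd rfl hij
  · exact Or.inl (by
      simpa [letter, ← mulVec_mulVec] using matT_mulVec_matJ_mulVec_mem_of_mem_setB h)
  · change (matB * (matJ * W)) *ᵥ vecV ∈ setB
    rw [← mulVec_mulVec, ← mulVec_mulVec]
    rcases h with h | ⟨h, -⟩
    · exact matB_mulVec_matJ_mulVec_mem_of_mem_setT h
    · exact matB_mulVec_mem_of_eq (matJ_mulVec_of_eq h)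
  · exact absurd rfl hij

theorem not_state_flip (i : Fin 2) (b : Bool) : ¬ State i (flip b) := by
  have hV : (flip b *ᵥ vecV) 0 = 0 := by
    rcases flip_mulVec_vecV b with h | h <;> simp [h, vecV_zero]
  intro h
  fin_cases i
  · rcases h with h | ⟨-, n, hn, hu⟩
    · exact setT_zero_ne h hV
    · rw [flip_mulVec_vecU] at hu
      have := congrFun hu 1
      simp [vecU, vecV] at this
      exact hn.ne' this
  · exact setB_zero_ne h hV

/-- The matrix of a word in the generators and their inverses. -/
def wordMatrix (L : List (Fin 2 × Bool)) : Matrix (Fin 6) (Fin 6) ℚ :=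
  (L.map fun x => flip x.2 * letter x.1 * flip x.2).prod

theorem state_wordMatrix (L : List (Fin 2 × Bool)) (i : Fin 2) (b : Bool)
    (h : FreeGroup.IsReduced ((i, b) :: L)) :
    State i (flip b * wordMatrix ((i, b) :: L)) := by
  induction L generalizing i b with
  | nil => simpa [wordMatrix, ← Matrix.mul_assoc, flip_mul_flip] using state_letter_mul_flip i b
  | cons a L ih =>
    obtain ⟨j, b'⟩ := a
    rw [FreeGroup.isReduced_cons_cons] at h
    have hs := ih j b' h.2
    have e : flip b * wordMatrix ((i, b) :: (j, b') :: L) =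
        letter i * (flip b * flip b' * (flip b' * wordMatrix ((j, b') :: L))) := by
      rw [Matrix.mul_assoc (flip b), ← Matrix.mul_assoc (flip b') (flip b'), flip_mul_flip,
        Matrix.one_mul]
      conv_lhs => rw [wordMatrix, List.map_cons, List.prod_cons, ← wordMatrix]
      simp only [← Matrix.mul_assoc, flip_mul_flip, Matrix.one_mul]
    rw [e]
    by_cases hb : b = b'
    · subst hb
      rw [flip_mul_flip, Matrix.one_mul]
      exact hs.letter_mul
    · rw [flip_mul_flip_of_ne hb]
      exact hs.letter_mul_matJ_mul fun hij => hb (h.1 hij)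

theorem wordMatrix_ne_one {L : List (Fin 2 × Bool)} (h : FreeGroup.IsReduced L) (hL : L ≠ []) :
    wordMatrix L ≠ 1 := by
  obtain ⟨⟨i, b⟩, L, rfl⟩ := List.exists_cons_of_ne_nil hL
  intro h1
  have := state_wordMatrix L i b h
  rw [h1, Matrix.mul_one] at this
  exact not_state_flip i b this

theorem coe_lift_mk (f : Fin 2 → GL (Fin 6) ℚ)
    (hf : ∀ i, (f i : Matrix (Fin 6) (Fin 6) ℚ) = letter i) (L : List (Fin 2 × Bool)) :
    ((FreeGroup.lift f (FreeGroup.mk L) : GL (Fin 6) ℚ) : Matrix (Fin 6) (Fin 6) ℚ) =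
      wordMatrix L := by
  have hinv (i : Fin 2) : (((f i)⁻¹ : GL (Fin 6) ℚ) : Matrix (Fin 6) (Fin 6) ℚ) =
      matJ * letter i * matJ := by
    apply Units.inv_eq_of_mul_eq_one_left
    rw [hf]
    fin_cases i
    · exact matJ_conj_matT
    · exact matJ_conj_matB
  rw [FreeGroup.lift_mk]
  induction L with
  | nil => simp [wordMatrix]
  | cons a L ih =>
    obtain ⟨i, b⟩ := a
    rw [List.map_cons, List.prod_cons, Units.val_mul, ih]
    cases b <;> simp [wordMatrix, flip, hf, hinv]

end HypergeometricA4

open HypergeometricA4 in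
/-- The hypergeometric group of case A4 is free of rank 2 on `T = B * A⁻¹` and `B`. -/
theorem thm_A4 (A B : GL (Fin 6) ℚ)
    (hA : (A : Matrix (Fin 6) (Fin 6) ℚ) = companionMatrix 6 ((X - 1) ^ 6))
    (hB : (B : Matrix (Fin 6) (Fin 6) ℚ) = companionMatrix 6 ((X + 1) ^ 4 * (X ^ 2 - X + 1))) :
    Function.Injective (FreeGroup.lift ![B * A⁻¹, B] : FreeGroup (Fin 2) →* GL (Fin 6) ℚ) := by
  rw [companionMatrix_matA] at hA
  rw [companionMatrix_matB] at hB
  have hT : ((B * A⁻¹ : GL (Fin 6) ℚ) : Matrix (Fin 6) (Fin 6) ℚ) = matT := by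
    rw [Units.val_mul, hB, ← matT_mul_matA, ← hA, Matrix.mul_assoc, Units.mul_inv, Matrix.mul_one]
  have hf (i : Fin 2) : ((![B * A⁻¹, B] i : GL (Fin 6) ℚ) : Matrix (Fin 6) (Fin 6) ℚ) =
      letter i := by
    fin_cases i
    · exact hT
    · exact hB
  refine (injective_iff_map_eq_one _).mpr fun w hw => ?_
  by_contra hne
  refine wordMatrix_ne_one (FreeGroup.isReduced_toWord (x := w))
    (fun h => hne (FreeGroup.toWord_eq_nil_iff.mp h)) ?_
  rw [← coe_lift_mk _ hf, FreeGroup.mk_toWord, hw, Units.val_one]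
end

section
/- Let A be the companion matrix of f(x) = (x−1)⁶ and B the companion matrix of g(x) = (x+1)²(x²+x+1)², regarded as elements of GL₆(ℚ), and set T = B·A⁻¹. Then T and B generate a free group of rank 2: the group homomorphism from the free group on two generators to GL₆(ℚ) sending the first generator to T and the second generator to B is injective. (This is the hypergeometric monodromy group of case A-5, with α = (0,0,0,0,0,0) and β = (1/2,1/2,1/3,1/3,2/3,2/3); in particular this group is isomorphic to ℤ ∗ ℤ.) -/
open Matrix Polynomial

open scoped Pointwise in
/-- A variant of the ping-pong lemma for free groups, with a single set for each generator. -/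
theorem FreeGroup.injective_lift_of_zpow_ping_pong {ι G α : Type*} [Nonempty ι] [Nontrivial ι]
    [Group G] [MulAction G α] (a : ι → G) (S : ι → Set α) (hS : ∀ i, (S i).Nonempty)
    (hdisj : Pairwise fun i j => Disjoint (S i) (S j))
    (hmap : ∀ i j, i ≠ j → ∀ k : ℤ, k ≠ 0 → ∀ x ∈ S j, a i ^ k • x ∈ S i) :
    Function.Injective (FreeGroup.lift a) := by
  have hlift : FreeGroup.lift a =
      (Monoid.CoprodI.lift fun i => FreeGroup.lift fun _ : Unit => a i).comp
        (@freeGroupEquivCoprodI ι).toMonoidHom := by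
    ext i
    simp
  rw [hlift, MonoidHom.coe_comp]
  refine Function.Injective.comp ?_ (MulEquiv.injective freeGroupEquivCoprodI)
  refine Monoid.CoprodI.lift_injective_of_ping_pong
    (H := fun _ : ι => FreeGroup Unit) (fun i => FreeGroup.lift fun _ => a i) ?_ S hS hdisj ?_
  · right
    inhabit ι
    use default
    rw [FreeGroup.freeGroupUnitEquivInt.cardinal_eq, Cardinal.mk_denumerable]
    exact Cardinal.natCast_le_aleph0
  · intro i j hij
    refine FreeGroup.freeGroupUnitEquivInt.forall_congr_left.mpr ?_
    intro n hn
    change FreeGroup.lift (fun _ => a i) (FreeGroup.of () ^ n) • S j ⊆ S i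
    rw [map_zpow, FreeGroup.lift_apply_of]
    have hn0 : n ≠ 0 := by
      rintro rfl
      apply hn
      simp [FreeGroup.freeGroupUnitEquivInt]
    rintro _ ⟨x, hx, rfl⟩
    exact hmap i j hij n hn0 x hx

/-- The action of the general linear group on column vectors. -/
instance mulVecAction {n R : Type*} [Fintype n] [DecidableEq n] [CommRing R] :
    MulAction (GL n R) (n → R) where
  smul g y := (g : Matrix n n R) *ᵥ y
  one_smul y := Matrix.one_mulVec y
  mul_smul g h y := (Matrix.mulVec_mulVec y (g : Matrix n n R) h).symm

theorem GL_smul_eq_mulVec {n R : Type*} [Fintype n] [DecidableEq n] [CommRing R]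
    (g : GL n R) (y : n → R) : g • y = (g : Matrix n n R) *ᵥ y := rfl

/-- Injectivity of the entrywise map on general linear groups. -/
theorem GL_map_injective {n R S : Type*} [Fintype n] [DecidableEq n] [CommRing R] [CommRing S]
    {φ : R →+* S} (hφ : Function.Injective φ) :
    Function.Injective (GeneralLinearGroup.map (n := n) φ) :=
  Units.map_injective (f := (φ.mapMatrix (m := n)).toMonoidHom) (Matrix.map_injective hφ)

theorem companionMatrix_six {K : Type*} [CommRing K] (p : K[X]) : companionMatrix 6 p =
    !![0, 0, 0, 0, 0, -p.coeff 0;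
      1, 0, 0, 0, 0, -p.coeff 1;
      0, 1, 0, 0, 0, -p.coeff 2;
      0, 0, 1, 0, 0, -p.coeff 3;
      0, 0, 0, 1, 0, -p.coeff 4;
      0, 0, 0, 0, 1, -p.coeff 5] := by
  ext i j
  fin_cases i <;> fin_cases j <;> simp [companionMatrix]

namespace HypergeometricA5

/-- The companion matrix of `(x - 1) ^ 6`, over `ℤ`. -/
def a : GL (Fin 6) ℤ where
  val :=
    !![0, 0, 0, 0, 0, -1;
      1, 0, 0, 0, 0, 6;
      0, 1, 0, 0, 0, -15;
      0, 0, 1, 0, 0, 20;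
      0, 0, 0, 1, 0, -15;
      0, 0, 0, 0, 1, 6]
  inv :=
    !![6, 1, 0, 0, 0, 0;
      -15, 0, 1, 0, 0, 0;
      20, 0, 0, 1, 0, 0;
      -15, 0, 0, 0, 1, 0;
      6, 0, 0, 0, 0, 1;
      -1, 0, 0, 0, 0, 0]
  val_inv := by decide +kernel
  inv_val := by decide +kernel

/-- The negative of the companion matrix of `(x + 1) ^ 2 * (x ^ 2 + x + 1) ^ 2`, over `ℤ`. -/
def c : GL (Fin 6) ℤ where
  val :=
    !![0, 0, 0, 0, 0, 1;
      -1, 0, 0, 0, 0, 4;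
      0, -1, 0, 0, 0, 8;
      0, 0, -1, 0, 0, 10;
      0, 0, 0, -1, 0, 8;
      0, 0, 0, 0, -1, 4]
  inv :=
    !![4, -1, 0, 0, 0, 0;
      8, 0, -1, 0, 0, 0;
      10, 0, 0, -1, 0, 0;
      8, 0, 0, 0, -1, 0;
      4, 0, 0, 0, 0, -1;
      1, 0, 0, 0, 0, 0]
  val_inv := by decide +kernel
  inv_val := by decide +kernel

/-- The reflection-like generator `T`, over `ℤ`. -/
def t : GL (Fin 6) ℤ where
  val :=
    !![1, 0, 0, 0, 0, 0;
      10, 1, 0, 0, 0, 0;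
      -7, 0, 1, 0, 0, 0;
      30, 0, 0, 1, 0, 0;
      -7, 0, 0, 0, 1, 0;
      10, 0, 0, 0, 0, 1]
  inv :=
    !![1, 0, 0, 0, 0, 0;
      -10, 1, 0, 0, 0, 0;
      7, 0, 1, 0, 0, 0;
      -30, 0, 0, 1, 0, 0;
      7, 0, 0, 0, 1, 0;
      -10, 0, 0, 0, 0, 1]
  val_inv := by decide +kernel
  inv_val := by decide +kernel

/-- An involution that inverts both generators. -/
def invol : GL (Fin 6) ℤ where
  val :=
    !![1, 0, 0, 0, 0, 0;
      4, 0, 0, 0, 0, -1;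
      8, 0, 0, 0, -1, 0;
      10, 0, 0, -1, 0, 0;
      8, 0, -1, 0, 0, 0;
      4, -1, 0, 0, 0, 0]
  inv :=
    !![1, 0, 0, 0, 0, 0;
      4, 0, 0, 0, 0, -1;
      8, 0, 0, 0, -1, 0;
      10, 0, 0, -1, 0, 0;
      8, 0, -1, 0, 0, 0;
      4, -1, 0, 0, 0, 0]
  val_inv := by decide +kernel
  inv_val := by decide +kernel

/-- The nilpotent matrix `T - 1`. -/
def nilp : Matrix (Fin 6) (Fin 6) ℤ :=
    !![0, 0, 0, 0, 0, 0;
      10, 0, 0, 0, 0, 0;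
      -7, 0, 0, 0, 0, 0;
      30, 0, 0, 0, 0, 0;
      -7, 0, 0, 0, 0, 0;
      10, 0, 0, 0, 0, 0]

/-- The linear forms cutting out the ping-pong cone. -/
def form : Matrix (Fin 16) (Fin 6) ℤ :=
  !![35, -1, -1, -1, -1, -1;
    1, 1, 1, 1, 1, 1;
    58, 14, 2, 6, 23, 63;
    626, -63, -23, -6, -2, -14;
    3, 2, 1, 0, -1, -2;
    9, 1, -1, 0, 1, -1;
    54, -6, 6, -7, 5, 12;
    96, -12, -5, 7, -6, 6;
    0, -2, 3, 2, 1, 0;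
    44, 0, -1, -2, -3, 2;
    1059, -246, 0, 0, 0, 19;
    151, -19, 0, 0, 0, 246;
    144, -3, -16, 0, 0, -1;
    0, 1, 0, 0, 16, 3;
    5, 1, -1, -1, 1, 5;
    19, -5, -1, 1, 1, -1]

/-- The underlying matrix of an element of `GL (Fin 6) ℤ`. -/
abbrev mat (g : GL (Fin 6) ℤ) : Matrix (Fin 6) (Fin 6) ℤ := g

theorem mat_mul (g h : GL (Fin 6) ℤ) : mat (g * h) = mat g * mat h := rfl

/-- Membership in the open cone. -/
def Pos (y : Fin 6 → ℤ) : Prop := ∀ i, 0 < (form *ᵥ y) i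

/-- The matrix `M` maps the cone into itself. -/
def MapsPos (M : Matrix (Fin 6) (Fin 6) ℤ) : Prop := ∀ y, Pos y → Pos (M *ᵥ y)

/-- The matrix `M` is such that `M * T ^ n` preserves the cone for all `n ≥ 1`. -/
def Good (M : Matrix (Fin 6) (Fin 6) ℤ) : Prop := MapsPos (M * mat t) ∧ MapsPos (M * nilp)

theorem Pos.add {y z : Fin 6 → ℤ} (hy : Pos y) (hz : Pos z) : Pos (y + z) := by
  intro i
  rw [Matrix.mulVec_add]
  exact add_pos (hy i) (hz i)

theorem MapsPos.add {M N : Matrix (Fin 6) (Fin 6) ℤ} (hM : MapsPos M) (hN : MapsPos N) :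
    MapsPos (M + N) := by
  intro y hy
  rw [Matrix.add_mulVec]
  exact (hM y hy).add (hN y hy)

theorem MapsPos.mul {M N : Matrix (Fin 6) (Fin 6) ℤ} (hM : MapsPos M) (hN : MapsPos N) :
    MapsPos (M * N) := by
  intro y hy
  rw [← Matrix.mulVec_mulVec]
  exact hM _ (hN y hy)

theorem Good.add {M N : Matrix (Fin 6) (Fin 6) ℤ} (hM : Good M) (hN : Good N) :
    Good (M + N) := by
  refine ⟨?_, ?_⟩
  · rw [add_mul]
    exact hM.1.add hN.1
  · rw [add_mul]
    exact hM.2.add hN.2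

theorem form_mulVec (y : Fin 6 → ℤ) (i : Fin 16) : (form *ᵥ y) i =
    form i 0 * y 0 + form i 1 * y 1 + form i 2 * y 2 + form i 3 * y 3 + form i 4 * y 4 +
      form i 5 * y 5 := by
  simp [Matrix.mulVec, dotProduct, Fin.sum_univ_six]

theorem Pos.zero_lt {y : Fin 6 → ℤ} (hy : Pos y) : 0 < y 0 := by
  have h0 := hy 0
  have h1 := hy 1
  rw [form_mulVec] at h0 h1
  simp [form] at h0 h1
  linarith

theorem Pos.lt_nine_mul {y : Fin 6 → ℤ} (hy : Pos y) : y 5 < 9 * y 0 := by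
  have h4 := hy 4
  have h5 := hy 5
  have h10 := hy 10
  rw [form_mulVec] at h4 h5 h10
  simp [form] at h4 h5 h10
  linarith

theorem Pos.neg_lt {y : Fin 6 → ℤ} (hy : Pos y) : -y 0 < y 5 := by
  have h4 := hy 4
  have h5 := hy 5
  have h11 := hy 11
  rw [form_mulVec] at h4 h5 h11
  simp [form] at h4 h5 h11
  linarith

theorem sum_mulVec (l : List (ℕ × Fin 16)) (y : Fin 6 → ℤ) :
    (fun j => (l.map fun p => (p.1 : ℤ) * form p.2 j).sum) ⬝ᵥ y =
      (l.map fun p => (p.1 : ℤ) * (form *ᵥ y) p.2).sum := by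
  induction l with
  | nil => simp [dotProduct]
  | cons p l ih =>
    simp only [List.map_cons, List.sum_cons, ← ih]
    simp only [Matrix.mulVec, dotProduct, add_mul, Finset.sum_add_distrib, Finset.mul_sum,
      mul_assoc]

theorem sum_pos {l : List (ℕ × Fin 16)} {y : Fin 6 → ℤ} (hy : Pos y) (hl : l ≠ [])
    (hpos : ∀ p ∈ l, 0 < p.1) : 0 < (l.map fun p => (p.1 : ℤ) * (form *ᵥ y) p.2).sum := by
  apply List.sum_pos
  · intro x hx
    obtain ⟨p, hp, rfl⟩ := List.mem_map.mp hx
    exact mul_pos (by exact_mod_cast hpos p hp) (hy p.2)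
  · simpa using hl

/-- A criterion for `Good`: up to scaling, each form composed with `M * T` is a positive
combination of the forms. -/
theorem good_of_combinations {M : Matrix (Fin 6) (Fin 6) ℤ}
    (w : Fin 16 → ℕ × List (ℕ × Fin 16))
    (hw : ∀ i, 0 < (w i).1 ∧ (w i).2 ≠ [] ∧ (∀ p ∈ (w i).2, 0 < p.1) ∧
      ∀ j, ((w i).1 : ℤ) * (form * (M * mat t)) i j =
        ((w i).2.map fun p => (p.1 : ℤ) * form p.2 j).sum)
    (hM : ∀ i, 0 < (form * (M * nilp)) i 0 ∧ ∀ j, j ≠ 0 → (form * (M * nilp)) i j = 0) :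
    Good M := by
  refine ⟨fun y hy i => ?_, fun y hy i => ?_⟩
  · obtain ⟨hd, hne, hpos, hrow⟩ := hw i
    have key : ((w i).1 : ℤ) * (form *ᵥ ((M * mat t) *ᵥ y)) i =
        ((w i).2.map fun p => (p.1 : ℤ) * (form *ᵥ y) p.2).sum := by
      rw [← sum_mulVec, Matrix.mulVec_mulVec, Matrix.mulVec, dotProduct, dotProduct,
        Finset.mul_sum]
      refine Finset.sum_congr rfl fun j _ => ?_
      rw [← mul_assoc, hrow j]
    have := sum_pos hy hne hpos
    rw [← key] at this
    exact pos_of_mul_pos_right this (by positivity)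
  · rw [Matrix.mulVec_mulVec, Matrix.mulVec, dotProduct, Finset.sum_eq_single 0]
    · exact mul_pos (hM i).1 hy.zero_lt
    · intro j _ hj
      rw [(hM i).2 j hj, zero_mul]
    · simp

theorem map_a : (GeneralLinearGroup.map (Int.castRingHom ℚ) a : Matrix (Fin 6) (Fin 6) ℚ) =
    !![0, 0, 0, 0, 0, -1;
      1, 0, 0, 0, 0, 6;
      0, 1, 0, 0, 0, -15;
      0, 0, 1, 0, 0, 20;
      0, 0, 0, 1, 0, -15;
      0, 0, 0, 0, 1, 6] := by
  decide +kernel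

theorem map_neg_c :
    (GeneralLinearGroup.map (Int.castRingHom ℚ) (-c) : Matrix (Fin 6) (Fin 6) ℚ) =
    !![0, 0, 0, 0, 0, -1;
      1, 0, 0, 0, 0, -4;
      0, 1, 0, 0, 0, -8;
      0, 0, 1, 0, 0, -10;
      0, 0, 0, 1, 0, -8;
      0, 0, 0, 0, 1, -4] := by
  decide +kernel

theorem coe_c_zpow_zero : mat (c ^ (0 : ℤ)) = 1 := by
  rw [zpow_zero]
  rfl

theorem coe_c_zpow_one : mat (c ^ (1 : ℤ)) =
    !![0, 0, 0, 0, 0, 1;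
      -1, 0, 0, 0, 0, 4;
      0, -1, 0, 0, 0, 8;
      0, 0, -1, 0, 0, 10;
      0, 0, 0, -1, 0, 8;
      0, 0, 0, 0, -1, 4] := by
  rw [zpow_one]
  rfl

theorem coe_c_zpow_neg_one : mat (c ^ (-1 : ℤ)) =
    !![4, -1, 0, 0, 0, 0;
      8, 0, -1, 0, 0, 0;
      10, 0, 0, -1, 0, 0;
      8, 0, 0, 0, -1, 0;
      4, 0, 0, 0, 0, -1;
      1, 0, 0, 0, 0, 0] := by
  rw [_root_.zpow_neg_one]
  rfl

theorem coe_c_zpow_two : mat (c ^ (2 : ℤ)) =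
    !![0, 0, 0, 0, -1, 4;
      0, 0, 0, 0, -4, 15;
      1, 0, 0, 0, -8, 28;
      0, 1, 0, 0, -10, 32;
      0, 0, 1, 0, -8, 22;
      0, 0, 0, 1, -4, 8] := by
  rw [show c ^ (2 : ℤ) = c ^ (1 : ℤ) * c from _root_.zpow_add_one c 1, mat_mul, coe_c_zpow_one]
  decide +kernel

theorem coe_c_zpow_three : mat (c ^ (3 : ℤ)) =
    !![0, 0, 0, 1, -4, 8;
      0, 0, 0, 4, -15, 28;
      0, 0, 0, 8, -28, 49;
      -1, 0, 0, 10, -32, 52;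
      0, -1, 0, 8, -22, 32;
      0, 0, -1, 4, -8, 10] := by
  rw [show c ^ (3 : ℤ) = c ^ (2 : ℤ) * c from _root_.zpow_add_one c 2, mat_mul, coe_c_zpow_two]
  decide +kernel

theorem coe_c_zpow_four : mat (c ^ (4 : ℤ)) =
    !![0, 0, -1, 4, -8, 10;
      0, 0, -4, 15, -28, 32;
      0, 0, -8, 28, -49, 52;
      0, 0, -10, 32, -52, 51;
      1, 0, -8, 22, -32, 28;
      0, 1, -4, 8, -10, 8] := by
  rw [show c ^ (4 : ℤ) = c ^ (3 : ℤ) * c from _root_.zpow_add_one c 3, mat_mul, coe_c_zpow_three]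
  decide +kernel

theorem coe_c_zpow_five : mat (c ^ (5 : ℤ)) =
    !![0, 1, -4, 8, -10, 8;
      0, 4, -15, 28, -32, 22;
      0, 8, -28, 49, -52, 32;
      0, 10, -32, 52, -51, 28;
      0, 8, -22, 32, -28, 13;
      -1, 4, -8, 10, -8, 4] := by
  rw [show c ^ (5 : ℤ) = c ^ (4 : ℤ) * c from _root_.zpow_add_one c 4, mat_mul, coe_c_zpow_four]
  decide +kernel

theorem coe_c_zpow_six : mat (c ^ (6 : ℤ)) =
    !![-1, 4, -8, 10, -8, 4;
      -4, 15, -28, 32, -22, 8;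
      -8, 28, -49, 52, -32, 10;
      -10, 32, -52, 51, -28, 8;
      -8, 22, -32, 28, -13, 4;
      -4, 8, -10, 8, -4, 3] := by
  rw [show c ^ (6 : ℤ) = c ^ (5 : ℤ) * c from _root_.zpow_add_one c 5, mat_mul, coe_c_zpow_five]
  decide +kernel

theorem coe_c_zpow_neg_two : mat (c ^ (-2 : ℤ)) =
    !![8, -4, 1, 0, 0, 0;
      22, -8, 0, 1, 0, 0;
      32, -10, 0, 0, 1, 0;
      28, -8, 0, 0, 0, 1;
      15, -4, 0, 0, 0, 0;
      4, -1, 0, 0, 0, 0] := by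
  rw [show c ^ (-2 : ℤ) = c ^ (-1 : ℤ) * c⁻¹ by
    rw [← _root_.zpow_sub_one]; rfl, mat_mul, coe_c_zpow_neg_one]
  decide +kernel

theorem coe_c_zpow_neg_three : mat (c ^ (-3 : ℤ)) =
    !![10, -8, 4, -1, 0, 0;
      32, -22, 8, 0, -1, 0;
      52, -32, 10, 0, 0, -1;
      49, -28, 8, 0, 0, 0;
      28, -15, 4, 0, 0, 0;
      8, -4, 1, 0, 0, 0] := by
  rw [show c ^ (-3 : ℤ) = c ^ (-2 : ℤ) * c⁻¹ by
    rw [← _root_.zpow_sub_one]; rfl, mat_mul, coe_c_zpow_neg_two]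
  decide +kernel

theorem coe_c_zpow_neg_four : mat (c ^ (-4 : ℤ)) =
    !![8, -10, 8, -4, 1, 0;
      28, -32, 22, -8, 0, 1;
      51, -52, 32, -10, 0, 0;
      52, -49, 28, -8, 0, 0;
      32, -28, 15, -4, 0, 0;
      10, -8, 4, -1, 0, 0] := by
  rw [show c ^ (-4 : ℤ) = c ^ (-3 : ℤ) * c⁻¹ by
    rw [← _root_.zpow_sub_one]; rfl, mat_mul, coe_c_zpow_neg_three]
  decide +kernel

theorem coe_c_zpow_neg_five : mat (c ^ (-5 : ℤ)) =
    !![4, -8, 10, -8, 4, -1;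
      13, -28, 32, -22, 8, 0;
      28, -51, 52, -32, 10, 0;
      32, -52, 49, -28, 8, 0;
      22, -32, 28, -15, 4, 0;
      8, -10, 8, -4, 1, 0] := by
  rw [show c ^ (-5 : ℤ) = c ^ (-4 : ℤ) * c⁻¹ by
    rw [← _root_.zpow_sub_one]; rfl, mat_mul, coe_c_zpow_neg_four]
  decide +kernel

theorem coe_c_zpow_neg_six : mat (c ^ (-6 : ℤ)) =
    !![3, -4, 8, -10, 8, -4;
      4, -13, 28, -32, 22, -8;
      8, -28, 51, -52, 32, -10;
      10, -32, 52, -49, 28, -8;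
      8, -22, 32, -28, 15, -4;
      4, -8, 10, -8, 4, -1] := by
  rw [show c ^ (-6 : ℤ) = c ^ (-5 : ℤ) * c⁻¹ by
    rw [← _root_.zpow_sub_one]; rfl, mat_mul, coe_c_zpow_neg_five]
  decide +kernel

theorem good_c_zpow_one : Good (mat (c ^ (1 : ℤ))) := by
  rw [coe_c_zpow_one]
  exact good_of_combinations
    ![(1, [(1, 0), (2, 1)]),
      (42887, [(12012, 7), (23100, 2), (46212, 4), (71610, 8), (118722, 9), (171347, 0)]),
      (128661, [(744861, 7), (1204794, 2), (3922131, 4), (4112267, 8), (7805834, 0),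
          (7910347, 9)]),
      (480600, [(45792, 3), (226107, 12), (743913, 13), (777782, 0), (6318576, 9),
          (14650886, 1)]),
      (840, [(36, 2), (36, 3), (65, 0), (84, 5), (905, 1)]),
      (876650, [(42575, 7), (85347, 6), (120050, 2), (310185, 9), (448054, 4), (677176, 0)]),
      (42887, [(16575, 7), (18009, 4), (48370, 2), (128630, 0), (321495, 8), (567520, 9)]),
      (242730, [(149973, 3), (335973, 2), (339450, 7), (814937, 5), (1017885, 9), (4608395, 4)]),
      (275094, [(90954, 6), (131750, 2), (159464, 7), (789943, 8), (1369396, 5), (1562525, 9)]),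
      (129456, [(5828, 2), (34100, 7), (133475, 9), (190825, 8), (272490, 4), (293734, 5)]),
      (438325, [(1188925, 2), (1188982, 6), (1322385, 9), (2140350, 7), (11148356, 0),
          (13660749, 4)]),
      (876650, [(14329400, 2), (15482901, 6), (31560425, 7), (53085305, 9), (92348458, 0),
          (181679682, 4)]),
      (99831, [(7551, 9), (10027, 7), (26962, 2), (216859, 0), (371923, 5), (592544, 4)]),
      (2067006, [(1010337, 7), (1568721, 6), (3537198, 2), (9250154, 8), (9484094, 0),
          (29701405, 9)]),
      (174525, [(4920, 11), (16269, 6), (30231, 7), (197642, 0), (500325, 9), (926033, 1)]),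
      (19295, [(480, 11), (1362, 6), (2270, 14), (7491, 0), (8034, 4), (25740, 5)])]
    (by decide +kernel) (by decide +kernel)

theorem good_c_zpow_two : Good (mat (c ^ (2 : ℤ))) := by
  rw [coe_c_zpow_two]
  exact good_of_combinations
    ![(87665, [(42966, 6), (46200, 2), (66990, 7), (105570, 9), (321893, 0), (324552, 4)]),
      (42887, [(73836, 2), (100152, 7), (280356, 8), (489361, 0), (586272, 9), (630540, 4)]),
      (184656, [(83799, 12), (3491385, 13), (6583598, 8), (7565424, 7), (78156034, 9),
          (101820232, 1)]),
      (42399, [(21123, 12), (40752, 7), (78669, 11), (1335780, 9), (4374535, 0), (6167245, 1)]),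
      (3299, [(780, 7), (1500, 2), (3215, 4), (4650, 8), (8770, 0), (10794, 9)]),
      (43152, [(18476, 2), (19964, 7), (77934, 4), (113266, 5), (144115, 8), (290993, 9)]),
      (209430, [(50580, 11), (245151, 6), (1208529, 7), (5213603, 0), (9849375, 9),
          (20681867, 1)]),
      (1314975, [(3743883, 6), (4775075, 2), (10014050, 7), (12783915, 9), (39083939, 0),
          (62034806, 4)]),
      (876650, [(1861950, 2), (2108573, 6), (4584625, 7), (8829765, 9), (10844534, 0),
          (27098736, 4)]),
      (70956, [(30816, 2), (35892, 7), (41130, 8), (158058, 9), (391163, 1), (451535, 0)]),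
      (438325, [(5130750, 2), (5183623, 6), (11165350, 7), (12571715, 9), (39184984, 0),
          (66220211, 4)]),
      (1314975, [(56734625, 2), (56984271, 6), (149048430, 9), (168067325, 7), (496408418, 0),
          (1030418597, 4)]),
      (52599, [(60513, 6), (63371, 2), (84318, 9), (89258, 7), (465404, 0), (506192, 4)]),
      (1314975, [(7365175, 2), (10518393, 6), (21396550, 7), (34695844, 0), (40848690, 9),
          (125726176, 4)]),
      (2700, [(468, 4), (1620, 8), (3024, 7), (9925, 0), (23400, 9), (45817, 1)]),
      (258912, [(51212, 7), (58652, 2), (253906, 5), (311550, 4), (412339, 8), (896993, 9)])]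
    (by decide +kernel) (by decide +kernel)

theorem good_c_zpow_three : Good (mat (c ^ (3 : ℤ))) := by
  rw [coe_c_zpow_three]
  exact good_of_combinations
    ![(438325, [(734700, 2), (841068, 6), (1854300, 7), (3308040, 9), (4446419, 0),
          (10948476, 4)]),
      (438325, [(1597554, 6), (1717800, 2), (2777670, 9), (5646750, 7), (17754457, 0),
          (35306628, 4)]),
      (1808715, [(51159405, 3), (82665530, 2), (234514214, 7), (849468735, 9), (1000556812, 1),
          (1918869203, 4)]),
      (262995, [(6823865, 2), (7684839, 6), (18270995, 7), (26540910, 9), (46710752, 0),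
          (108531803, 4)]),
      (238500, [(15768, 11), (236268, 8), (343440, 7), (1573621, 0), (3646512, 9),
          (6705529, 1)]),
      (225, [(27, 4), (180, 8), (486, 7), (1625, 0), (3825, 9), (7538, 1)]),
      (1860, [(34534, 4), (35712, 7), (78235, 8), (168250, 5), (283145, 9), (338396, 1)]),
      (5400, [(1116, 4), (15120, 5), (68688, 7), (261055, 0), (514260, 9), (1100359, 1)]),
      (95550, [(527736, 7), (537000, 12), (1704852, 4), (2350505, 8), (6665275, 9),
          (9139588, 1)]),
      (666345, [(444546, 2), (536478, 7), (1022223, 12), (5795863, 8), (16871522, 1),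
          (17442935, 9)]),
      (2225, [(69304, 6), (72750, 2), (186145, 9), (197825, 7), (627882, 0), (1199553, 4)]),
      (300, [(55812, 7), (62080, 5), (103384, 4), (200145, 0), (236940, 9), (601041, 1)]),
      (1314975, [(5439100, 2), (6162942, 6), (12883600, 7), (23529135, 9), (32620936, 0),
          (74027194, 4)]),
      (128661, [(1758296, 2), (4424186, 7), (5502182, 8), (6905233, 9), (20185792, 0),
          (28802834, 4)]),
      (128661, [(151157, 9), (196390, 2), (351487, 8), (513838, 7), (2731307, 0), (3361108, 4)]),
      (1314975, [(910850, 2), (1083786, 6), (2318730, 9), (3030200, 7), (7877663, 0),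
          (18337952, 4)])]
    (by decide +kernel) (by decide +kernel)

theorem good_c_zpow_four : Good (mat (c ^ (4 : ℤ))) := by
  rw [coe_c_zpow_four]
  exact good_of_combinations
    ![(438325, [(1597554, 6), (1717800, 2), (2777670, 9), (5646750, 7), (17754457, 0),
          (35306628, 4)]),
      (60, [(180, 8), (360, 2), (1224, 7), (2107, 1), (6655, 0), (7308, 4)]),
      (8190, [(340560, 5), (686310, 2), (2538042, 7), (5915891, 1), (13877045, 0),
          (14492364, 4)]),
      (262995, [(13147203, 6), (15697780, 2), (17594685, 9), (50691850, 7), (172691674, 0),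
          (318213121, 4)]),
      (438325, [(325080, 9), (937836, 6), (1178100, 2), (4075200, 7), (14353588, 0),
          (25756477, 4)]),
      (421967, [(154209, 3), (469776, 6), (1234630, 2), (3664669, 7), (13233998, 0),
          (26018531, 4)]),
      (2592, [(32652, 8), (46152, 2), (140328, 7), (167117, 1), (776237, 0), (871668, 4)]),
      (6329505, [(9841750, 3), (43943209, 6), (109050365, 2), (318583445, 7), (1226514322, 0),
          (2222238543, 4)]),
      (28665, [(51615, 3), (252585, 2), (619753, 1), (736281, 7), (2966440, 0), (5448807, 4)]),
      (876650, [(3766909, 6), (3946750, 2), (8618395, 9), (12516825, 7), (37887022, 0),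
          (78594588, 4)]),
      (27864, [(383184, 12), (3456216, 7), (5239332, 4), (14037139, 0), (18709668, 9),
          (46712035, 1)]),
      (16380, [(1667160, 2), (5482320, 5), (6612372, 7), (15703721, 1), (34532225, 0),
          (36691944, 4)]),
      (2629950, [(26307903, 6), (26761000, 2), (59883465, 9), (84827575, 7), (253190524, 0),
          (525842446, 4)]),
      (1092, [(18436, 2), (25036, 5), (74932, 7), (189047, 1), (397215, 0), (413744, 4)]),
      (2730, [(4580, 2), (17888, 7), (18560, 5), (41589, 1), (93275, 0), (98656, 4)]),
      (8928, [(6820, 2), (32116, 7), (97469, 8), (143778, 4), (145519, 9), (188366, 5)])]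
    (by decide +kernel) (by decide +kernel)

theorem good_c_zpow_five : Good (mat (c ^ (5 : ℤ))) := by
  rw [coe_c_zpow_five]
  exact good_of_combinations
    ![(3185, [(5400, 3), (23460, 2), (31464, 1), (64428, 7), (243655, 0), (500136, 4)]),
      (65, [(360, 2), (1872, 7), (4320, 5), (4951, 1), (8580, 0), (9504, 4)]),
      (390, [(32550, 2), (165906, 7), (415430, 5), (425723, 1), (755885, 0), (847022, 4)]),
      (114660, [(510840, 3), (10100280, 2), (34078044, 7), (65982037, 1), (178494325, 0),
          (209439048, 4)]),
      (455, [(1320, 2), (4920, 5), (5928, 7), (15649, 1), (30030, 0), (31741, 4)]),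
      (910, [(2540, 2), (11258, 7), (15010, 5), (28349, 1), (55965, 0), (60166, 4)]),
      (2340, [(41460, 2), (186576, 7), (343080, 5), (456503, 1), (902135, 0), (992832, 4)]),
      (1365, [(24450, 2), (99801, 7), (104120, 5), (238958, 1), (512330, 0), (549137, 4)]),
      (16380, [(109140, 2), (591396, 7), (1440720, 5), (1595863, 1), (2672215, 0),
          (2962572, 4)]),
      (27300, [(259368, 7), (444450, 12), (1495265, 8), (1845276, 4), (2596975, 9),
          (3745744, 1)]),
      (8190, [(129420, 5), (814770, 2), (2754882, 7), (5845831, 1), (15489565, 0),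
          (16201404, 4)]),
      (2730, [(285210, 2), (1396356, 7), (3340423, 1), (4131410, 5), (6264895, 0),
          (7223732, 4)]),
      (301190, [(1104060, 11), (3131530, 12), (11573466, 7), (83870762, 4), (95326635, 0),
          (96838433, 1)]),
      (2730, [(43700, 2), (244946, 7), (650803, 1), (720050, 5), (1071525, 0), (1210672, 4)]),
      (1365, [(2540, 2), (11258, 7), (24709, 1), (32300, 5), (51870, 0), (60166, 4)]),
      (2730, [(4580, 2), (17888, 7), (18560, 5), (41589, 1), (93275, 0), (98656, 4)])]
    (by decide +kernel) (by decide +kernel)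

theorem good_c_zpow_six : Good (mat (c ^ (6 : ℤ))) := by
  rw [coe_c_zpow_six]
  exact good_of_combinations
    ![(65, [(360, 2), (1872, 7), (4320, 5), (4951, 1), (8580, 0), (9504, 4)]),
      (65, [(360, 2), (1872, 7), (3976, 1), (7475, 0), (9000, 5), (9504, 4)]),
      (2340, [(201780, 2), (980928, 7), (1941989, 1), (3967925, 0), (4737960, 5), (5106096, 4)]),
      (390, [(32850, 2), (163488, 7), (376910, 5), (418229, 1), (755885, 0), (841916, 4)]),
      (455, [(1200, 2), (7176, 7), (19008, 1), (25320, 5), (30030, 0), (34787, 4)]),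
      (130, [(360, 2), (1872, 7), (4431, 1), (6790, 5), (7995, 0), (9504, 4)]),
      (1365, [(24870, 2), (120003, 7), (258824, 1), (469520, 5), (512330, 0), (626291, 4)]),
      (16380, [(298440, 2), (1472796, 7), (3479443, 1), (4662360, 5), (6521515, 0),
          (7608312, 4)]),
      (3276, [(21816, 2), (115128, 7), (242113, 1), (451633, 0), (580716, 4), (582840, 5)]),
      (2322, [(30564, 12), (54000, 7), (100530, 9), (244692, 4), (278711, 0), (607967, 1)]),
      (390, [(41450, 2), (187694, 7), (391190, 5), (451727, 1), (894985, 0), (998158, 4)]),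
      (8190, [(938550, 2), (3976986, 7), (6557513, 1), (16522415, 0), (19567260, 5),
          (21856152, 4)]),
      (2730, [(46880, 2), (226616, 7), (397850, 5), (590773, 1), (1082445, 0), (1180822, 4)]),
      (2730, [(46000, 2), (222664, 7), (405317, 1), (864045, 0), (1159358, 4), (1235410, 5)]),
      (210, [(440, 2), (1724, 7), (2687, 1), (7520, 5), (7525, 0), (9808, 4)]),
      (1365, [(2540, 2), (11258, 7), (24709, 1), (32300, 5), (51870, 0), (60166, 4)])]
    (by decide +kernel) (by decide +kernel)

theorem good_neg_c_zpow_neg_one : Good (-mat (c ^ (-1 : ℤ))) := by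
  rw [coe_c_zpow_neg_one]
  exact good_of_combinations
    ![(31598, [(11028, 2), (13495, 12), (30744, 9), (36278, 14), (165723, 5), (395011, 4)]),
      (1, [(1, 1)]),
      (3405, [(39, 11), (2724, 2), (9534, 14), (15683, 5), (67439, 4)]),
      (209975, [(193177, 7), (520520, 11), (2614586, 1), (4398125, 9), (43519589, 4),
          (53998590, 5)]),
      (1, [(1, 1), (1, 4)]),
      (2, [(1, 1), (2, 5), (3, 14), (6, 4)]),
      (99831, [(87275, 2), (145214, 7), (300008, 0), (320577, 9), (1688454, 5), (2261573, 4)]),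
      (7491, [(1440, 11), (3405, 7), (61290, 14), (238163, 4), (249740, 5)]),
      (15288, [(76, 2), (132, 3), (3640, 7), (7775, 0), (28495, 1), (30212, 5)]),
      (5124, [(2136, 2), (2697, 12), (5124, 9), (7692, 14), (30853, 5), (82549, 4)]),
      (36556, [(445416, 2), (923949, 12), (1813024, 1), (2242760, 9), (7592393, 5),
          (12921705, 4)]),
      (10896, [(7476, 11), (12939, 12), (608719, 4), (608719, 5)]),
      (1708, [(780, 2), (1539, 12), (32008, 14), (35915, 5), (85863, 4)]),
      (3981168, [(3186, 2), (157590, 6), (214398, 11), (1945242, 9), (4969367, 0),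
          (9943865, 1)]),
      (1, [(1, 14), (2, 4)]),
      (31598, [(6600, 2), (11807, 12), (19958, 14), (25620, 9), (132275, 5), (195575, 4)])]
    (by decide +kernel) (by decide +kernel)

theorem good_neg_c_zpow_neg_two : Good (-mat (c ^ (-2 : ℤ))) := by
  rw [coe_c_zpow_neg_two]
  exact good_of_combinations
    ![(2390, [(3825, 13), (11160, 9), (12747, 12), (28356, 14), (53066, 1), (106752, 4)]),
      (31598, [(11028, 2), (13495, 12), (30744, 9), (36278, 14), (165723, 5), (395011, 4)]),
      (134384, [(128228, 11), (570224, 2), (732075, 12), (2651360, 9), (20661823, 5),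
          (26091663, 4)]),
      (4680, [(854, 1), (88083, 13), (133560, 2), (409833, 12), (507374, 0), (3867048, 4)]),
      (277167, [(2724, 7), (34050, 14), (35868, 11), (269676, 9), (3011773, 4), (3525928, 5)]),
      (67192, [(8964, 11), (25197, 12), (114408, 9), (161624, 1), (773865, 4), (1022657, 5)]),
      (8892, [(11231, 13), (31248, 2), (31357, 5), (76634, 12), (134136, 0), (848973, 4)]),
      (26429, [(955, 3), (84949, 13), (118120, 2), (370104, 12), (385842, 0), (3556047, 4)]),
      (29640, [(4201, 13), (14280, 2), (26948, 1), (28771, 12), (53348, 0), (458176, 4)]),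
      (68088, [(70128, 14), (126456, 2), (160669, 13), (344304, 9), (455167, 12), (4448320, 4)]),
      (4446, [(157158, 2), (558675, 12), (654081, 5), (1240187, 0), (1390955, 1), (4419483, 4)]),
      (109668, [(782892, 2), (1931553, 12), (4869852, 9), (7126044, 1), (14403461, 5),
          (24926465, 4)]),
      (76183, [(281667, 7), (382773, 2), (508931, 12), (2019879, 9), (9723580, 4),
          (9888368, 5)]),
      (327561, [(50394, 2), (77727, 11), (717093, 9), (804261, 1), (8115385, 4), (8303341, 5)]),
      (89192, [(4152, 6), (14040, 2), (24073, 13), (71163, 12), (144368, 14), (784024, 4)]),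
      (370, [(284, 14), (683, 12), (1680, 9), (3075, 5), (3443, 4), (5494, 1)])]
    (by decide +kernel) (by decide +kernel)

theorem good_neg_c_zpow_neg_three : Good (-mat (c ^ (-3 : ℤ))) := by
  rw [coe_c_zpow_neg_three]
  exact good_of_combinations
    ![(33277, [(99780, 2), (291480, 7), (489636, 9), (495073, 0), (2389284, 4), (3773928, 5)]),
      (13829, [(21060, 9), (24156, 2), (50742, 12), (88987, 0), (210402, 5), (599994, 4)]),
      (114178, [(2187422, 2), (3130377, 13), (8967608, 9), (9681725, 12), (11433008, 1),
          (83328430, 4)]),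
      (48, [(3791, 8), (9045, 12), (20677, 9), (26675, 5), (35279, 4), (63820, 1)]),
      (239, [(300, 13), (1044, 9), (1056, 12), (1746, 14), (4551, 1), (7487, 4)]),
      (494, [(108, 2), (1755, 12), (4446, 9), (8147, 5), (9489, 4), (12690, 1)]),
      (99831, [(622159, 2), (1593373, 7), (1804507, 0), (3845592, 9), (15350356, 4),
          (23343234, 5)]),
      (8352, [(54580, 2), (138233, 8), (188740, 7), (561667, 9), (1470810, 4), (2794454, 5)]),
      (34044, [(3072, 14), (57456, 2), (66355, 13), (170832, 9), (190021, 12), (1941832, 4)]),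
      (7215, [(13110, 2), (72618, 7), (262434, 1), (265980, 9), (464521, 4), (1134205, 5)]),
      (111, [(528, 2), (20925, 7), (82863, 9), (85705, 4), (133632, 1), (286762, 5)]),
      (1434, [(37961, 13), (150955, 12), (173329, 14), (196032, 9), (781927, 1), (1001782, 4)]),
      (99831, [(1043816, 2), (3266174, 7), (4005081, 9), (6740288, 0), (24726436, 4),
          (38771750, 5)]),
      (3416, [(13620, 2), (21086, 14), (29501, 12), (60634, 0), (110921, 5), (381217, 4)]),
      (99831, [(52214, 2), (126551, 0), (138962, 7), (330156, 9), (1302382, 4), (2152082, 5)]),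
      (930, [(175, 8), (2976, 7), (11222, 4), (11645, 9), (19778, 1), (39410, 5)])]
    (by decide +kernel) (by decide +kernel)

theorem good_neg_c_zpow_neg_four : Good (-mat (c ^ (-4 : ℤ))) := by
  rw [coe_c_zpow_neg_four]
  exact good_of_combinations
    ![(455, [(1537, 1), (2580, 2), (9204, 7), (31850, 0), (58908, 4), (69180, 5)]),
      (33277, [(99780, 2), (291480, 7), (489636, 9), (495073, 0), (2389284, 4), (3773928, 5)]),
      (99831, [(4555784, 2), (13522127, 7), (19445931, 9), (26493554, 0), (108850739, 4),
          (164241618, 5)]),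
      (8190, [(686310, 2), (979141, 1), (2538042, 7), (8940295, 0), (15903774, 4),
          (18181110, 5)]),
      (1266, [(864, 2), (6300, 9), (12096, 12), (22643, 0), (52698, 4), (70571, 1)]),
      (33277, [(74201, 2), (100125, 9), (246233, 7), (737338, 0), (1713085, 4), (2222080, 5)]),
      (99831, [(1307953, 2), (2336856, 9), (4198180, 7), (12195742, 0), (30182502, 4),
          (39104099, 5)]),
      (99831, [(530424, 9), (1581061, 2), (5302567, 7), (17990131, 0), (35948788, 4),
          (41397414, 5)]),
      (99831, [(339408, 2), (939201, 7), (1250997, 0), (1982802, 9), (8168210, 4),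
          (13196435, 5)]),
      (4095, [(28304, 1), (28710, 2), (105183, 7), (363545, 0), (659586, 4), (785415, 5)]),
      (4095, [(416790, 2), (1348924, 1), (1653093, 7), (6056050, 0), (9919641, 4),
          (10622550, 5)]),
      (24900, [(309672, 7), (1005780, 2), (5501640, 12), (14058125, 0), (23235941, 1),
          (34212624, 4)]),
      (1092, [(18436, 2), (55823, 1), (74932, 7), (263991, 0), (441044, 4), (517528, 5)]),
      (9560, [(82085, 13), (171504, 14), (356863, 12), (516960, 9), (1856408, 4), (1922424, 1)]),
      (4118, [(2365, 12), (5200, 2), (14368, 7), (53534, 0), (120377, 5), (120825, 4)]),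
      (1365, [(2290, 2), (7372, 1), (8944, 7), (33215, 0), (54788, 4), (55690, 5)])]
    (by decide +kernel) (by decide +kernel)

theorem good_neg_c_zpow_neg_five : Good (-mat (c ^ (-5 : ℤ))) := by
  rw [coe_c_zpow_neg_five]
  exact good_of_combinations
    ![(65, [(360, 2), (1872, 7), (3716, 1), (7345, 0), (9000, 5), (9504, 4)]),
      (455, [(1537, 1), (2580, 2), (9204, 7), (31850, 0), (58908, 4), (69180, 5)]),
      (8190, [(486013, 1), (684960, 2), (2434146, 7), (8522605, 0), (15667362, 4),
          (17911020, 5)]),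
      (1170, [(97650, 2), (497718, 7), (991949, 1), (1982435, 0), (2299680, 5), (2557836, 4)]),
      (455, [(1320, 2), (5928, 7), (7004, 1), (21385, 0), (32651, 4), (37680, 5)]),
      (450, [(4914, 7), (9065, 0), (11430, 9), (14598, 4), (30377, 1), (40410, 5)]),
      (3870, [(84474, 7), (253800, 12), (258570, 9), (783125, 0), (1054278, 4), (2330477, 1)]),
      (585, [(10365, 2), (46644, 7), (68902, 1), (180310, 0), (249375, 5), (257958, 4)]),
      (1032, [(2832, 7), (25668, 9), (27696, 12), (56609, 0), (99540, 4), (215057, 1)]),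
      (5460, [(36380, 2), (197132, 7), (417901, 1), (776685, 0), (918860, 5), (978424, 4)]),
      (1800, [(822888, 7), (1711260, 9), (2035955, 0), (2371116, 4), (5018520, 5),
          (5343059, 1)]),
      (4095, [(67108, 1), (407385, 2), (1377441, 7), (4888975, 0), (9210447, 4), (10068795, 5)]),
      (5460, [(87400, 2), (489892, 7), (1144631, 1), (1986075, 0), (2029780, 5), (2394044, 4)]),
      (1290, [(6102, 7), (79290, 9), (81330, 12), (154255, 0), (291594, 4), (623581, 1)]),
      (1365, [(2290, 2), (7372, 1), (8944, 7), (33215, 0), (54788, 4), (55690, 5)]),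
      (2730, [(5080, 2), (22516, 7), (38953, 1), (93275, 0), (97360, 5), (125792, 4)])]
    (by decide +kernel) (by decide +kernel)

theorem good_neg_c_zpow_neg_six : Good (-mat (c ^ (-6 : ℤ))) := by
  rw [coe_c_zpow_neg_six]
  exact good_of_combinations
    ![(65, [(360, 2), (1872, 7), (4320, 5), (5081, 1), (8580, 0), (9504, 4)]),
      (65, [(360, 2), (1872, 7), (3716, 1), (7345, 0), (9000, 5), (9504, 4)]),
      (2340, [(197100, 2), (980928, 7), (1841239, 1), (3867175, 0), (4737960, 5), (5106096, 4)]),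
      (390, [(33630, 2), (163488, 7), (378730, 5), (418229, 1), (755885, 0), (860116, 4)]),
      (455, [(1200, 2), (7176, 7), (19008, 1), (25320, 5), (30030, 0), (33877, 4)]),
      (130, [(360, 2), (1872, 7), (4431, 1), (6530, 5), (7995, 0), (9504, 4)]),
      (1365, [(24870, 2), (122733, 7), (258824, 1), (487720, 5), (512330, 0), (641761, 4)]),
      (16380, [(298440, 2), (1440036, 7), (3272873, 1), (4662360, 5), (6314945, 0),
          (7608312, 4)]),
      (129, [(1944, 7), (3165, 9), (3348, 12), (14266, 0), (15552, 4), (35110, 1)]),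
      (2322, [(30564, 12), (54000, 7), (95886, 9), (244692, 4), (280259, 0), (609515, 1)]),
      (2730, [(312850, 2), (1325662, 7), (2943261, 1), (3045310, 5), (6264895, 0),
          (7526534, 4)]),
      (1170, [(124350, 2), (563082, 7), (883021, 1), (2212795, 0), (2870460, 5), (3097824, 4)]),
      (2730, [(46000, 2), (222664, 7), (356350, 5), (612797, 1), (1071525, 0), (1175738, 4)]),
      (1161, [(38124, 7), (71694, 9), (74817, 12), (293771, 0), (335952, 4), (755435, 1)]),
      (387, [(1458, 7), (2124, 12), (3438, 9), (9689, 0), (10890, 4), (25322, 1)]),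
      (105, [(220, 2), (862, 7), (1571, 1), (2500, 5), (3990, 0), (5114, 4)])]
    (by decide +kernel) (by decide +kernel)

theorem good_c_zpow_sub_one : Good (mat (c ^ (1 : ℤ)) - mat (c ^ (-5 : ℤ))) := by
  rw [coe_c_zpow_one, coe_c_zpow_neg_five]
  exact good_of_combinations
    ![(65, [(360, 2), (1872, 7), (3846, 1), (7410, 0), (9000, 5), (9504, 4)]),
      (91, [(366, 1), (576, 2), (1872, 7), (7098, 0), (12024, 4), (13464, 5)]),
      (1365, [(74278, 1), (131370, 2), (415896, 7), (1619800, 0), (2711022, 4), (2870460, 5)]),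
      (1365, [(115530, 2), (580632, 7), (1178326, 1), (2340520, 0), (2680380, 5), (2992974, 4)]),
      (2, [(3, 0), (36, 12), (54, 8), (54, 9), (108, 4), (159, 1)]),
      (455, [(1350, 2), (5616, 7), (7188, 1), (21840, 0), (31662, 4), (32580, 5)]),
      (2730, [(53700, 2), (196591, 1), (201552, 7), (799435, 0), (1184940, 5), (1197564, 4)]),
      (775, [(55428, 7), (66890, 8), (157046, 4), (200500, 9), (251224, 1), (554450, 5)]),
      (311, [(420, 9), (2394, 2), (7440, 7), (27662, 0), (49010, 4), (56936, 5)]),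
      (1365, [(9090, 2), (49608, 7), (109169, 1), (197015, 0), (229200, 5), (246606, 4)]),
      (2730, [(293520, 2), (1402752, 7), (2860861, 1), (5788140, 5), (5879965, 0),
          (7398864, 4)]),
      (2730, [(12919, 1), (334380, 2), (977808, 7), (4020835, 0), (6278460, 5), (6671556, 4)]),
      (35, [(570, 2), (3144, 7), (7332, 1), (12810, 0), (13140, 5), (15558, 4)]),
      (33277, [(482976, 9), (602958, 2), (1775064, 7), (6491778, 0), (12063858, 4),
          (14191308, 5)]),
      (91, [(192, 2), (395, 1), (624, 7), (2639, 0), (3396, 5), (4008, 4)]),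
      (455, [(900, 2), (3744, 7), (6157, 1), (15925, 0), (16260, 5), (21108, 4)])]
    (by decide +kernel) (by decide +kernel)

theorem good_c_zpow_sub_two : Good (mat (c ^ (2 : ℤ)) - mat (c ^ (-4 : ℤ))) := by
  rw [coe_c_zpow_two, coe_c_zpow_neg_four]
  exact good_of_combinations
    ![(91, [(366, 1), (576, 2), (1872, 7), (7098, 0), (12024, 4), (13464, 5)]),
      (20, [(27, 13), (221, 0), (297, 12), (900, 9), (972, 4), (2741, 1)]),
      (33277, [(2791162, 2), (6139468, 7), (6899082, 9), (24960574, 0), (45495150, 5),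
          (49958716, 4)]),
      (2730, [(259500, 2), (337529, 1), (865488, 7), (3350165, 0), (5479716, 4), (5849460, 5)]),
      (2035, [(2790, 12), (9936, 7), (36522, 4), (59400, 9), (110298, 1), (151830, 5)]),
      (13748, [(40672, 2), (54013, 13), (88168, 7), (88495, 12), (366280, 0), (1151840, 4)]),
      (5805, [(30996, 7), (312930, 12), (602390, 0), (695070, 9), (1026612, 4), (3029438, 1)]),
      (33277, [(206256, 9), (680174, 2), (1943000, 7), (7885418, 0), (12967164, 5),
          (13440530, 4)]),
      (33277, [(211114, 2), (421252, 7), (747678, 9), (1588674, 0), (3656544, 4), (3695954, 5)]),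
      (546, [(4164, 2), (5501, 1), (14352, 7), (53417, 0), (89244, 4), (103476, 5)]),
      (1365, [(159210, 2), (471893, 1), (571896, 7), (2282735, 0), (3406560, 5), (3477822, 4)]),
      (2697, [(191332, 2), (625084, 7), (1197170, 8), (2685976, 9), (4003278, 4), (6950534, 5)]),
      (910, [(16620, 2), (50157, 1), (63024, 7), (236145, 0), (372468, 4), (423300, 5)]),
      (33277, [(531318, 2), (1019028, 7), (1733886, 9), (4257726, 0), (7647306, 5),
          (9085956, 4)]),
      (3870, [(4968, 7), (18360, 12), (47155, 0), (52020, 9), (69156, 4), (209299, 1)]),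
      (91, [(192, 2), (395, 1), (624, 7), (2639, 0), (3396, 5), (4008, 4)])]
    (by decide +kernel) (by decide +kernel)

theorem good_c_zpow_sub_three : Good (mat (c ^ (3 : ℤ)) - mat (c ^ (-3 : ℤ))) := by
  rw [coe_c_zpow_three, coe_c_zpow_neg_three]
  exact good_of_combinations
    ![(211, [(216, 2), (3024, 12), (5186, 0), (7272, 9), (11592, 4), (26030, 1)]),
      (33277, [(209736, 2), (247752, 9), (396576, 7), (616392, 5), (2340972, 0), (3570552, 4)]),
      (5805, [(454356, 7), (626670, 12), (2309725, 0), (3167352, 4), (4683870, 9),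
          (12467593, 1)]),
      (9889, [(721308, 2), (2863005, 12), (3044663, 5), (5039328, 9), (6257442, 8),
          (17004275, 4)]),
      (311, [(816, 2), (1320, 7), (3024, 9), (6222, 0), (8376, 5), (13260, 4)]),
      (1964, [(1495, 13), (5917, 12), (6280, 2), (8920, 7), (64768, 0), (120776, 4)]),
      (6177, [(48828, 12), (131554, 2), (234328, 7), (486592, 5), (1503070, 0), (2345210, 4)]),
      (33277, [(635558, 2), (1051518, 9), (1392692, 7), (6467606, 0), (7533450, 5),
          (11360804, 4)]),
      (33277, [(260844, 2), (261858, 9), (392698, 5), (487044, 7), (2986468, 0), (4423138, 4)]),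
      (764, [(2673, 13), (3242, 8), (15279, 12), (45262, 9), (53856, 4), (117656, 1)]),
      (10, [(745, 8), (2268, 7), (6426, 4), (12455, 9), (19644, 1), (27570, 5)]),
      (273, [(14809, 1), (35130, 2), (80184, 7), (122352, 5), (456547, 0), (637038, 4)]),
      (8, [(330, 5), (378, 12), (453, 0), (972, 9), (1134, 4), (3549, 1)]),
      (1935, [(30510, 12), (38988, 7), (168670, 0), (201996, 4), (324450, 9), (823294, 1)]),
      (455, [(523, 1), (1020, 2), (2496, 7), (6780, 5), (13195, 0), (18972, 4)]),
      (775, [(2265, 8), (3348, 7), (9486, 4), (18075, 9), (26784, 1), (36150, 5)])]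
    (by decide +kernel) (by decide +kernel)

theorem good_c_zpow_sub_four : Good (mat (c ^ (4 : ℤ)) - mat (c ^ (-2 : ℤ))) := by
  rw [coe_c_zpow_four, coe_c_zpow_neg_two]
  exact good_of_combinations
    ![(33277, [(209736, 2), (247752, 9), (396576, 7), (616392, 5), (2340972, 0), (3570552, 4)]),
      (91, [(360, 5), (576, 2), (1872, 7), (3642, 1), (10374, 0), (12024, 4)]),
      (1365, [(129750, 2), (262980, 5), (432744, 7), (834202, 1), (2340520, 0), (2739858, 4)]),
      (12354, [(404769, 12), (1023901, 5), (1252432, 2), (2132644, 7), (14660080, 0),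
          (21868505, 4)]),
      (87665, [(60840, 9), (83952, 6), (293880, 2), (741720, 7), (3616026, 0), (5768004, 4)]),
      (455, [(1530, 2), (1980, 5), (2832, 1), (3744, 7), (21840, 0), (28458, 4)]),
      (2730, [(57660, 2), (151380, 5), (160368, 7), (190849, 1), (889525, 0), (1127076, 4)]),
      (390, [(7549, 1), (8520, 2), (19968, 7), (25020, 5), (114205, 0), (155976, 4)]),
      (273, [(960, 5), (2082, 2), (7176, 7), (15445, 1), (39403, 0), (44622, 4)]),
      (33277, [(246214, 2), (428268, 9), (439504, 7), (882728, 5), (2565858, 0), (4117758, 4)]),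
      (33277, [(3537966, 9), (3990612, 2), (8560140, 7), (27343366, 5), (45375232, 0),
          (70810870, 4)]),
      (2730, [(318420, 2), (1143792, 7), (1555140, 5), (2258281, 1), (5879965, 0),
          (6955644, 4)]),
      (33277, [(582618, 2), (1045704, 7), (1267056, 9), (3535668, 5), (5685918, 0),
          (9760038, 4)]),
      (455, [(8310, 2), (17820, 5), (31512, 7), (73536, 1), (166530, 0), (186234, 4)]),
      (91, [(192, 2), (624, 7), (941, 1), (1212, 5), (3185, 0), (4008, 4)]),
      (455, [(523, 1), (1020, 2), (2496, 7), (6780, 5), (13195, 0), (18972, 4)])]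
    (by decide +kernel) (by decide +kernel)

theorem good_c_zpow_sub_five : Good (mat (c ^ (5 : ℤ)) - mat (c ^ (-1 : ℤ))) := by
  rw [coe_c_zpow_five, coe_c_zpow_neg_one]
  exact good_of_combinations
    ![(91, [(360, 5), (576, 2), (1872, 7), (3642, 1), (10374, 0), (12024, 4)]),
      (65, [(360, 2), (1872, 7), (4320, 5), (5016, 1), (8580, 0), (9504, 4)]),
      (900, [(343224, 7), (693180, 9), (972468, 4), (1031915, 0), (1434960, 5), (2386307, 1)]),
      (2730, [(262740, 2), (417420, 5), (831792, 7), (1479431, 1), (4570475, 0), (5422044, 4)]),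
      (455, [(1320, 2), (4920, 5), (5928, 7), (16104, 1), (30030, 0), (32196, 4)]),
      (910, [(2700, 2), (11232, 7), (16020, 5), (26661, 1), (55965, 0), (63324, 4)]),
      (2730, [(51720, 2), (222144, 7), (440460, 5), (514777, 1), (1069705, 0), (1232808, 4)]),
      (1365, [(26850, 2), (100776, 7), (142020, 5), (210908, 1), (512330, 0), (598782, 4)]),
      (2730, [(18180, 2), (99216, 7), (245460, 5), (271573, 1), (447265, 0), (493212, 4)]),
      (273, [(450, 3), (2258, 1), (2592, 2), (6552, 7), (27668, 0), (54054, 4)]),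
      (496, [(34596, 2), (164052, 7), (420805, 8), (658823, 9), (868434, 4), (1189182, 5)]),
      (2730, [(293520, 2), (1402752, 7), (3245791, 1), (4248420, 5), (6264895, 0),
          (7398864, 4)]),
      (162295, [(29328, 6), (572010, 3), (3771540, 2), (8821080, 7), (38867334, 0),
          (75750906, 4)]),
      (70, [(1140, 2), (6288, 7), (16659, 1), (18300, 5), (27615, 0), (31116, 4)]),
      (455, [(900, 2), (3744, 7), (7522, 1), (10800, 5), (17290, 0), (21108, 4)]),
      (91, [(192, 2), (624, 7), (941, 1), (1212, 5), (3185, 0), (4008, 4)])]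
    (by decide +kernel) (by decide +kernel)

theorem good_c_zpow_sub_six : Good (mat (c ^ (6 : ℤ)) - mat (c ^ (0 : ℤ))) := by
  rw [coe_c_zpow_six, coe_c_zpow_zero]
  exact good_of_combinations
    ![(65, [(360, 2), (1872, 7), (4320, 5), (5016, 1), (8580, 0), (9504, 4)]),
      (65, [(360, 2), (1872, 7), (3846, 1), (7410, 0), (9000, 5), (9504, 4)]),
      (390, [(33240, 2), (163488, 7), (315269, 1), (652925, 0), (789660, 5), (851016, 4)]),
      (390, [(33240, 2), (163488, 7), (377820, 5), (418229, 1), (755885, 0), (851016, 4)]),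
      (455, [(1200, 2), (7176, 7), (19008, 1), (25320, 5), (30030, 0), (34332, 4)]),
      (130, [(360, 2), (1872, 7), (4431, 1), (6660, 5), (7995, 0), (9504, 4)]),
      (1365, [(24870, 2), (121368, 7), (258824, 1), (478620, 5), (512330, 0), (634026, 4)]),
      (2730, [(49740, 2), (242736, 7), (562693, 1), (777060, 5), (1069705, 0), (1268052, 4)]),
      (390, [(2640, 2), (13728, 7), (27229, 1), (53365, 0), (69696, 4), (69900, 5)]),
      (390, [(2640, 2), (13728, 7), (27780, 5), (37759, 1), (63895, 0), (69696, 4)]),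
      (546, [(60300, 2), (263952, 7), (578364, 5), (610535, 1), (1252979, 0), (1451364, 4)]),
      (273, [(30150, 2), (131976, 7), (212311, 1), (533533, 0), (661008, 5), (725682, 4)]),
      (182, [(3096, 2), (14976, 7), (25140, 5), (40119, 1), (71799, 0), (78552, 4)]),
      (182, [(3096, 2), (14976, 7), (25923, 1), (57603, 0), (78552, 4), (81924, 5)]),
      (455, [(900, 2), (3744, 7), (6157, 1), (15925, 0), (16260, 5), (21108, 4)]),
      (455, [(900, 2), (3744, 7), (7522, 1), (10800, 5), (17290, 0), (21108, 4)])]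
    (by decide +kernel) (by decide +kernel)

theorem mat_c_zpow_add_twelve (k : ℤ) :
    mat (c ^ (k + 12)) - mat (c ^ (k + 6)) = mat (c ^ (k + 6)) - mat (c ^ k) := by
  have h : mat (c ^ (6 : ℤ)) * mat (c ^ (6 : ℤ)) - mat (c ^ (6 : ℤ)) =
      mat (c ^ (6 : ℤ)) - 1 := by
    rw [coe_c_zpow_six]
    decide +kernel
  rw [show k + 12 = k + (6 + 6) by ring, _root_.zpow_add,
    _root_.zpow_add, _root_.zpow_add, mat_mul, mat_mul, mat_mul,
    ← mul_sub, h, mul_sub, mul_one]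

theorem mat_c_zpow_sub_periodic (k m : ℤ) :
    mat (c ^ (k + 6 * m)) - mat (c ^ (k + 6 * m - 6)) = mat (c ^ k) - mat (c ^ (k - 6)) := by
  have step (l : ℤ) :
      mat (c ^ (l + 6)) - mat (c ^ l) = mat (c ^ l) - mat (c ^ (l - 6)) := by
    have := mat_c_zpow_add_twelve (l - 6)
    rwa [show l - 6 + 12 = l + 6 by ring, show l - 6 + 6 = l by ring] at this
  induction m using Int.induction_on with
  | zero => simp
  | succ m ih =>
    rw [← ih, ← step (k + 6 * m), show k + 6 * ((m : ℤ) + 1) = k + 6 * m + 6 by ring,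
      add_sub_cancel_right]
  | pred m ih =>
    rw [← ih, show k + 6 * (-(m : ℤ) - 1) = k + 6 * -(m : ℤ) - 6 by ring,
      ← step (k + 6 * -(m : ℤ) - 6), sub_add_cancel]

theorem good_c_zpow_sub (k : ℤ) : Good (mat (c ^ k) - mat (c ^ (k - 6))) := by
  obtain ⟨r, m, rfl, h1, h6⟩ : ∃ r m : ℤ, k = r + 6 * m ∧ 1 ≤ r ∧ r ≤ 6 :=
    ⟨(k - 1) % 6 + 1, (k - 1) / 6, by omega, by omega, by omega⟩
  rw [mat_c_zpow_sub_periodic]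
  interval_cases r
  exacts [good_c_zpow_sub_one, good_c_zpow_sub_two, good_c_zpow_sub_three, good_c_zpow_sub_four,
    good_c_zpow_sub_five, good_c_zpow_sub_six]

theorem good_c_zpow_of_pos (n : ℕ) (hn : 0 < n) : Good (mat (c ^ (n : ℤ))) := by
  induction n using Nat.strong_induction_on with
  | _ n ih =>
    by_cases h6 : n ≤ 6
    · interval_cases n
      exacts [good_c_zpow_one, good_c_zpow_two, good_c_zpow_three, good_c_zpow_four,
        good_c_zpow_five, good_c_zpow_six]
    · have := (ih (n - 6) (by omega) (by omega)).add (good_c_zpow_sub n)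
      rwa [show ((n - 6 : ℕ) : ℤ) = (n : ℤ) - 6 by omega, add_sub_cancel] at this

theorem good_neg_c_zpow_neg (n : ℕ) (hn : 0 < n) : Good (-mat (c ^ (-(n : ℤ)))) := by
  induction n using Nat.strong_induction_on with
  | _ n ih =>
    by_cases h6 : n ≤ 6
    · interval_cases n
      exacts [good_neg_c_zpow_neg_one, good_neg_c_zpow_neg_two, good_neg_c_zpow_neg_three,
        good_neg_c_zpow_neg_four, good_neg_c_zpow_neg_five, good_neg_c_zpow_neg_six]
    · have := (ih (n - 6) (by omega) (by omega)).add (good_c_zpow_sub (-((n - 6 : ℕ) : ℤ)))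
      rwa [show -((n - 6 : ℕ) : ℤ) - 6 = -(n : ℤ) by omega, neg_add_eq_sub,
        sub_sub_cancel_left] at this

theorem mat_t_pow_mul_nilp (n : ℕ) : mat (t ^ n) * nilp = nilp := by
  induction n with
  | zero => simp [mat]
  | succ n ih =>
    have h : mat t * nilp = nilp := by decide +kernel
    rw [pow_succ, mat_mul, mul_assoc, h, ih]

theorem mat_t_pow_succ (n : ℕ) : mat (t ^ (n + 1)) = mat (t ^ n) + nilp := by
  have h : mat t = 1 + nilp := by decide +kernel
  rw [pow_succ, mat_mul, h, mul_add, mul_one, mat_t_pow_mul_nilp]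

theorem Good.mapsPos {M : Matrix (Fin 6) (Fin 6) ℤ} (hM : Good M) (n : ℕ) :
    MapsPos (M * mat (t ^ (n + 1))) := by
  induction n with
  | zero => simpa using hM.1
  | succ n ih =>
    rw [mat_t_pow_succ, mul_add]
    exact ih.add hM.2

/-- The cone together with its negative. -/
def bicone : Set (Fin 6 → ℤ) := {y | Pos y ∨ Pos (-y)}

theorem neg_mem_bicone {y : Fin 6 → ℤ} (hy : y ∈ bicone) : -y ∈ bicone := by
  rcases hy with hy | hy
  · exact Or.inr (by rwa [neg_neg])
  · exact Or.inl hy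

theorem mulVec_mem_bicone {M : Matrix (Fin 6) (Fin 6) ℤ} (hM : MapsPos M) {y : Fin 6 → ℤ}
    (hy : y ∈ bicone) : M *ᵥ y ∈ bicone := by
  rcases hy with hy | hy
  · exact Or.inl (hM y hy)
  · exact Or.inr (by simpa [Matrix.mulVec_neg] using hM _ hy)

theorem c_zpow_mul_t_pow_smul_mem (k : ℤ) (hk : k ≠ 0) (n : ℕ) {y : Fin 6 → ℤ}
    (hy : y ∈ bicone) : (c ^ k * t ^ (n + 1)) • y ∈ bicone := by
  rw [GL_smul_eq_mulVec]
  change (mat (c ^ k) * mat (t ^ (n + 1))) *ᵥ y ∈ bicone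
  rcases lt_or_gt_of_ne hk with h | h
  · obtain ⟨m, rfl⟩ : ∃ m : ℕ, k = -(m : ℤ) := ⟨k.natAbs, by omega⟩
    have := mulVec_mem_bicone ((good_neg_c_zpow_neg m (by omega)).mapsPos n) hy
    rw [neg_mul, Matrix.neg_mulVec] at this
    simpa using neg_mem_bicone this
  · obtain ⟨m, rfl⟩ : ∃ m : ℕ, k = (m : ℤ) := ⟨k.natAbs, by omega⟩
    exact mulVec_mem_bicone ((good_c_zpow_of_pos m (by omega)).mapsPos n) hy

theorem mapsPos_invol : MapsPos (mat invol) := by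
  have h : form * mat invol =
      form.submatrix ![1, 0, 3, 2, 4, 5, 7, 6, 9, 8, 11, 10, 13, 12, 15, 14] id := by
    decide +kernel
  intro y hy i
  rw [Matrix.mulVec_mulVec, h]
  exact hy _

theorem invol_conj_c : invol * c * invol⁻¹ = c⁻¹ := by
  apply Units.ext
  decide +kernel

theorem invol_conj_t : invol * t * invol⁻¹ = t⁻¹ := by
  apply Units.ext
  decide +kernel

theorem invol_inv : invol⁻¹ = invol := Units.ext rfl

theorem c_zpow_mul_t_zpow_smul_mem {k n : ℤ} (hk : k ≠ 0) (hn : n ≠ 0) {y : Fin 6 → ℤ}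
    (hy : y ∈ bicone) : (c ^ k * t ^ n) • y ∈ bicone := by
  rcases lt_or_gt_of_ne hn with h | h
  · obtain ⟨m, rfl⟩ : ∃ m : ℕ, n = -((m + 1 : ℕ) : ℤ) := ⟨n.natAbs - 1, by omega⟩
    have hconj : c ^ k * t ^ (-((m + 1 : ℕ) : ℤ)) =
        invol * (c ^ (-k) * t ^ (m + 1)) * invol⁻¹ := by
      rw [← conj_mul, ← conj_zpow, ← conj_pow, invol_conj_c, invol_conj_t, _root_.inv_zpow', neg_neg,
        _root_.zpow_neg, zpow_natCast, inv_pow]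
    rw [hconj, invol_inv, mul_smul, mul_smul]
    exact mulVec_mem_bicone mapsPos_invol
      (c_zpow_mul_t_pow_smul_mem (-k) (neg_ne_zero.mpr hk) m
        (mulVec_mem_bicone mapsPos_invol hy))
  · obtain ⟨m, rfl⟩ : ∃ m : ℕ, n = ((m + 1 : ℕ) : ℤ) := ⟨n.natAbs - 1, by omega⟩
    rw [zpow_natCast]
    exact c_zpow_mul_t_pow_smul_mem k hk m hy

theorem neg_c_zpow_mul_t_zpow_smul_mem {k n : ℤ} (hk : k ≠ 0) (hn : n ≠ 0) {y : Fin 6 → ℤ}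
    (hy : y ∈ bicone) : ((-c) ^ k * t ^ n) • y ∈ bicone := by
  have h := c_zpow_mul_t_zpow_smul_mem hk hn hy
  rcases Int.even_or_odd k with he | ho
  · rwa [he.neg_zpow]
  · rw [ho.neg_zpow, neg_mul, GL_smul_eq_mulVec, Units.val_neg, Matrix.neg_mulVec]
    exact neg_mem_bicone h

/-- The union of the images of the bicone under nontrivial powers of `T`. -/
def shears : Set (Fin 6 → ℤ) := {y | ∃ n : ℤ, n ≠ 0 ∧ ∃ z ∈ bicone, y = t ^ n • z}

theorem t_zpow_smul (n : ℤ) (z : Fin 6 → ℤ) :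
    (t ^ n • z) 0 = z 0 ∧ (t ^ n • z) 5 = z 5 + 10 * n * z 0 := by
  have h (z : Fin 6 → ℤ) : (t • z) 0 = z 0 ∧ (t • z) 5 = z 5 + 10 * z 0 := by
    rw [GL_smul_eq_mulVec]
    simp [t, Matrix.mulVec, dotProduct, Fin.sum_univ_six]
    ring
  induction n using Int.induction_on generalizing z with
  | zero => simp
  | succ n ih =>
    obtain ⟨h0, h5⟩ := ih (t • z)
    rw [_root_.zpow_add_one, mul_smul, h0, h5, (h z).1, (h z).2]
    exact ⟨rfl, by ring⟩
  | pred n ih =>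
    obtain ⟨h0, h5⟩ := ih (t⁻¹ • z)
    obtain ⟨g0, g5⟩ := h (t⁻¹ • z)
    rw [smul_inv_smul] at g0 g5
    rw [_root_.zpow_sub_one, mul_smul, h0, h5, g0, g5]
    exact ⟨rfl, by ring⟩

theorem bounds_of_mem_bicone {y : Fin 6 → ℤ} (hy : y ∈ bicone) :
    (0 < y 0 ∧ -y 0 < y 5 ∧ y 5 < 9 * y 0) ∨ (y 0 < 0 ∧ 9 * y 0 < y 5 ∧ y 5 < -y 0) := by
  rcases hy with hy | hy
  · exact Or.inl ⟨hy.zero_lt, hy.neg_lt, hy.lt_nine_mul⟩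
  · have h1 := hy.zero_lt
    have h2 := hy.neg_lt
    have h3 := hy.lt_nine_mul
    simp only [Pi.neg_apply] at h1 h2 h3
    exact Or.inr ⟨by linarith, by linarith, by linarith⟩

theorem disjoint_shears_bicone : Disjoint shears bicone := by
  rw [Set.disjoint_left]
  rintro _ ⟨n, hn, z, hz, rfl⟩ hy
  obtain ⟨h0, h5⟩ := t_zpow_smul n z
  have hz' := bounds_of_mem_bicone hz
  have hy' := bounds_of_mem_bicone hy
  rw [h0, h5] at hy'
  rcases hz' with hz' | hz' <;> rcases hy' with hy' | hy' <;> try omega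
  all_goals rcases lt_or_gt_of_ne hn with h | h <;> nlinarith

theorem bicone_nonempty : bicone.Nonempty :=
  ⟨![10, 40, 70, 107, 50, 47], Or.inl (by unfold Pos; decide +kernel)⟩

/-- The matrices `T` and `B` freely generate a free group, over `ℤ`. -/
theorem injective_lift : Function.Injective (FreeGroup.lift ![t, -c]) := by
  refine FreeGroup.injective_lift_of_zpow_ping_pong (α := Fin 6 → ℤ) _ ![shears, bicone] ?_ ?_ ?_
  · rw [Fin.forall_fin_two]
    obtain ⟨z, hz⟩ := bicone_nonempty
    exact ⟨⟨t ^ (1 : ℤ) • z, 1, one_ne_zero, z, hz, rfl⟩, z, hz⟩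
  · intro i j hij
    fin_cases i <;> fin_cases j
    · exact absurd rfl hij
    · exact disjoint_shears_bicone
    · exact disjoint_shears_bicone.symm
    · exact absurd rfl hij
  · intro i j hij k hk x hx
    fin_cases i <;> fin_cases j
    · exact absurd rfl hij
    · exact ⟨k, hk, x, hx, rfl⟩
    · obtain ⟨n, hn, z, hz, rfl⟩ := hx
      change (-c) ^ k • t ^ n • z ∈ bicone
      rw [← mul_smul]
      exact neg_c_zpow_mul_t_zpow_smul_mem hk hn hz
    · exact absurd rfl hij

theorem t_eq : t = -c * a⁻¹ := by
  apply Units.ext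
  decide +kernel

end HypergeometricA5

/-- The hypergeometric group of case A5 is free of rank 2 on `T = B * A⁻¹` and `B`. -/
theorem thm_A5 (A B : GL (Fin 6) ℚ)
    (hA : (A : Matrix (Fin 6) (Fin 6) ℚ) = companionMatrix 6 ((X - 1) ^ 6))
    (hB : (B : Matrix (Fin 6) (Fin 6) ℚ) = companionMatrix 6 ((X + 1) ^ 2 * (X ^ 2 + X + 1) ^ 2)) :
    Function.Injective (FreeGroup.lift ![B * A⁻¹, B] : FreeGroup (Fin 2) →* GL (Fin 6) ℚ) := by
  have ha : A = GeneralLinearGroup.map (Int.castRingHom ℚ) HypergeometricA5.a := by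
    have hpoly : ((X - 1) ^ 6 : ℚ[X]) =
        X ^ 6 - C 6 * X ^ 5 + C 15 * X ^ 4 - C 20 * X ^ 3 + C 15 * X ^ 2 - C 6 * X + C 1 := by
      simp only [map_ofNat, map_one]
      ring
    apply Units.ext
    rw [hA, hpoly, companionMatrix_six, HypergeometricA5.map_a]
    simp [coeff_X, coeff_X_pow, coeff_C, coeff_one]
  have hb : B = GeneralLinearGroup.map (Int.castRingHom ℚ) (-HypergeometricA5.c) := by
    have hpoly : ((X + 1) ^ 2 * (X ^ 2 + X + 1) ^ 2 : ℚ[X]) =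
        X ^ 6 + C 4 * X ^ 5 + C 8 * X ^ 4 + C 10 * X ^ 3 + C 8 * X ^ 2 + C 4 * X + C 1 := by
      simp only [map_ofNat, map_one]
      ring
    apply Units.ext
    rw [hB, hpoly, companionMatrix_six, HypergeometricA5.map_neg_c]
    simp [coeff_X, coeff_X_pow, coeff_C, coeff_one]
  have hlift : FreeGroup.lift ![B * A⁻¹, B] =
      (GeneralLinearGroup.map (Int.castRingHom ℚ)).comp
        (FreeGroup.lift ![HypergeometricA5.t, -HypergeometricA5.c]) := by
    ext1 i
    rw [MonoidHom.comp_apply, FreeGroup.lift_apply_of, FreeGroup.lift_apply_of]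
    fin_cases i
    · change B * A⁻¹ = GeneralLinearGroup.map (Int.castRingHom ℚ) HypergeometricA5.t
      rw [HypergeometricA5.t_eq, map_mul, map_inv, ← ha, ← hb]
    · exact hb
  rw [hlift, MonoidHom.coe_comp]
  exact (GL_map_injective (RingHom.injective_int _)).comp HypergeometricA5.injective_lift
end

section
/- Let A be the companion matrix of f(x) = (x−1)⁶ and B the companion matrix of g(x) = (x+1)²(x⁴+x³+x²+x+1), regarded as elements of GL₆(ℚ), and set T = B·A⁻¹. Then T and B generate a free group of rank 2: the group homomorphism from the free group on two generators to GL₆(ℚ) sending the first generator to T and the second generator to B is injective. (This is the hypergeometric monodromy group of case A-10, with α = (0,0,0,0,0,0) and β = (1/2,1/2,1/5,2/5,3/5,4/5); in particular this group is isomorphic to ℤ ∗ ℤ.) -/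
open Matrix Polynomial

/-- The order-six linear recurrence with characteristic polynomial
`(x - 1)² (x⁴ - x³ + x² - x + 1)`. -/
def IsRecurrent (a : ℤ → ℚ) : Prop :=
  ∀ n, a (n + 6) =
    3 * a (n + 5) - 4 * a (n + 4) + 4 * a (n + 3) - 4 * a (n + 2) + 3 * a (n + 1) - a n

/-- The open polyhedral cone on which ping-pong is played, described by inequalities on the
terms `a 0, …, a 5`. -/
structure InCone (a : ℤ → ℚ) : Prop where
  h₁ : 0 < 137 * a 0 + 47 * a 1 - 39 * a 2 + 41 * a 3 - 33 * a 4 + 12 * a 5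
  h₂ : 0 < 193 * a 0 - 47 * a 1 + 39 * a 2 - 41 * a 3 + 33 * a 4 - 12 * a 5
  h₃ : 0 < 3 * a 0 + 7 * a 1 - 11 * a 2 + 11 * a 3 - 7 * a 4 + 2 * a 5
  h₄ : 0 < a 0 + 16 * a 1 - 12 * a 2 + 8 * a 3 - 4 * a 4 + a 5
  h₅ : 0 < 19 * a 0 - 16 * a 1 + 12 * a 2 - 8 * a 3 + 4 * a 4 - a 5
  h₆ : 0 < 27 * a 0 - 29 * a 1 + 37 * a 2 - 37 * a 3 + 29 * a 4 - 10 * a 5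
  h₇ : 0 < 73 * a 0 - 2 * a 1 - 6 * a 2 + 54 * a 3 - 62 * a 4 + 23 * a 5
  h₈ : 0 < 87 * a 0 + 2 * a 1 + 6 * a 2 - 54 * a 3 + 62 * a 4 - 23 * a 5
  h₉ : 0 < 5 * a 0 - a 1 + 3 * a 2 - 3 * a 3 + a 4

namespace IsRecurrent

theorem add {a b : ℤ → ℚ} (ha : IsRecurrent a) (hb : IsRecurrent b) :
    IsRecurrent fun k => a k + b k := by
  intro n
  linear_combination ha n + hb n

theorem const_mul {a : ℤ → ℚ} (ha : IsRecurrent a) (c : ℚ) : IsRecurrent fun k => c * a k := by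
  intro n
  linear_combination c * ha n

theorem reflect {a : ℤ → ℚ} (ha : IsRecurrent a) : IsRecurrent fun k => a (-k) := by
  intro n
  have h := ha (-n - 6)
  ring_nf at h ⊢
  linarith

theorem window_eq_zero {a : ℤ → ℚ} (ha : IsRecurrent a) (h0 : a 0 = 0) (h1 : a 1 = 0)
    (h2 : a 2 = 0) (h3 : a 3 = 0) (h4 : a 4 = 0) (h5 : a 5 = 0) (n : ℤ) :
    a n = 0 ∧ a (n + 1) = 0 ∧ a (n + 2) = 0 ∧ a (n + 3) = 0 ∧ a (n + 4) = 0 ∧ a (n + 5) = 0 := by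
  induction n using Int.induction_on with
  | zero => simp [*]
  | succ n ih =>
    obtain ⟨i0, i1, i2, i3, i4, i5⟩ := ih
    have h := ha n
    ring_nf at *
    refine ⟨i1, i2, i3, i4, i5, ?_⟩
    linarith
  | pred n ih =>
    obtain ⟨i0, i1, i2, i3, i4, i5⟩ := ih
    have h := ha (-n - 1)
    ring_nf at *
    refine ⟨?_, i0, i1, i2, i3, i4⟩
    linarith

/-- Advancing a recurrent sequence by ten adds a constant. -/
theorem add_ten {a : ℤ → ℚ} (ha : IsRecurrent a) (n : ℤ) : a (n + 10) - a n = a 10 - a 0 := by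
  have step (n : ℤ) : a (n + 1 + 10) - a (n + 1) = a (n + 10) - a n := by
    have h0 := ha n
    have h1 := ha (n + 1)
    have h2 := ha (n + 2)
    have h3 := ha (n + 3)
    have h4 := ha (n + 4)
    have h5 := ha (n + 5)
    ring_nf at *
    linarith
  induction n using Int.induction_on with
  | zero => simp
  | succ n ih => rw [step, ih]
  | pred n ih => rw [← ih, ← step, sub_add_cancel]

theorem add_ten_mul {a : ℤ → ℚ} (ha : IsRecurrent a) (n : ℤ) (k : ℕ) :
    a (n + 10 * k) = a n + k * (a 10 - a 0) := by
  induction k with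
  | zero => simp
  | succ k ih =>
    have h := ha.add_ten (n + 10 * k)
    push_cast
    rw [show n + 10 * ((k : ℤ) + 1) = n + 10 * k + 10 by ring]
    linarith

end IsRecurrent

namespace InCone

theorem apply_zero_pos {a : ℤ → ℚ} (h : InCone a) : 0 < a 0 := by
  linarith [h.h₁, h.h₂]

theorem add_const {a : ℤ → ℚ} (h : InCone a) {c : ℚ} (hc : 0 ≤ c) : InCone fun k => a k + c := by
  obtain ⟨h1, h2, h3, h4, h5, h6, h7, h8, h9⟩ := h
  constructor <;> linarith

theorem reflect {a : ℤ → ℚ} (h : InCone a) (ha : IsRecurrent a) : InCone fun k => a (-k) := by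
  obtain ⟨h1, h2, h3, h4, h5, h6, h7, h8, h9⟩ := h
  have r1 := ha (-1)
  have r2 := ha (-2)
  have r3 := ha (-3)
  have r4 := ha (-4)
  have r5 := ha (-5)
  norm_num at r1 r2 r3 r4 r5
  constructor <;> norm_num <;> linarith

end InCone

/-- The recurrent sequence `0, 9, 38, 102, 201, 320, …`. -/
structure IsTransvector (σ : ℤ → ℚ) : Prop where
  isRecurrent : IsRecurrent σ
  h0 : σ 0 = 0
  h1 : σ 1 = 9
  h2 : σ 2 = 38
  h3 : σ 3 = 102
  h4 : σ 4 = 201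
  h5 : σ 5 = 320

namespace IsTransvector

variable {σ : ℤ → ℚ}

theorem apply_neg (hσ : IsTransvector σ) (n : ℤ) : σ (-n) = -σ n := by
  obtain ⟨r, h0, h1, h2, h3, h4, h5⟩ := hσ
  have r1 := r (-1)
  have r2 := r (-2)
  have r3 := r (-3)
  have r4 := r (-4)
  have r5 := r (-5)
  norm_num [h0, h1, h2, h3, h4, h5] at r1 r2 r3 r4 r5
  have h := ((r.reflect).add r).window_eq_zero (by simp [h0]) (by linarith) (by linarith)
    (by linarith) (by linarith) (by linarith) n
  linarith [h.1]

set_option maxHeartbeats 4000000 in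
theorem inCone_shift_of_le_ten (hσ : IsTransvector σ) {b : ℤ → ℚ} (hb : IsRecurrent b)
    (hK : InCone b) {s : ℚ} (hs : b 0 ≤ s) {n : ℤ} (h1n : 1 ≤ n) (hn : n ≤ 10) :
    InCone fun k => b (k + n) + s * σ (k + n) := by
  obtain ⟨c, hc⟩ : ∃ c : ℤ → ℚ, c = fun k => b k + s * σ k := ⟨_, rfl⟩
  have rc : IsRecurrent c := hc ▸ hb.add (hσ.isRecurrent.const_mul s)
  have e0 : c 0 = b 0 := by simp [hc, hσ.h0]
  have e1 : c 1 = b 1 + 9 * s := by simp [hc, hσ.h1, mul_comm]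
  have e2 : c 2 = b 2 + 38 * s := by simp [hc, hσ.h2, mul_comm]
  have e3 : c 3 = b 3 + 102 * s := by simp [hc, hσ.h3, mul_comm]
  have e4 : c 4 = b 4 + 201 * s := by simp [hc, hσ.h4, mul_comm]
  have e5 : c 5 = b 5 + 320 * s := by simp [hc, hσ.h5, mul_comm]
  change InCone fun k => (fun k => b k + s * σ k) (k + n)
  rw [← hc]
  clear hc hb
  obtain ⟨h1, h2, h3, h4, h5, h6, h7, h8, h9⟩ := hK
  have r6 : c 6 = -b 0 + 3 * b 1 - 4 * b 2 + 4 * b 3 - 4 * b 4 + 3 * b 5 + 439 * s := by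
    have h := rc 0
    norm_num at h
    linarith
  have r7 : c 7 = -3 * b 0 + 8 * b 1 - 9 * b 2 + 8 * b 3 - 8 * b 4 + 5 * b 5 + 538 * s := by
    have h := rc 1
    norm_num at h
    linarith
  have r8 : c 8 = -5 * b 0 + 12 * b 1 - 12 * b 2 + 11 * b 3 - 12 * b 4 + 7 * b 5 + 602 * s := by
    have h := rc 2
    norm_num at h
    linarith
  have r9 : c 9 = -7 * b 0 + 16 * b 1 - 16 * b 2 + 16 * b 3 - 17 * b 4 + 9 * b 5 + 631 * s := by
    have h := rc 3
    norm_num at h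
    linarith
  have r10 : c 10 = -9 * b 0 + 20 * b 1 - 20 * b 2 + 20 * b 3 - 20 * b 4 + 10 * b 5 + 640 * s := by
    have h := rc 4
    norm_num at h
    linarith
  have r11 : c 11 = -10 * b 0 + 21 * b 1 - 20 * b 2 + 20 * b 3 - 20 * b 4 + 10 * b 5 + 649 * s := by
    have h := rc 5
    norm_num at h
    linarith
  have r12 : c 12 = -10 * b 0 + 20 * b 1 - 19 * b 2 + 20 * b 3 - 20 * b 4 + 10 * b 5 + 678 * s := by
    have h := rc 6
    norm_num at h
    linarith
  have r13 : c 13 = -10 * b 0 + 20 * b 1 - 20 * b 2 + 21 * b 3 - 20 * b 4 + 10 * b 5 + 742 * s := by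
    have h := rc 7
    norm_num at h
    linarith
  have r14 : c 14 = -10 * b 0 + 20 * b 1 - 20 * b 2 + 20 * b 3 - 19 * b 4 + 10 * b 5 + 841 * s := by
    have h := rc 8
    norm_num at h
    linarith
  have r15 : c 15 = -10 * b 0 + 20 * b 1 - 20 * b 2 + 20 * b 3 - 20 * b 4 + 11 * b 5 + 960 * s := by
    have h := rc 9
    norm_num at h
    linarith
  clear hσ rc
  interval_cases n <;> constructor <;>
    norm_num [e0, e1, e2, e3, e4, e5, r6, r7, r8, r9, r10, r11, r12, r13, r14, r15] <;> linarith

set_option maxHeartbeats 4000000 in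
theorem inCone_neg_shift_of_le_ten (hσ : IsTransvector σ) {b : ℤ → ℚ} (hb : IsRecurrent b)
    (hK : InCone b) {s : ℚ} (hs : b 0 ≤ s) {n : ℤ} (h1n : 1 ≤ n) (hn : n ≤ 10) :
    InCone fun k => -(b (k - n) + s * σ (k - n)) := by
  obtain ⟨c, hc⟩ : ∃ c : ℤ → ℚ, c = fun k => b k + s * σ k := ⟨_, rfl⟩
  have rc : IsRecurrent c := hc ▸ hb.add (hσ.isRecurrent.const_mul s)
  have e0 : c 0 = b 0 := by simp [hc, hσ.h0]
  have e1 : c 1 = b 1 + 9 * s := by simp [hc, hσ.h1, mul_comm]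
  have e2 : c 2 = b 2 + 38 * s := by simp [hc, hσ.h2, mul_comm]
  have e3 : c 3 = b 3 + 102 * s := by simp [hc, hσ.h3, mul_comm]
  have e4 : c 4 = b 4 + 201 * s := by simp [hc, hσ.h4, mul_comm]
  have e5 : c 5 = b 5 + 320 * s := by simp [hc, hσ.h5, mul_comm]
  change InCone fun k => -(fun k => b k + s * σ k) (k - n)
  rw [← hc]
  clear hc hb
  obtain ⟨h1, h2, h3, h4, h5, h6, h7, h8, h9⟩ := hK
  have r1 : c (-1) = 3 * b 0 - 4 * b 1 + 4 * b 2 - 4 * b 3 + 3 * b 4 - b 5 - 9 * s := by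
    have h := rc (-1)
    norm_num at h
    linarith
  have r2 : c (-2) = 5 * b 0 - 8 * b 1 + 8 * b 2 - 9 * b 3 + 8 * b 4 - 3 * b 5 - 38 * s := by
    have h := rc (-2)
    norm_num at h
    linarith
  have r3 : c (-3) = 7 * b 0 - 12 * b 1 + 11 * b 2 - 12 * b 3 + 12 * b 4 - 5 * b 5 - 102 * s := by
    have h := rc (-3)
    norm_num at h
    linarith
  have r4 : c (-4) = 9 * b 0 - 17 * b 1 + 16 * b 2 - 16 * b 3 + 16 * b 4 - 7 * b 5 - 201 * s := by
    have h := rc (-4)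
    norm_num at h
    linarith
  have r5 : c (-5) = 10 * b 0 - 20 * b 1 + 20 * b 2 - 20 * b 3 + 20 * b 4 - 9 * b 5 - 320 * s := by
    have h := rc (-5)
    norm_num at h
    linarith
  have r6 : c (-6) = 10 * b 0 - 20 * b 1 + 20 * b 2 - 20 * b 3 + 21 * b 4 - 10 * b 5 - 439 * s := by
    have h := rc (-6)
    norm_num at h
    linarith
  have r7 : c (-7) = 10 * b 0 - 20 * b 1 + 20 * b 2 - 19 * b 3 + 20 * b 4 - 10 * b 5 - 538 * s := by
    have h := rc (-7)
    norm_num at h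
    linarith
  have r8 : c (-8) = 10 * b 0 - 20 * b 1 + 21 * b 2 - 20 * b 3 + 20 * b 4 - 10 * b 5 - 602 * s := by
    have h := rc (-8)
    norm_num at h
    linarith
  have r9 : c (-9) = 10 * b 0 - 19 * b 1 + 20 * b 2 - 20 * b 3 + 20 * b 4 - 10 * b 5 - 631 * s := by
    have h := rc (-9)
    norm_num at h
    linarith
  have r10 : c (-10) = 11 * b 0 - 20 * b 1 + 20 * b 2 - 20 * b 3 + 20 * b 4 - 10 * b 5 - 640 * s := by
    have h := rc (-10)
    norm_num at h
    linarith
  clear hσ rc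
  interval_cases n <;> constructor <;>
    norm_num [e0, e1, e2, e3, e4, e5, r1, r2, r3, r4, r5, r6, r7, r8, r9, r10] <;> linarith

theorem le_apply_ten (hσ : IsTransvector σ) {b : ℤ → ℚ} (hb : IsRecurrent b)
    (hK : InCone b) {s : ℚ} (hs : b 0 ≤ s) :
    0 ≤ (b 10 + s * σ 10) - (b 0 + s * σ 0) := by
  obtain ⟨r, i0, i1, i2, i3, i4, i5⟩ := hσ
  obtain ⟨h1, h2, h3, h4, h5, h6, h7, h8, h9⟩ := hK
  have r0 := r 0
  have r1 := r 1
  have r2 := r 2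
  have r3 := r 3
  have r4 := r 4
  have b0 := hb 0
  have b1 := hb 1
  have b2 := hb 2
  have b3 := hb 3
  have b4 := hb 4
  norm_num at r0 r1 r2 r3 r4 b0 b1 b2 b3 b4
  have h : σ 10 = 640 := by linarith
  rw [h, i0]
  linarith

theorem inCone_shift (hσ : IsTransvector σ) {b : ℤ → ℚ} (hb : IsRecurrent b)
    (hK : InCone b) {s : ℚ} (hs : b 0 ≤ s) {n : ℤ} (hn : n ≠ 0) :
    InCone (fun k => b (k + n) + s * σ (k + n)) ∨
      InCone (fun k => -(b (k + n) + s * σ (k + n))) := by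
  have rc : IsRecurrent fun k => b k + s * σ k := hb.add (hσ.isRecurrent.const_mul s)
  have hten := hσ.le_apply_ten hb hK hs
  rcases lt_or_gt_of_ne hn with h | h
  · right
    obtain ⟨r, q, h1, h10, rfl⟩ : ∃ (r : ℤ) (q : ℕ), 1 ≤ r ∧ r ≤ 10 ∧ n = -(r + 10 * q) :=
      ⟨(-n - 1) % 10 + 1, ((-n - 1) / 10).toNat, by omega, by omega, by omega⟩
    have := (hσ.inCone_neg_shift_of_le_ten hb hK hs h1 h10).add_const
      (mul_nonneg q.cast_nonneg hten)
    convert this using 2 with k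
    have h := rc.add_ten_mul (k - r - 10 * q) q
    rw [sub_add_cancel] at h
    rw [show k + -(r + 10 * (q : ℤ)) = k - r - 10 * q by ring]
    linarith
  · left
    obtain ⟨r, q, h1, h10, rfl⟩ : ∃ (r : ℤ) (q : ℕ), 1 ≤ r ∧ r ≤ 10 ∧ n = r + 10 * q :=
      ⟨(n - 1) % 10 + 1, ((n - 1) / 10).toNat, by omega, by omega, by omega⟩
    have := (hσ.inCone_shift_of_le_ten hb hK hs h1 h10).add_const
      (mul_nonneg q.cast_nonneg hten)
    convert this using 2 with k
    have h := rc.add_ten_mul (k + r) q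
    rw [← add_assoc]
    linarith

theorem inCone_shift_int (hσ : IsTransvector σ) {b : ℤ → ℚ} (hb : IsRecurrent b)
    (hK : InCone b) {m n : ℤ} (hm : m ≠ 0) (hn : n ≠ 0) :
    InCone (fun k => b (k + n) + m * b 0 * σ (k + n)) ∨
      InCone (fun k => -(b (k + n) + m * b 0 * σ (k + n))) := by
  have hpos := hK.apply_zero_pos
  rcases lt_or_gt_of_ne hm with h | h
  · have hm' : (1 : ℚ) ≤ -m := by exact_mod_cast (show (1 : ℤ) ≤ -m by omega)
    have key := hσ.inCone_shift hb.reflect (hK.reflect hb) (s := -m * b 0)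
      (by simpa using le_mul_of_one_le_left hpos.le hm') (neg_ne_zero.mpr hn)
    have rc : IsRecurrent fun k => b k + m * b 0 * σ k := hb.add (hσ.isRecurrent.const_mul _)
    have rs : IsRecurrent fun k => b (k + n) + m * b 0 * σ (k + n) := by
      intro j
      have := rc (j + n)
      simpa only [add_right_comm _ n] using this
    have flip (k : ℤ) : b (-(k + -n)) + -m * b 0 * σ (k + -n) =
        b (-k + n) + m * b 0 * σ (-k + n) := by
      rw [show k + -n = -(-k + n) by ring, hσ.apply_neg, neg_neg]
      ring
    simp only [flip] at key
    have rs' := rs.const_mul (-1)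
    simp only [neg_one_mul] at rs'
    refine key.imp (fun h => ?_) fun h => ?_
    · simpa using h.reflect rs.reflect
    · simpa using h.reflect rs'.reflect
  · have hm' : (1 : ℚ) ≤ m := by exact_mod_cast (show (1 : ℤ) ≤ m by omega)
    exact hσ.inCone_shift hb hK (le_mul_of_one_le_left hpos.le hm') hn

theorem not_inCone_add (hσ : IsTransvector σ) {b : ℤ → ℚ} (hK : InCone b) {m : ℤ} (hm : m ≠ 0) :
    ¬ InCone (fun k => b k + m * b 0 * σ k) ∧ ¬ InCone (fun k => -(b k + m * b 0 * σ k)) := by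
  have hpos := hK.apply_zero_pos
  constructor
  · rintro ⟨h1, h2, -⟩
    simp only [hσ.h0, hσ.h1, hσ.h2, hσ.h3, hσ.h4, hσ.h5] at h1 h2
    rcases lt_or_gt_of_ne hm with h | h
    · have hm' : (m : ℚ) ≤ -1 := by exact_mod_cast (show m ≤ -1 by omega)
      have := mul_le_mul_of_nonneg_right hm' hpos.le
      linarith [hK.h₁, hK.h₂]
    · have hm' : (1 : ℚ) ≤ m := by exact_mod_cast (show (1 : ℤ) ≤ m by omega)
      have := mul_le_mul_of_nonneg_right hm' hpos.le
      linarith [hK.h₁, hK.h₂]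
  · intro h
    have := h.apply_zero_pos
    simp only [hσ.h0] at this
    linarith

end IsTransvector

open Pointwise in
/-- Ping-pong for two elements, where one of the two players' sets is generated by the other. -/
theorem FreeGroup.injective_lift_pair_of_ping_pong {G α : Type*} [Group G] [MulAction G α]
    (t b : G) (S : Set α) (hne : S.Nonempty)
    (hdisj : ∀ m : ℤ, m ≠ 0 → ∀ x ∈ S, t ^ m • x ∉ S)
    (hmaps : ∀ n m : ℤ, n ≠ 0 → m ≠ 0 → ∀ x ∈ S, b ^ n • t ^ m • x ∈ S) :
    Function.Injective (FreeGroup.lift ![t, b]) := by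
  have hlift : FreeGroup.lift ![t, b] =
      (Monoid.CoprodI.lift fun i => FreeGroup.lift fun _ : Unit => ![t, b] i).comp
        (freeGroupEquivCoprodI (ι := Fin 2)).toMonoidHom := by
    ext i
    simp
  rw [hlift, MonoidHom.coe_comp]
  refine Function.Injective.comp ?_ (MulEquiv.injective freeGroupEquivCoprodI)
  let S' : Set α := {y | ∃ m : ℤ, m ≠ 0 ∧ ∃ x ∈ S, y = t ^ m • x}
  have hS' : Disjoint S' S := by
    rw [Set.disjoint_left]
    rintro _ ⟨m, hm, x, hx, rfl⟩
    exact hdisj m hm x hx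
  refine Monoid.CoprodI.lift_injective_of_ping_pong
    (fun i : Fin 2 => FreeGroup.lift fun _ : Unit => ![t, b] i) ?_ ![S', S] ?_ ?_ ?_
  · refine Or.inr ⟨0, ?_⟩
    rw [FreeGroup.freeGroupUnitEquivInt.cardinal_eq, Cardinal.mk_denumerable]
    exact Cardinal.natCast_le_aleph0
  · obtain ⟨x, hx⟩ := hne
    intro i
    fin_cases i
    · exact ⟨t ^ (1 : ℤ) • x, 1, one_ne_zero, x, hx, rfl⟩
    · exact ⟨x, hx⟩
  · intro i j hij
    fin_cases i <;> fin_cases j <;> simp_all [Function.onFun, hS'.symm]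
  · intro i j hij
    refine FreeGroup.freeGroupUnitEquivInt.forall_congr_left.mpr fun n hn => ?_
    have hn0 : n ≠ 0 := by
      rintro rfl
      exact hn (by simp [FreeGroup.freeGroupUnitEquivInt])
    have hn' : FreeGroup.freeGroupUnitEquivInt.symm n = FreeGroup.of () ^ n := rfl
    rw [hn', map_zpow, FreeGroup.lift_apply_of]
    rintro _ ⟨x, hx, rfl⟩
    fin_cases i <;> fin_cases j
    · exact absurd rfl hij
    · exact ⟨n, hn0, x, hx, rfl⟩
    · obtain ⟨m, hm, y, hy, rfl⟩ := hx
      exact hmaps n m hn0 hm y hy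
    · exact absurd rfl hij

/-- The action of invertible matrices on column vectors. -/
@[reducible]
def glVecMulAction : MulAction (GL (Fin 6) ℚ) (Fin 6 → ℚ) where
  smul g x := (g : Matrix (Fin 6) (Fin 6) ℚ) *ᵥ x
  one_smul x := by
    change ((1 : GL (Fin 6) ℚ) : Matrix (Fin 6) (Fin 6) ℚ) *ᵥ x = x
    simp
  mul_smul g h x := by
    change ((g * h : GL (Fin 6) ℚ) : Matrix (Fin 6) (Fin 6) ℚ) *ᵥ x = _ *ᵥ (_ *ᵥ x)
    simp

section Dynamics

attribute [local instance] glVecMulAction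

theorem gl_smul_def (g : GL (Fin 6) ℚ) (x : Fin 6 → ℚ) :
    g • x = (g : Matrix (Fin 6) (Fin 6) ℚ) *ᵥ x := rfl

/-- The sequence of first coordinates along the orbit of a vector. -/
def orbitSeq (N : GL (Fin 6) ℚ) (x : Fin 6 → ℚ) (n : ℤ) : ℚ := (N ^ n • x) 0

/-- `N` acts as the companion matrix of the polynomial attached to `IsRecurrent`. -/
def ActsByRecurrence (N : GL (Fin 6) ℚ) : Prop :=
  ∀ x : Fin 6 → ℚ, N • x =
    ![x 5, -x 0 + 3 * x 5, -x 1 + 4 * x 5, -x 2 + 4 * x 5, -x 3 + 4 * x 5, -x 4 + 3 * x 5]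

theorem ActsByRecurrence.eq {N : GL (Fin 6) ℚ} (hN : ActsByRecurrence N) (x : Fin 6 → ℚ) :
    N • x = ![x 5, -x 0 + 3 * x 5, -x 1 + 4 * x 5, -x 2 + 4 * x 5, -x 3 + 4 * x 5,
      -x 4 + 3 * x 5] := hN x

theorem coe_companion_sub_one (A : GL (Fin 6) ℚ)
    (hA : (A : Matrix (Fin 6) (Fin 6) ℚ) = companionMatrix 6 ((X - 1) ^ 6)) :
    (A : Matrix (Fin 6) (Fin 6) ℚ) =
      !![0, 0, 0, 0, 0, -1; 1, 0, 0, 0, 0, 6; 0, 1, 0, 0, 0, -15;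
         0, 0, 1, 0, 0, 20; 0, 0, 0, 1, 0, -15; 0, 0, 0, 0, 1, 6] := by
  have hp : ((X - 1) ^ 6 : ℚ[X]) = X ^ 6 + C (-6) * X ^ 5 + C 15 * X ^ 4 + C (-20) * X ^ 3
      + C 15 * X ^ 2 + C (-6) * X + C 1 := by
    simp only [map_neg, map_one, map_ofNat]
    ring
  rw [hA, hp]
  ext i j
  fin_cases i <;> fin_cases j <;>
    simp [companionMatrix, coeff_X, coeff_one]

theorem coe_companion_add_one (B : GL (Fin 6) ℚ)
    (hB : (B : Matrix (Fin 6) (Fin 6) ℚ) =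
      companionMatrix 6 ((X + 1) ^ 2 * (X ^ 4 + X ^ 3 + X ^ 2 + X + 1))) :
    (B : Matrix (Fin 6) (Fin 6) ℚ) =
      !![0, 0, 0, 0, 0, -1; 1, 0, 0, 0, 0, -3; 0, 1, 0, 0, 0, -4;
         0, 0, 1, 0, 0, -4; 0, 0, 0, 1, 0, -4; 0, 0, 0, 0, 1, -3] := by
  have hp : ((X + 1) ^ 2 * (X ^ 4 + X ^ 3 + X ^ 2 + X + 1) : ℚ[X]) =
      X ^ 6 + C 3 * X ^ 5 + C 4 * X ^ 4 + C 4 * X ^ 3 + C 4 * X ^ 2 + C 3 * X + C 1 := by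
    simp only [map_one, map_ofNat]
    ring
  rw [hB, hp]
  ext i j
  fin_cases i <;> fin_cases j <;>
    simp [companionMatrix, coeff_X, coeff_one]

theorem actsByRecurrence_neg {B : GL (Fin 6) ℚ}
    (hB : (B : Matrix (Fin 6) (Fin 6) ℚ) =
      companionMatrix 6 ((X + 1) ^ 2 * (X ^ 4 + X ^ 3 + X ^ 2 + X + 1))) :
    ActsByRecurrence (-B) := by
  intro x
  rw [gl_smul_def, Units.val_neg, coe_companion_add_one B hB]
  ext i
  fin_cases i <;> simp [Matrix.mulVec, dotProduct, Fin.sum_univ_six] <;> ring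

/-- The direction of the transvection `B * A⁻¹`. -/
def transvectionVec : Fin 6 → ℚ := ![0, 9, -11, 24, -11, 9]

theorem mul_inv_smul {A B : GL (Fin 6) ℚ}
    (hA : (A : Matrix (Fin 6) (Fin 6) ℚ) = companionMatrix 6 ((X - 1) ^ 6))
    (hB : (B : Matrix (Fin 6) (Fin 6) ℚ) =
      companionMatrix 6 ((X + 1) ^ 2 * (X ^ 4 + X ^ 3 + X ^ 2 + X + 1))) (x : Fin 6 → ℚ) :
    (B * A⁻¹) • x = x + x 0 • transvectionVec := by
  obtain ⟨y, rfl⟩ : ∃ y, x = A • y := ⟨A⁻¹ • x, (smul_inv_smul A x).symm⟩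
  rw [mul_smul, inv_smul_smul, gl_smul_def, gl_smul_def, coe_companion_sub_one A hA,
    coe_companion_add_one B hB]
  ext i
  fin_cases i <;>
    simp [Matrix.mulVec, dotProduct, Fin.sum_univ_six, transvectionVec] <;> ring

theorem zpow_smul_of_transvection {T : GL (Fin 6) ℚ} {v : Fin 6 → ℚ} (hv : v 0 = 0)
    (hT : ∀ x, T • x = x + x 0 • v) (m : ℤ) (x : Fin 6 → ℚ) :
    T ^ m • x = x + (m * x 0) • v := by
  induction m using Int.induction_on generalizing x with
  | zero => simp
  | succ m ih =>
    rw [_root_.zpow_add_one, mul_smul, ih, hT]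
    ext i
    simp [hv]
    ring
  | pred m ih =>
    rw [_root_.zpow_sub_one, mul_smul, ih]
    have h : T⁻¹ • x = x - x 0 • v := by
      rw [inv_smul_eq_iff, hT]
      simp [hv]
    rw [h]
    ext i
    simp [hv]
    ring

namespace orbitSeq

variable (N : GL (Fin 6) ℚ)

theorem apply_zero (x : Fin 6 → ℚ) : orbitSeq N x 0 = x 0 := by
  simp [orbitSeq]

theorem add_smul (x v : Fin 6 → ℚ) (c : ℚ) :
    orbitSeq N (x + c • v) = fun k => orbitSeq N x k + c * orbitSeq N v k := by
  ext k
  simp [orbitSeq, gl_smul_def, Matrix.mulVec_smul]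

theorem neg (x : Fin 6 → ℚ) : orbitSeq N (-x) = fun k => -orbitSeq N x k := by
  ext k
  simp [orbitSeq, gl_smul_def]

theorem zpow_smul (x : Fin 6 → ℚ) (n : ℤ) :
    orbitSeq N (N ^ n • x) = fun k => orbitSeq N x (k + n) := by
  ext k
  rw [orbitSeq, orbitSeq, smul_smul, ← _root_.zpow_add]

variable {N}

theorem isRecurrent (hN : ActsByRecurrence N) (x : Fin 6 → ℚ) : IsRecurrent (orbitSeq N x) := by
  intro n
  have h (k : ℕ) : orbitSeq N x (n + k) = (N ^ k • N ^ n • x) 0 := by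
    rw [orbitSeq, smul_smul, ← zpow_natCast, ← _root_.zpow_add, add_comm]
  have h0 := h 0
  have h1 := h 1
  have h2 := h 2
  have h3 := h 3
  have h4 := h 4
  have h5 := h 5
  have h6 := h 6
  simp only [pow_succ, pow_zero, one_mul, mul_smul, one_smul, hN.eq] at h0 h1 h2 h3 h4 h5 h6
  simp at h0 h1 h2 h3 h4 h5 h6
  rw [h0, h1, h2, h3, h4, h5, h6]
  ring

theorem isTransvector (hN : ActsByRecurrence N) : IsTransvector (orbitSeq N transvectionVec) := by
  have h (k : ℕ) : orbitSeq N transvectionVec k = (N ^ k • transvectionVec) 0 := by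
    rw [orbitSeq, zpow_natCast]
  refine ⟨isRecurrent hN _, ?_, ?_, ?_, ?_, ?_, ?_⟩
  · exact apply_zero N _
  · refine (h 1).trans ?_
    simp [hN.eq, transvectionVec]
  · refine (h 2).trans ?_
    simp [pow_succ, mul_smul, hN.eq, transvectionVec]
    norm_num
  · refine (h 3).trans ?_
    simp [pow_succ, mul_smul, hN.eq, transvectionVec]
    norm_num
  · refine (h 4).trans ?_
    simp [pow_succ, mul_smul, hN.eq, transvectionVec]
    norm_num
  · refine (h 5).trans ?_
    simp [pow_succ, mul_smul, hN.eq, transvectionVec]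
    norm_num

theorem inCone_of_fixed (hN : ActsByRecurrence N) : InCone (orbitSeq N ![1, 2, 2, 2, 2, 1]) := by
  have hfix : N • ![1, 2, 2, 2, 2, 1] = (![1, 2, 2, 2, 2, 1] : Fin 6 → ℚ) := by
    rw [hN.eq]
    ext i
    fin_cases i <;> simp <;> norm_num
  have h (k : ℤ) : orbitSeq N ![1, 2, 2, 2, 2, 1] k = 1 := by
    have := zpow_mem (show N ∈ MulAction.stabilizer (GL (Fin 6) ℚ)
      (![1, 2, 2, 2, 2, 1] : Fin 6 → ℚ) from hfix) k
    rw [orbitSeq, MulAction.mem_stabilizer_iff.mp this]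
    rfl
  constructor <;> norm_num [h]

end orbitSeq

/-- The set of vectors whose orbit sequence lies in the cone, up to sign. -/
def coneSet (N : GL (Fin 6) ℚ) : Set (Fin 6 → ℚ) :=
  {x | InCone (orbitSeq N x) ∨ InCone (orbitSeq N (-x))}

theorem neg_mem_coneSet {N : GL (Fin 6) ℚ} {x : Fin 6 → ℚ} :
    -x ∈ coneSet N ↔ x ∈ coneSet N := by
  simp only [coneSet, Set.mem_ofPred_eq, neg_neg, or_comm]

theorem gl_smul_neg (g : GL (Fin 6) ℚ) (x : Fin 6 → ℚ) : g • (-x) = -(g • x) :=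
  Matrix.mulVec_neg _ _

theorem neg_gl_smul (g : GL (Fin 6) ℚ) (x : Fin 6 → ℚ) : (-g) • x = -(g • x) := by
  rw [gl_smul_def, gl_smul_def, Units.val_neg, Matrix.neg_mulVec]

theorem neg_zpow_smul_mem_coneSet {N : GL (Fin 6) ℚ} {n : ℤ} {x : Fin 6 → ℚ}
    (h : N ^ n • x ∈ coneSet N) : (-N) ^ n • x ∈ coneSet N := by
  rcases Int.even_or_odd n with hn | hn
  · rwa [hn.neg_zpow]
  · rwa [hn.neg_zpow, neg_gl_smul, neg_mem_coneSet]

end Dynamics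

/-- The hypergeometric group of case A10 is free of rank 2 on `T = B * A⁻¹` and `B`. -/
theorem thm_A10 (A B : GL (Fin 6) ℚ)
    (hA : (A : Matrix (Fin 6) (Fin 6) ℚ) = companionMatrix 6 ((X - 1) ^ 6))
    (hB : (B : Matrix (Fin 6) (Fin 6) ℚ) = companionMatrix 6 ((X + 1) ^ 2 * (X ^ 4 + X ^ 3 + X ^ 2 + X + 1))) :
    Function.Injective (FreeGroup.lift ![B * A⁻¹, B] : FreeGroup (Fin 2) →* GL (Fin 6) ℚ) := by
  let := glVecMulAction
  have hN := actsByRecurrence_neg hB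
  have hσ := orbitSeq.isTransvector hN
  have hT := zpow_smul_of_transvection (v := transvectionVec) rfl (mul_inv_smul hA hB)
  have hseq (m : ℤ) (x : Fin 6 → ℚ) : orbitSeq (-B) ((B * A⁻¹) ^ m • x) = fun k =>
      orbitSeq (-B) x k + m * orbitSeq (-B) x 0 * orbitSeq (-B) transvectionVec k := by
    rw [hT, orbitSeq.add_smul, orbitSeq.apply_zero]
  refine FreeGroup.injective_lift_pair_of_ping_pong (B * A⁻¹) B (coneSet (-B))
    ⟨_, Or.inl (orbitSeq.inCone_of_fixed hN)⟩ (fun m hm x hx => ?_) fun n m hn hm x hx => ?_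
  · have key (y : Fin 6 → ℚ) (hy : InCone (orbitSeq (-B) y)) :
        (B * A⁻¹) ^ m • y ∉ coneSet (-B) := by
      have h := hσ.not_inCone_add hy hm
      rintro (h' | h')
      · exact h.1 (by rwa [hseq] at h')
      · exact h.2 (by rwa [orbitSeq.neg, hseq] at h')
    rcases hx with hx | hx
    · exact key x hx
    · simpa only [gl_smul_neg, neg_mem_coneSet] using key (-x) hx
  · have key (y : Fin 6 → ℚ) (hy : InCone (orbitSeq (-B) y)) :
        B ^ n • (B * A⁻¹) ^ m • y ∈ coneSet (-B) := by
      have h := hσ.inCone_shift_int (orbitSeq.isRecurrent hN y) hy hm hn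
      have h' : (-B) ^ n • (B * A⁻¹) ^ m • y ∈ coneSet (-B) := by
        refine h.imp (fun h => ?_) fun h => ?_
        · rwa [orbitSeq.zpow_smul, hseq]
        · rwa [orbitSeq.neg, orbitSeq.zpow_smul, hseq]
      simpa only [neg_neg] using neg_zpow_smul_mem_coneSet h'
    rcases hx with hx | hx
    · exact key x hx
    · simpa only [gl_smul_neg, neg_mem_coneSet] using key (-x) hx
end

section
/- Let A be the companion matrix of f(x) = (x−1)⁶ and B the companion matrix of g(x) = (x+1)²(x⁴−x²+1), regarded as elements of GL₆(ℚ), and set T = B·A⁻¹. Then T and B generate a free group of rank 2: the group homomorphism from the free group on two generators to GL₆(ℚ) sending the first generator to T and the second generator to B is injective. (This is the hypergeometric monodromy group of case A-14, with α = (0,0,0,0,0,0) and β = (1/2,1/2,1/12,5/12,7/12,11/12); in particular this group is isomorphic to ℤ ∗ ℤ.) -/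
open Matrix Polynomial

namespace HypergeometricA14

section PingPong

open scoped Pointwise

/-- The ping-pong lemma for two elements of infinite order. -/
theorem injective_lift_of_zpow_smul_mem {G α : Type*} [Group G] [MulAction G α] (t b : G)
    (X Y : Set α) (hX : X.Nonempty) (hY : Y.Nonempty) (hXY : Disjoint X Y)
    (ht : ∀ n : ℤ, n ≠ 0 → ∀ y ∈ Y, t ^ n • y ∈ X)
    (hb : ∀ n : ℤ, n ≠ 0 → ∀ x ∈ X, b ^ n • x ∈ Y) :
    Function.Injective (FreeGroup.lift ![t, b] : FreeGroup (Fin 2) →* G) := by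
  have hfactor : (FreeGroup.lift ![t, b] : FreeGroup (Fin 2) →* G) =
      (Monoid.CoprodI.lift fun i => FreeGroup.lift fun _ : Unit => ![t, b] i).comp
        (@freeGroupEquivCoprodI (Fin 2)).toMonoidHom := by
    ext i
    simp
  rw [hfactor, MonoidHom.coe_comp]
  refine Function.Injective.comp ?_ (MulEquiv.injective freeGroupEquivCoprodI)
  have hzpow : ∀ (i : Fin 2) (U V : Set α),
      (∀ n : ℤ, n ≠ 0 → ∀ v ∈ V, ![t, b] i ^ n • v ∈ U) →
      ∀ h : FreeGroup Unit, h ≠ 1 → FreeGroup.lift (fun _ => ![t, b] i) h • V ⊆ U := by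
    intro i U V hUV
    refine FreeGroup.freeGroupUnitEquivInt.forall_congr_left.mpr ?_
    intro n hn
    change FreeGroup.lift (fun _ => ![t, b] i) (FreeGroup.of () ^ n) • V ⊆ U
    simp only [map_zpow, FreeGroup.lift_apply_of]
    rintro _ ⟨v, hv, rfl⟩
    refine hUV n ?_ v hv
    rintro rfl
    exact hn (by simp [FreeGroup.freeGroupUnitEquivInt])
  refine Monoid.CoprodI.lift_injective_of_ping_pong
    (fun i : Fin 2 => FreeGroup.lift fun _ : Unit => ![t, b] i) ?_ ![X, Y] ?_ ?_ ?_
  · refine Or.inr ⟨0, ?_⟩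
    have : Infinite (FreeGroup Unit) := FreeGroup.freeGroupUnitEquivInt.infinite_iff.mpr inferInstance
    exact le_trans (Cardinal.natCast_lt_aleph0 (n := 3)).le (Cardinal.aleph0_le_mk _)
  · intro i
    fin_cases i
    · exact hX
    · exact hY
  · intro i j hij
    fin_cases i <;> fin_cases j
    · exact absurd rfl hij
    · exact hXY
    · exact hXY.symm
    · exact absurd rfl hij
  · intro i j hij
    fin_cases i <;> fin_cases j
    · exact absurd rfl hij
    · exact hzpow 0 X Y ht
    · exact hzpow 1 Y X hb
    · exact absurd rfl hij

end PingPong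

/-- The negative of the companion matrix of `(x + 1) ^ 2 * (x ^ 4 - x ^ 2 + 1)`. -/
def shift : Matrix (Fin 6) (Fin 6) ℤ :=
  !![0, 0, 0, 0, 0, 1;
     -1, 0, 0, 0, 0, 2;
     0, -1, 0, 0, 0, 0;
     0, 0, -1, 0, 0, -2;
     0, 0, 0, -1, 0, 0;
     0, 0, 0, 0, -1, 2]

/-- The companion matrix of `(x - 1) ^ 6`. -/
def unip : Matrix (Fin 6) (Fin 6) ℤ :=
  !![0, 0, 0, 0, 0, -1;
     1, 0, 0, 0, 0, 6;
     0, 1, 0, 0, 0, -15;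
     0, 0, 1, 0, 0, 20;
     0, 0, 0, 1, 0, -15;
     0, 0, 0, 0, 1, 6]

/-- The direction of the transvection `T`. -/
def axis : Fin 6 → ℤ := ![0, 8, -15, 18, -15, 8]

/-- The transvection `T`. -/
def transv : Matrix (Fin 6) (Fin 6) ℤ :=
  !![1, 0, 0, 0, 0, 0;
     8, 1, 0, 0, 0, 0;
     -15, 0, 1, 0, 0, 0;
     18, 0, 0, 1, 0, 0;
     -15, 0, 0, 0, 1, 0;
     8, 0, 0, 0, 0, 1]

/-- An involution conjugating `T` and `B` to their inverses. -/
def refl : Matrix (Fin 6) (Fin 6) ℤ :=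
  !![1, 0, 0, 0, 0, 0;
     2, 0, 0, 0, 0, -1;
     0, 0, 0, 0, -1, 0;
     -2, 0, 0, -1, 0, 0;
     0, 0, -1, 0, 0, 0;
     2, -1, 0, 0, 0, 0]

/-- The rows are the inequalities defining the simplicial ping-pong cone. -/
def ineqs : Matrix (Fin 6) (Fin 6) ℤ :=
  !![-1709, -7241, -8385, -7369, -5089, -905;
     1423, 355, -341, -1245, -1717, -1629;
     -126, -77, -80, -35, 26, 71;
     -7, 25, 53, 65, 61, 41;
     15, 19, 11, 3, -5, -13;
     3, -1, -1, -1, -1, -1]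

/-- The columns span the extreme rays of the simplicial ping-pong cone. -/
def rays : Matrix (Fin 6) (Fin 6) ℤ :=
  !![1, 3, 32, 192, 256, 1024;
     3, 1, 64, 328, 1120, -912;
     -5, 17, 96, -96, -1648, 1136;
     8, -24, -320, 176, 1680, -5488;
     -10, 2, 192, -800, -1616, 7632;
     7, 13, 64, 968, 1232, -3392]

/-- The values `(ineqs * shift ^ t) i 0` for `0 ≤ t < 18`. -/
def orbit : Matrix (Fin 6) (Fin 18) ℤ :=
  !![-1709, 7241, -8385, 7369, -5089, 905, 3263, -7307, 6699, -10675, 163, -7451, -11429, -2479,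
      -18105, -2351, -14809, -8815;
     1423, -355, -341, 1245, -1717, 1629, -1365, 377, 327, -1295, 1631, -1751, 1207, -571,
      -557, 1029, -1933, 1413;
     -126, 77, -80, 35, 26, -71, 68, -153, -14, -147, -156, -77, -234, -31, -188, -73, -82, -179;
     -7, -25, 53, -65, 61, -41, 5, 19, -63, 51, -79, 19, -31, -49, 29, -89, 37, -65;
     15, -19, 11, -3, -5, 13, -21, 9, -25, -15, -17, -39, -9, -43, -13, -27, -29, -11;
     3, 1, -1, 1, -1, 1, -1, -3, -5, -11, -13, -19, -21, -23, -25, -23, -25, -23]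

/-- The matrix `ineqs * shift ^ k` for `k ≤ 12`. -/
def shifted (k : ℕ) : Matrix (Fin 6) (Fin 6) ℤ :=
  Matrix.of fun i j => (-1) ^ (j : ℕ) * orbit i (Fin.ofNat 18 (k + j))

/-- The increment of `ineqs * shift ^ k` when `k` grows by `12`. -/
def drift : Matrix (Fin 6) (Fin 6) ℤ :=
  Matrix.of fun i j => ![-9720, -216, -108, -24, -24, -24] i * (-1) ^ (j : ℕ)

/-- The images of the extreme rays under the four maps `v ↦ v 0 • axis ± v` and
`v ↦ v 0 • axis ± refl v`. -/
def images : Fin 4 → Matrix (Fin 6) (Fin 6) ℤ :=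
  ![!![1, 3, 32, 192, 256, 1024;
       11, 25, 320, 1864, 3168, 7280;
       -20, -28, -384, -2976, -5488, -14224;
       26, 30, 256, 3632, 6288, 12944;
       -25, -43, -288, -3680, -5456, -7728;
       15, 37, 320, 2504, 3280, 4800],
    !![1, 3, 32, 192, 256, 1024;
       3, 17, 256, 952, 1328, 13632;
       -5, -47, -672, -2080, -2224, -22992;
       8, 72, 832, 2896, 2416, 21872;
       -10, -62, -576, -2784, -2192, -16496;
       7, 29, 256, 1592, 1440, 11152],
    !![-1, -3, -32, -192, -256, -1024;
       5, 23, 192, 1208, 928, 9104;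
       -10, -62, -576, -2784, -2192, -16496;
       10, 78, 896, 3280, 2928, 23920;
       -5, -47, -672, -2080, -2224, -22992;
       1, 11, 192, 568, 816, 11584],
    !![-1, -3, -32, -192, -256, -1024;
       13, 31, 256, 2120, 2768, 2752;
       -25, -43, -288, -3680, -5456, -7728;
       28, 36, 320, 4016, 6800, 14992;
       -20, -28, -384, -2976, -5488, -14224;
       9, 19, 256, 1480, 2656, 5232]]

/-- The linear maps `± 1` and `± refl`. -/
def signedRefl : Fin 4 → Matrix (Fin 6) (Fin 6) ℤ := ![1, refl, -1, -refl]

theorem rays_mul_ineqs : rays * ineqs = 4096 • (1 : Matrix (Fin 6) (Fin 6) ℤ) := by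
  decide +kernel

theorem shifted_zero : shifted 0 = ineqs := by decide +kernel

theorem shifted_succ : ∀ k < 12, shifted (k + 1) = shifted k * shift := by decide +kernel

theorem shifted_twelve : shifted 12 = ineqs + drift := by decide +kernel

theorem drift_mul_shift : drift * shift = drift := by decide +kernel

theorem images_eq : ∀ s, images s =
    (vecMulVec axis (Pi.single 0 1) + signedRefl s) * rays := by decide +kernel

theorem shifted_mul_images_nonneg :
    ∀ k < 12, ∀ s i j, 0 ≤ (shifted (k + 1) * images s) i j := by decide +kernel

theorem shifted_mul_images_pos :
    ∀ k < 12, ∀ s i, ∃ j, 0 < (shifted (k + 1) * images s) i j := by decide +kernel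

theorem shifted_mulVec_axis_nonneg :
    ∀ k < 12, ∀ i, 0 ≤ (shifted (k + 1) *ᵥ axis) i := by decide +kernel

theorem drift_mul_images_nonneg : ∀ s i j, 0 ≤ (drift * images s) i j := by decide +kernel

theorem drift_mulVec_axis_nonneg : ∀ i, 0 ≤ (drift *ᵥ axis) i := by decide +kernel

theorem refl_mul_refl : refl * refl = 1 := by decide +kernel

theorem transv_eq : transv = 1 + vecMulVec axis (Pi.single 0 1) := by decide +kernel

theorem refl_mulVec_axis : refl *ᵥ axis = -axis := by decide +kernel

theorem transv_mul_unip : transv * unip = -shift := by decide +kernel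

theorem signedRefl_add_two : ∀ s, signedRefl (s + 2) = -signedRefl s := by decide +kernel

theorem refl_mul_signedRefl : ∀ s, ∃ s', refl * signedRefl s = signedRefl s' := by decide +kernel

theorem exists_ineqs_mul_shift_pow (k : ℕ) :
    ∃ r < 12, ∃ m : ℕ, ineqs * shift ^ (k + 1) = shifted (r + 1) + m • drift := by
  have hone : shifted (0 + 1) = ineqs * shift := by
    rw [shifted_succ 0 (by norm_num), shifted_zero]
  induction k with
  | zero => exact ⟨0, by norm_num, 0, by simp [hone]⟩
  | succ k ih =>
    obtain ⟨r, hr, m, h⟩ := ih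
    have hstep : ineqs * shift ^ (k + 1 + 1) = shifted (r + 1) * shift + m • drift := by
      rw [pow_succ, ← mul_assoc, h, add_mul, smul_mul_assoc, drift_mul_shift]
    rcases Nat.lt_or_ge (r + 1) 12 with hr' | hr'
    · exact ⟨r + 1, hr', m, by rw [hstep, shifted_succ _ hr']⟩
    · obtain rfl : r = 11 := by omega
      refine ⟨0, by norm_num, m + 1, ?_⟩
      rw [hstep, shifted_twelve, add_mul, drift_mul_shift, hone, add_smul, one_smul]
      abel

theorem ineqs_mul_shift_pow_mul_images_nonneg (k : ℕ) (s : Fin 4) (i j : Fin 6) :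
    0 ≤ (ineqs * shift ^ (k + 1) * images s) i j := by
  obtain ⟨r, hr, m, h⟩ := exists_ineqs_mul_shift_pow k
  rw [h, add_mul, smul_mul_assoc, Matrix.add_apply, Matrix.smul_apply]
  exact add_nonneg (shifted_mul_images_nonneg r hr s i j)
    (nsmul_nonneg (drift_mul_images_nonneg s i j) m)

theorem exists_ineqs_mul_shift_pow_mul_images_pos (k : ℕ) (s : Fin 4) (i : Fin 6) :
    ∃ j, 0 < (ineqs * shift ^ (k + 1) * images s) i j := by
  obtain ⟨r, hr, m, h⟩ := exists_ineqs_mul_shift_pow k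
  obtain ⟨j, hj⟩ := shifted_mul_images_pos r hr s i
  refine ⟨j, ?_⟩
  rw [h, add_mul, smul_mul_assoc, Matrix.add_apply, Matrix.smul_apply]
  exact add_pos_of_pos_of_nonneg hj (nsmul_nonneg (drift_mul_images_nonneg s i j) m)

theorem ineqs_mul_shift_pow_mulVec_axis_nonneg (k : ℕ) (i : Fin 6) :
    0 ≤ ((ineqs * shift ^ (k + 1)) *ᵥ axis) i := by
  obtain ⟨r, hr, m, h⟩ := exists_ineqs_mul_shift_pow k
  rw [h, add_mulVec, smul_mulVec, Pi.add_apply, Pi.smul_apply]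
  exact add_nonneg (shifted_mulVec_axis_nonneg r hr i) (nsmul_nonneg (drift_mulVec_axis_nonneg i) m)

/-- The entrywise inclusion of integer matrices into rational matrices. -/
def toRat : Matrix (Fin 6) (Fin 6) ℤ →+* Matrix (Fin 6) (Fin 6) ℚ :=
  (Int.castRingHom ℚ).mapMatrix

/-- The direction of the transvection `T` as a rational vector. -/
def ratAxis : Fin 6 → ℚ := fun i => axis i

theorem toRat_apply (M : Matrix (Fin 6) (Fin 6) ℤ) (i j : Fin 6) : toRat M i j = M i j := rfl

theorem toRat_mulVec_ratAxis (M : Matrix (Fin 6) (Fin 6) ℤ) (i : Fin 6) :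
    (toRat M *ᵥ ratAxis) i = (M *ᵥ axis) i := by
  simp [mulVec, dotProduct, toRat_apply, ratAxis]

theorem toRat_vecMulVec_axis_mulVec (v : Fin 6 → ℚ) :
    toRat (vecMulVec axis (Pi.single 0 1)) *ᵥ v = v 0 • ratAxis := by
  ext i
  simp [mulVec, dotProduct, toRat_apply, ratAxis, vecMulVec_apply, Pi.single_apply, mul_comm]

theorem toRat_transv_mulVec (v : Fin 6 → ℚ) :
    toRat transv *ᵥ v = v + v 0 • ratAxis := by
  rw [transv_eq, map_add, map_one, add_mulVec, one_mulVec, toRat_vecMulVec_axis_mulVec]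

theorem toRat_refl_mulVec_ratAxis : toRat refl *ᵥ ratAxis = -ratAxis := by
  ext i
  rw [toRat_mulVec_ratAxis, refl_mulVec_axis]
  simp [ratAxis]

/-- The simplicial ping-pong cone. -/
def cone : Set (Fin 6 → ℚ) := {v | ∀ i, 0 < (toRat ineqs *ᵥ v) i}

theorem toRat_rays_mulVec (v : Fin 6 → ℚ) :
    toRat rays *ᵥ (toRat ineqs *ᵥ v) = (4096 : ℚ) • v := by
  rw [mulVec_mulVec, ← map_mul, rays_mul_ineqs, map_nsmul, map_one, smul_mulVec, one_mulVec]
  ext i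
  simp

theorem toRat_images_mulVec (s : Fin 4) (v : Fin 6 → ℚ) :
    toRat (images s) *ᵥ (toRat ineqs *ᵥ v) =
      (4096 : ℚ) • (v 0 • ratAxis + toRat (signedRefl s) *ᵥ v) := by
  rw [images_eq, map_mul, ← mulVec_mulVec, toRat_rays_mulVec, mulVec_smul, map_add, add_mulVec,
    toRat_vecMulVec_axis_mulVec]

theorem shift_pow_mem_cone {v : Fin 6 → ℚ} (hv : v ∈ cone) {p : ℚ} (hp : v 0 ≤ p) (s : Fin 4)
    (k : ℕ) :
    toRat (shift ^ (k + 1)) *ᵥ (p • ratAxis + toRat (signedRefl s) *ᵥ v) ∈ cone := by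
  intro i
  set w := toRat ineqs *ᵥ v with hw
  have hdecomp : (4096 : ℚ) • (p • ratAxis + toRat (signedRefl s) *ᵥ v) =
      (4096 * (p - v 0)) • ratAxis + toRat (images s) *ᵥ w := by
    rw [hw, toRat_images_mulVec]
    module
  have himages : 0 < (toRat (ineqs * shift ^ (k + 1) * images s) *ᵥ w) i := by
    obtain ⟨j, hj⟩ := exists_ineqs_mul_shift_pow_mul_images_pos k s i
    refine Finset.sum_pos' (fun j _ => mul_nonneg ?_ (hv j).le)
      ⟨j, Finset.mem_univ j, mul_pos ?_ (hv j)⟩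
    · rw [toRat_apply]
      exact_mod_cast ineqs_mul_shift_pow_mul_images_nonneg k s i j
    · rw [toRat_apply]
      exact_mod_cast hj
  have haxis : 0 ≤ (toRat (ineqs * shift ^ (k + 1)) *ᵥ ratAxis) i := by
    rw [toRat_mulVec_ratAxis]
    exact_mod_cast ineqs_mul_shift_pow_mulVec_axis_nonneg k i
  have hsmul : 0 < (4096 : ℚ) * (toRat (ineqs * shift ^ (k + 1)) *ᵥ
      (p • ratAxis + toRat (signedRefl s) *ᵥ v)) i := by
    rw [← smul_eq_mul, ← Pi.smul_apply, ← mulVec_smul, hdecomp, mulVec_add, mulVec_smul,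
      mulVec_mulVec, ← map_mul]
    exact add_pos_of_nonneg_of_pos
      (mul_nonneg (mul_nonneg (by norm_num) (sub_nonneg.mpr hp)) haxis) himages
  rw [mulVec_mulVec, ← map_mul]
  exact pos_of_mul_pos_right hsmul (by norm_num)

/-- A linear functional that `T` increases by `16` times the coordinate `v 0`. -/
def height (v : Fin 6 → ℚ) : ℚ := -2 * v 0 + v 1 + v 5

theorem zero_pos_and_abs_height_lt_of_mem_cone {v : Fin 6 → ℚ} (hv : v ∈ cone) :
    0 < v 0 ∧ |height v| < 8 * v 0 := by
  have h := toRat_rays_mulVec v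
  set w := toRat ineqs *ᵥ v
  have hw : ∀ i, 0 < w i := hv
  have h0 := congrFun h 0
  have h1 := congrFun h 1
  have h5 := congrFun h 5
  simp [mulVec, dotProduct, toRat_apply, rays, Fin.sum_univ_six] at h0 h1 h5
  have w0 := hw 0
  have w1 := hw 1
  have w2 := hw 2
  have w3 := hw 3
  have w4 := hw 4
  have w5 := hw 5
  refine ⟨by linarith, abs_lt.mpr ⟨?_, ?_⟩⟩ <;> unfold height <;> linarith

/-- The union of the images of the cone under `± 1` and `± refl`. -/
def largeSet : Set (Fin 6 → ℚ) := {y | ∃ s, ∃ v ∈ cone, y = toRat (signedRefl s) *ᵥ v}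

/-- The union of the images of `largeSet` under the nontrivial powers of `T`. -/
def smallSet : Set (Fin 6 → ℚ) :=
  {x | ∃ n : ℤ, n ≠ 0 ∧ ∃ y ∈ largeSet, x = y + (n * y 0) • ratAxis}

theorem neg_mem_largeSet {y : Fin 6 → ℚ} (hy : y ∈ largeSet) : -y ∈ largeSet := by
  obtain ⟨s, v, hv, rfl⟩ := hy
  exact ⟨s + 2, v, hv, by rw [signedRefl_add_two, map_neg, neg_mulVec]⟩

theorem refl_mem_largeSet {y : Fin 6 → ℚ} (hy : y ∈ largeSet) : toRat refl *ᵥ y ∈ largeSet := by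
  obtain ⟨s, v, hv, rfl⟩ := hy
  obtain ⟨s', hs'⟩ := refl_mul_signedRefl s
  exact ⟨s', v, hv, by rw [← hs', map_mul, mulVec_mulVec]⟩

theorem cone_subset_largeSet : cone ⊆ largeSet := fun v hv => ⟨0, v, hv, by simp [signedRefl]⟩

theorem toRat_refl_mulVec_zero (v : Fin 6 → ℚ) : (toRat refl *ᵥ v) 0 = v 0 := by
  simp [mulVec, dotProduct, toRat_apply, refl, Fin.sum_univ_six]

theorem height_toRat_refl_mulVec (v : Fin 6 → ℚ) : height (toRat refl *ᵥ v) = -height v := by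
  simp [height, mulVec, dotProduct, toRat_apply, refl, Fin.sum_univ_six]
  ring

theorem height_neg (v : Fin 6 → ℚ) : height (-v) = -height v := by
  simp [height]
  ring

theorem abs_signedRefl_zero (s : Fin 4) (v : Fin 6 → ℚ) :
    |(toRat (signedRefl s) *ᵥ v) 0| = |v 0| := by
  fin_cases s <;> simp [signedRefl, neg_mulVec, toRat_refl_mulVec_zero]

theorem abs_height_signedRefl (s : Fin 4) (v : Fin 6 → ℚ) :
    |height (toRat (signedRefl s) *ᵥ v)| = |height v| := by
  fin_cases s <;> simp [signedRefl, neg_mulVec, height_toRat_refl_mulVec, height_neg]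

theorem abs_height_lt_of_mem_largeSet {y : Fin 6 → ℚ} (hy : y ∈ largeSet) :
    |height y| < 8 * |y 0| := by
  obtain ⟨s, v, hv, rfl⟩ := hy
  obtain ⟨hpos, hlt⟩ := zero_pos_and_abs_height_lt_of_mem_cone hv
  rwa [abs_signedRefl_zero, abs_height_signedRefl, abs_of_pos hpos]

theorem ratAxis_zero : ratAxis 0 = 0 := by simp [ratAxis, axis]

theorem height_add_smul_ratAxis (v : Fin 6 → ℚ) (c : ℚ) :
    height (v + c • ratAxis) = height v + 16 * c := by
  simp [height, ratAxis, axis]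
  ring

theorem one_le_abs_intCast {n : ℤ} (hn : n ≠ 0) : (1 : ℚ) ≤ |(n : ℚ)| := by
  exact_mod_cast Int.one_le_abs hn

theorem disjoint_smallSet_largeSet : Disjoint smallSet largeSet := by
  rw [Set.disjoint_left]
  rintro x ⟨n, hn, y, hy, rfl⟩ hx
  have hlt := abs_height_lt_of_mem_largeSet hy
  have hlt' := abs_height_lt_of_mem_largeSet hx
  rw [height_add_smul_ratAxis] at hlt'
  have hzero : (y + ((n : ℚ) * y 0) • ratAxis) 0 = y 0 := by simp [ratAxis_zero]
  rw [hzero] at hlt'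
  have hle : |y 0| ≤ |(n : ℚ) * y 0| := by
    rw [abs_mul]
    exact le_mul_of_one_le_left (abs_nonneg _) (one_le_abs_intCast hn)
  have htri := abs_sub (height y + 16 * ((n : ℚ) * y 0)) (height y)
  rw [add_sub_cancel_left, abs_mul, abs_of_pos (by norm_num : (0 : ℚ) < 16)] at htri
  linarith

theorem cone_nonempty : cone.Nonempty := by
  refine ⟨toRat rays *ᵥ 1, fun i => ?_⟩
  have h : ∀ i j, (ineqs * rays) i j = if i = j then 4096 else 0 := by decide +kernel
  rw [mulVec_mulVec, ← map_mul]
  simp [mulVec, dotProduct, toRat_apply, h]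

theorem largeSet_nonempty : largeSet.Nonempty := cone_nonempty.mono cone_subset_largeSet

theorem smallSet_nonempty : smallSet.Nonempty := by
  obtain ⟨y, hy⟩ := largeSet_nonempty
  exact ⟨_, 1, one_ne_zero, y, hy, rfl⟩

theorem refl_mem_smallSet {x : Fin 6 → ℚ} (hx : x ∈ smallSet) : toRat refl *ᵥ x ∈ smallSet := by
  obtain ⟨n, hn, y, hy, rfl⟩ := hx
  refine ⟨-n, neg_ne_zero.mpr hn, _, refl_mem_largeSet hy, ?_⟩
  rw [mulVec_add, mulVec_smul, toRat_refl_mulVec_ratAxis, toRat_refl_mulVec_zero]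
  push_cast
  module

theorem shift_pow_mem_largeSet {x : Fin 6 → ℚ} (hx : x ∈ smallSet) (k : ℕ) :
    toRat (shift ^ (k + 1)) *ᵥ x ∈ largeSet := by
  obtain ⟨n, hn, y, ⟨s, v, hv, rfl⟩, rfl⟩ := hx
  set y := toRat (signedRefl s) *ᵥ v with hy
  have hle : v 0 ≤ |(n : ℚ) * y 0| := by
    rw [abs_mul, hy, abs_signedRefl_zero]
    exact (le_abs_self _).trans
      (le_mul_of_one_le_left (abs_nonneg _) (one_le_abs_intCast hn))
  rcases abs_choice ((n : ℚ) * y 0) with h | h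
  · rw [h] at hle
    rw [add_comm y]
    exact cone_subset_largeSet (shift_pow_mem_cone hv hle s k)
  · rw [h] at hle
    have := neg_mem_largeSet (cone_subset_largeSet (shift_pow_mem_cone hv hle (s + 2) k))
    rw [signedRefl_add_two, map_neg, neg_mulVec, ← hy, ← mulVec_neg] at this
    convert this using 2
    module

theorem neg_shift_pow_mem_largeSet {x : Fin 6 → ℚ} (hx : x ∈ smallSet) (k : ℕ) :
    toRat ((-shift) ^ (k + 1)) *ᵥ x ∈ largeSet := by
  have h := shift_pow_mem_largeSet hx k
  rcases neg_one_pow_eq_or (Matrix (Fin 6) (Fin 6) ℤ) (k + 1) with hk | hk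
  · rwa [neg_pow, hk, one_mul]
  · rw [neg_pow, hk, neg_one_mul, map_neg, neg_mulVec]
    exact neg_mem_largeSet h

/-- The conjugate of `-shift` by `refl` is its inverse. -/
theorem neg_shift_mul_conj : -shift * (refl * -shift * refl) = 1 := by decide +kernel

theorem conj_pow (k : ℕ) : (refl * -shift * refl) ^ k = refl * (-shift) ^ k * refl := by
  induction k with
  | zero => rw [pow_zero, pow_zero, mul_one, refl_mul_refl]
  | succ k ih =>
    rw [pow_succ, ih, pow_succ]
    calc refl * (-shift) ^ k * refl * (refl * -shift * refl)
        = refl * (-shift) ^ k * (refl * refl) * -shift * refl := by simp only [mul_assoc]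
      _ = refl * ((-shift) ^ k * -shift) * refl := by
        rw [refl_mul_refl, mul_one]
        simp only [mul_assoc]

theorem companionMatrix_unip : companionMatrix 6 ((X - 1) ^ 6 : ℚ[X]) = toRat unip := by
  have h : ((X - 1) ^ 6 : ℚ[X]) =
      X ^ 6 - C 6 * X ^ 5 + C 15 * X ^ 4 - C 20 * X ^ 3 + C 15 * X ^ 2 - C 6 * X + C 1 := by
    simp only [map_ofNat, map_one]
    ring
  ext i j
  rw [h]
  fin_cases i <;> fin_cases j <;>
    simp [companionMatrix, toRat_apply, unip, coeff_X, coeff_one, coeff_X_pow]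

theorem companionMatrix_neg_shift :
    companionMatrix 6 ((X + 1) ^ 2 * (X ^ 4 - X ^ 2 + 1) : ℚ[X]) = toRat (-shift) := by
  have h : ((X + 1) ^ 2 * (X ^ 4 - X ^ 2 + 1) : ℚ[X]) =
      X ^ 6 + C 2 * X ^ 5 - C 2 * X ^ 3 + C 2 * X + C 1 := by
    simp only [map_ofNat, map_one]
    ring
  ext i j
  rw [h]
  fin_cases i <;> fin_cases j <;>
    simp [companionMatrix, toRat_apply, shift, coeff_X, coeff_one, coeff_X_pow]

theorem zpow_mulVec_eq_add_smul {t : GL (Fin 6) ℚ}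
    (ht : (t : Matrix (Fin 6) (Fin 6) ℚ) = toRat transv) (n : ℤ) (v : Fin 6 → ℚ) :
    ((t ^ n : GL (Fin 6) ℚ) : Matrix (Fin 6) (Fin 6) ℚ) *ᵥ v = v + (n * v 0) • ratAxis := by
  have hinv (v : Fin 6 → ℚ) :
      ((t⁻¹ : GL (Fin 6) ℚ) : Matrix (Fin 6) (Fin 6) ℚ) *ᵥ v = v - v 0 • ratAxis := by
    have h : v = (t : Matrix (Fin 6) (Fin 6) ℚ) *ᵥ (v - v 0 • ratAxis) := by
      rw [ht, toRat_transv_mulVec]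
      simp [ratAxis_zero]
    conv_lhs => rw [h]
    rw [mulVec_mulVec, ← Units.val_mul, inv_mul_cancel, Units.val_one, one_mulVec]
  induction n generalizing v with
  | zero => simp
  | succ n ih =>
    rw [_root_.zpow_add_one, Units.val_mul, ← mulVec_mulVec, ih, ht, toRat_transv_mulVec]
    simp only [Pi.add_apply, Pi.smul_apply, ratAxis_zero, smul_zero, add_zero]
    push_cast
    module
  | pred n ih =>
    rw [_root_.zpow_sub_one, Units.val_mul, ← mulVec_mulVec, ih, hinv]
    simp only [Pi.sub_apply, Pi.smul_apply, ratAxis_zero, smul_zero, sub_zero]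
    push_cast
    module

theorem zpow_mulVec_mem_largeSet {b : GL (Fin 6) ℚ}
    (hb : (b : Matrix (Fin 6) (Fin 6) ℚ) = toRat (-shift)) {n : ℤ} (hn : n ≠ 0)
    {x : Fin 6 → ℚ} (hx : x ∈ smallSet) :
    ((b ^ n : GL (Fin 6) ℚ) : Matrix (Fin 6) (Fin 6) ℚ) *ᵥ x ∈ largeSet := by
  have hinv : ((b⁻¹ : GL (Fin 6) ℚ) : Matrix (Fin 6) (Fin 6) ℚ) =
      toRat (refl * -shift * refl) := by
    refine Units.inv_eq_of_mul_eq_one_right ?_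
    rw [hb, ← map_mul, neg_shift_mul_conj, map_one]
  obtain ⟨k, hk⟩ := Nat.exists_eq_add_one_of_ne_zero (Int.natAbs_ne_zero.mpr hn)
  rcases Int.natAbs_eq n with h | h
  · rw [h, hk, zpow_natCast, Units.val_pow_eq_pow_val, hb, ← map_pow]
    exact neg_shift_pow_mem_largeSet hx k
  · rw [h, hk, _root_.zpow_neg, zpow_natCast, ← inv_pow, Units.val_pow_eq_pow_val, hinv, ← map_pow,
      conj_pow, map_mul, map_mul, ← mulVec_mulVec, ← mulVec_mulVec]
    exact refl_mem_largeSet (neg_shift_pow_mem_largeSet (refl_mem_smallSet hx) k)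

end HypergeometricA14

/-- The hypergeometric group of case A14 is free of rank 2 on `T = B * A⁻¹` and `B`. -/
theorem thm_A14 (A B : GL (Fin 6) ℚ)
    (hA : (A : Matrix (Fin 6) (Fin 6) ℚ) = companionMatrix 6 ((X - 1) ^ 6))
    (hB : (B : Matrix (Fin 6) (Fin 6) ℚ) = companionMatrix 6 ((X + 1) ^ 2 * (X ^ 4 - X ^ 2 + 1))) :
    Function.Injective (FreeGroup.lift ![B * A⁻¹, B] : FreeGroup (Fin 2) →* GL (Fin 6) ℚ) := by
  have ht : ((B * A⁻¹ : GL (Fin 6) ℚ) : Matrix (Fin 6) (Fin 6) ℚ) =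
      HypergeometricA14.toRat HypergeometricA14.transv := by
    rw [Units.val_mul, hB, HypergeometricA14.companionMatrix_neg_shift,
      ← HypergeometricA14.transv_mul_unip, map_mul, ← HypergeometricA14.companionMatrix_unip, ← hA,
      mul_assoc, Units.mul_inv, mul_one]
  let _ : MulAction (GL (Fin 6) ℚ) (Fin 6 → ℚ) :=
    { smul := fun g v => (g : Matrix (Fin 6) (Fin 6) ℚ) *ᵥ v
      one_smul := fun v => one_mulVec v
      mul_smul := fun g h v => (mulVec_mulVec v _ _).symm }
  refine HypergeometricA14.injective_lift_of_zpow_smul_mem _ _ HypergeometricA14.smallSet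
    HypergeometricA14.largeSet HypergeometricA14.smallSet_nonempty
    HypergeometricA14.largeSet_nonempty HypergeometricA14.disjoint_smallSet_largeSet ?_ ?_
  · intro n hn y hy
    exact ⟨n, hn, y, hy, HypergeometricA14.zpow_mulVec_eq_add_smul ht n y⟩
  · intro n hn x hx
    exact HypergeometricA14.zpow_mulVec_mem_largeSet
      (hB.trans HypergeometricA14.companionMatrix_neg_shift) hn hx
end

section
/- Let A be the companion matrix of f(x) = (x−1)⁶ and B the companion matrix of g(x) = (x²+1)(x⁴−x²+1), regarded as elements of GL₆(ℚ), and set T = B·A⁻¹. Then B¹² = I, B⁶ = −I, T has infinite order, no nonzero power of T equals −I, and the group ⟨A,B⟩ is isomorphic to the amalgamated free product (ℤ × ℤ/2ℤ) ∗_{ℤ/2ℤ} (ℤ/12ℤ): the homomorphism from this amalgamated product to GL₆(ℚ) — where ℤ/2ℤ embeds into ℤ × ℤ/2ℤ as the factor {0} × ℤ/2ℤ and into ℤ/12ℤ as the subgroup {0,6}, and which sends (1,0) ∈ ℤ × ℤ/2ℤ to T, (0,1) ∈ ℤ × ℤ/2ℤ to −I, and 1 ∈ ℤ/12ℤ to B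 — is injective. (This is the hypergeometric monodromy group of case A-31, with α = (0,0,0,0,0,0) and β = (1/4,3/4,1/12,5/12,7/12,11/12).) -/
open Matrix Polynomial

/-- The embedding `ℤ/2ℤ → ℤ/12ℤ` with image `{0, 6}`, sending `1` to `6`. -/
def zmod2ToZmod12 : ZMod 2 →+ ZMod 12 :=
  ZMod.lift 2 ⟨zmultiplesHom (ZMod 12) 6, by decide⟩

/-- The two factors of the amalgam `(ℤ × ℤ/2ℤ) ∗_{ℤ/2ℤ} ℤ/12ℤ`:
`ℤ × ℤ/2ℤ` at index `true` and `ℤ/12ℤ` at index `false`. -/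
abbrev AmFactor : Bool → Type
  | true => Multiplicative (ℤ × ZMod 2)
  | false => Multiplicative (ZMod 12)

instance : ∀ b, Group (AmFactor b)
  | true => inferInstanceAs (Group (Multiplicative (ℤ × ZMod 2)))
  | false => inferInstanceAs (Group (Multiplicative (ZMod 12)))

/-- The two legs of the amalgam `(ℤ × ℤ/2ℤ) ∗_{ℤ/2ℤ} ℤ/12ℤ`: the copy of `ℤ/2ℤ`
embeds into `ℤ × ℤ/2ℤ` as `{0} × ℤ/2ℤ` (index `true`) and into `ℤ/12ℤ` as the
subgroup `{0, 6}` (index `false`). -/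
def ampalg : ∀ b : Bool, Multiplicative (ZMod 2) →* AmFactor b
  | true => AddMonoidHom.toMultiplicative (AddMonoidHom.inr ℤ (ZMod 2))
  | false => AddMonoidHom.toMultiplicative zmod2ToZmod12

namespace HypergeometricA31

/-- A ping-pong criterion for homomorphisms out of an amalgamated product: `W i` is the set of
points on which the letters of index `i` play, and `S i g` is where the letter `g` sends them. -/
theorem injective_of_pingPong {ι H K V : Type*} {G : ι → Type*} [∀ i, Group (G i)] [Group H]
    [Group K] [MulAction K V] {φ : ∀ i, H →* G i} (hφ : ∀ i, Function.Injective (φ i))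
    (ψ : Monoid.PushoutI φ →* K) (hbase : ∀ h : H, ψ (Monoid.PushoutI.base φ h) = 1 → h = 1)
    (W : ι → Set V) (S : ∀ i, G i → Set V)
    (hplay : ∀ i g, g ∉ (φ i).range → ∀ v ∈ W i, ψ (Monoid.PushoutI.of i g) • v ∈ S i g)
    (hsub : ∀ i j, i ≠ j → ∀ g : G j, g ∉ (φ j).range → S j g ⊆ W i)
    (hout : ∀ i j, ∀ g : G j, g ∉ (φ j).range → ∀ h : H,
      ∃ v ∈ W i, ψ (Monoid.PushoutI.base φ h) • v ∉ S j g) :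
    Function.Injective ψ := by
  classical
  have fold : ∀ (l : List (Σ i, G i)) (p : Σ i, G i),
      (p :: l).IsChain (fun a b => a.1 ≠ b.1) → (∀ a ∈ p :: l, a.2 ∉ (φ a.1).range) →
      ∃ i, ∀ v ∈ W i,
        ψ (((p :: l).map fun a => Monoid.PushoutI.of (φ := φ) a.1 a.2).prod) • v ∈ S p.1 p.2 := by
    intro l
    induction l with
    | nil =>
      intro p _ hr
      exact ⟨p.1, fun v hv => by simpa using hplay p.1 p.2 (hr p (by simp)) v hv⟩
    | cons q l ih =>
      intro p hc hr
      rw [List.isChain_cons_cons] at hc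
      obtain ⟨i, hi⟩ := ih q hc.2 fun a ha => hr a (List.mem_cons_of_mem _ ha)
      refine ⟨i, fun v hv => ?_⟩
      rw [List.map_cons, List.prod_cons, map_mul, mul_smul]
      exact hplay p.1 p.2 (hr p (by simp)) _
        (hsub p.1 q.1 hc.1 q.2 (hr q (by simp)) (hi v hv))
  obtain ⟨d⟩ := Monoid.PushoutI.NormalWord.transversal_nonempty φ hφ
  rw [injective_iff_map_eq_one]
  intro x hx
  obtain ⟨w, rfl⟩ : ∃ w : Monoid.PushoutI.NormalWord d, w.prod = x :=
    ⟨_, Monoid.PushoutI.NormalWord.equiv.symm_apply_apply x⟩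
  have hprod : ∀ l : List (Σ i, G i),
      Monoid.PushoutI.ofCoprodI (φ := φ)
        ((l.map fun a => Monoid.CoprodI.of (i := a.1) a.2).prod) =
      (l.map fun a => Monoid.PushoutI.of (φ := φ) a.1 a.2).prod := by
    intro l
    induction l with
    | nil => simp
    | cons a l ih => simp [ih]
  have hx' : ψ (Monoid.PushoutI.base φ w.head) *
      ψ ((w.toList.map fun a => Monoid.PushoutI.of (φ := φ) a.1 a.2).prod) = 1 := by
    rw [← hprod, ← map_mul]
    exact hx
  cases hl : w.toList with
  | nil =>
    rw [hl] at hx'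
    have h1 := hbase w.head (by simpa using hx')
    rw [Monoid.PushoutI.NormalWord.prod, h1, Monoid.CoprodI.Word.prod, hl]
    simp
  | cons p l =>
    exfalso
    have hr : ∀ a ∈ p :: l, a.2 ∉ (φ a.1).range := by
      rintro ⟨i, g⟩ ha ⟨h, hh⟩
      rw [← hl] at ha
      have hn := w.normalized i g ha
      have hgr : g ∈ (φ i).range := ⟨h, hh⟩
      have h1 : g = 1 := by
        have e1 := (d.compl i).1 (a₁ := (⟨g, hgr⟩, ⟨1, d.one_mem i⟩))
          (a₂ := (⟨1, one_mem _⟩, ⟨g, hn⟩)) (by simp)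
        simpa using congrArg (fun z => (z.1 : G i)) e1
      exact w.ne_one _ ha h1
    have hc := w.chain_ne
    rw [hl] at hc
    obtain ⟨i, hi⟩ := fold l p hc hr
    rw [hl] at hx'
    obtain ⟨v, hv, hvS⟩ := hout i p.1 p.2 (hr p (by simp)) w.head⁻¹
    apply hvS
    rw [map_inv, map_inv, inv_eq_of_mul_eq_one_right hx']
    exact hi v hv

/-- The polyhedral cone driving the ping-pong. -/
def InCone (x : Fin 6 → ℚ) : Prop :=
  0 ≤ x 0 ∧
  0 ≤ x 0 + 4 * x 1 + 3 * x 2 + 2 * x 3 + x 4 ∧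
  0 ≤ -x 0 + x 1 + x 2 + x 3 + x 4 + x 5 ∧
  0 ≤ 5 * x 1 + 2 * x 2 - x 4 - x 5 ∧
  0 ≤ x 0 - x 1 - x 2 + x 4 + x 5 ∧
  0 ≤ -x 4 - 2 * x 5 ∧
  0 ≤ -x 0 - x 1 + x 5 ∧
  0 ≤ -2 * x 2 - 2 * x 3 - x 4

/-- The union of the cone and its negative. -/
def InDoubleCone (x : Fin 6 → ℚ) : Prop := InCone x ∨ InCone (-x)

/-- The negacyclic shift, which is the action of `B`. -/
def rot (x : Fin 6 → ℚ) : Fin 6 → ℚ := ![-x 5, x 0, x 1, x 2, x 3, x 4]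

/-- The transvection `T ^ c`. -/
def push (c : ℚ) (x : Fin 6 → ℚ) : Fin 6 → ℚ :=
  ![x 0, x 1 + 6 * c * x 0, x 2 - 15 * c * x 0, x 3 + 20 * c * x 0, x 4 - 15 * c * x 0,
    x 5 + 6 * c * x 0]

/-- The involution conjugating both `B` and `T` to their inverses. -/
def flip (x : Fin 6 → ℚ) : Fin 6 → ℚ := ![-x 0, x 5, x 4, x 3, x 2, x 1]

/-- The double cone together with its mirror image. -/
def InTable (x : Fin 6 → ℚ) : Prop := InDoubleCone x ∨ InDoubleCone (flip x)

theorem rot_neg (x : Fin 6 → ℚ) : rot (-x) = -rot x := by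
  ext i; fin_cases i <;> simp [rot]

theorem iterate_rot_neg (k : ℕ) (x : Fin 6 → ℚ) : rot^[k] (-x) = -rot^[k] x := by
  induction k with
  | zero => rfl
  | succ k ih => rw [Function.iterate_succ_apply', Function.iterate_succ_apply', ih, rot_neg]

theorem iterate_rot_six (x : Fin 6 → ℚ) : rot^[6] x = -x := by
  ext i; fin_cases i <;> simp [rot]

theorem iterate_rot_twelve (x : Fin 6 → ℚ) : rot^[12] x = x := by
  rw [show 12 = 6 + 6 from rfl, Function.iterate_add_apply, iterate_rot_six, iterate_rot_six,
    neg_neg]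

theorem push_neg_apply (c : ℚ) (x : Fin 6 → ℚ) : push c (-x) = -push c x := by
  ext i; fin_cases i <;> simp [push] <;> ring

theorem push_push (c d : ℚ) (x : Fin 6 → ℚ) : push c (push d x) = push (c + d) x := by
  ext i; fin_cases i <;> simp [push] <;> ring

theorem push_zero (x : Fin 6 → ℚ) : push 0 x = x := by
  ext i; fin_cases i <;> simp [push]

theorem flip_neg (x : Fin 6 → ℚ) : flip (-x) = -flip x := by
  ext i; fin_cases i <;> simp [flip]

theorem flip_flip (x : Fin 6 → ℚ) : flip (flip x) = x := by
  ext i; fin_cases i <;> simp [flip]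

theorem flip_push (c : ℚ) (x : Fin 6 → ℚ) : flip (push c x) = push (-c) (flip x) := by
  ext i; fin_cases i <;> simp [flip, push]

theorem rot_flip_rot (x : Fin 6 → ℚ) : rot (flip (rot x)) = flip x := by
  ext i; fin_cases i <;> simp [flip, rot]

theorem iterate_rot_flip_iterate_rot (k : ℕ) (x : Fin 6 → ℚ) :
    rot^[k] (flip (rot^[k] x)) = flip x := by
  induction k generalizing x with
  | zero => rfl
  | succ k ih =>
    rw [Function.iterate_succ_apply' rot k x, Function.iterate_succ_apply, rot_flip_rot, ih]

theorem inDoubleCone_neg {x : Fin 6 → ℚ} : InDoubleCone (-x) ↔ InDoubleCone x := by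
  rw [InDoubleCone, InDoubleCone, neg_neg, or_comm]

theorem inTable_neg {x : Fin 6 → ℚ} : InTable (-x) ↔ InTable x := by
  rw [InTable, InTable, flip_neg, inDoubleCone_neg, inDoubleCone_neg]

theorem inTable_flip {x : Fin 6 → ℚ} : InTable (flip x) ↔ InTable x := by
  rw [InTable, InTable, flip_flip, or_comm]

theorem InCone.push_one {x : Fin 6 → ℚ} (h : InCone x) : InCone (push 1 x) := by
  obtain ⟨h1, h2, h3, h4, h5, h6, h7, h8⟩ := h
  simp only [InCone, push, Matrix.cons_val]
  refine ⟨?_, ?_, ?_, ?_, ?_, ?_, ?_, ?_⟩ <;> linarith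

theorem InDoubleCone.push_one {x : Fin 6 → ℚ} (h : InDoubleCone x) :
    InDoubleCone (push 1 x) := by
  rcases h with h | h
  · exact Or.inl h.push_one
  · exact Or.inr (by simpa only [push_neg_apply] using h.push_one)

theorem InCone.push_rot {x : Fin 6 → ℚ} (h : InCone x) {j : ℕ} (hj : j ∈ Finset.Icc 1 5) :
    InDoubleCone (push 1 (rot^[j] x)) := by
  obtain ⟨h1, h2, h3, h4, h5, h6, h7, h8⟩ := h
  rw [Finset.mem_Icc] at hj
  obtain ⟨hj1, hj5⟩ := hj
  interval_cases j
  · right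
    simp only [InCone, push, rot, Matrix.cons_val, Function.iterate_succ, Function.iterate_zero,
      Function.comp_apply, id_eq, Pi.neg_apply]
    refine ⟨?_, ?_, ?_, ?_, ?_, ?_, ?_, ?_⟩ <;> linarith
  · left
    simp only [InCone, push, rot, Matrix.cons_val, Function.iterate_succ, Function.iterate_zero,
      Function.comp_apply, id_eq]
    refine ⟨?_, ?_, ?_, ?_, ?_, ?_, ?_, ?_⟩ <;> linarith
  · right
    simp only [InCone, push, rot, Matrix.cons_val, Function.iterate_succ, Function.iterate_zero,
      Function.comp_apply, id_eq, Pi.neg_apply]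
    refine ⟨?_, ?_, ?_, ?_, ?_, ?_, ?_, ?_⟩ <;> linarith
  · left
    simp only [InCone, push, rot, Matrix.cons_val, Function.iterate_succ, Function.iterate_zero,
      Function.comp_apply, id_eq]
    refine ⟨?_, ?_, ?_, ?_, ?_, ?_, ?_, ?_⟩ <;> linarith
  · right
    simp only [InCone, push, rot, Matrix.cons_val, Function.iterate_succ, Function.iterate_zero,
      Function.comp_apply, id_eq, Pi.neg_apply]
    refine ⟨?_, ?_, ?_, ?_, ?_, ?_, ?_, ?_⟩ <;> linarith

theorem InCone.push_rot_flip {x : Fin 6 → ℚ} (h : InCone x) {j : ℕ}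
    (hj : j ∈ Finset.Icc 1 5) : InDoubleCone (push 1 (rot^[j] (flip x))) := by
  obtain ⟨h1, h2, h3, h4, h5, h6, h7, h8⟩ := h
  rw [Finset.mem_Icc] at hj
  obtain ⟨hj1, hj5⟩ := hj
  interval_cases j
  · right
    simp only [InCone, push, rot, flip, Matrix.cons_val, Function.iterate_succ,
      Function.iterate_zero, Function.comp_apply, id_eq, Pi.neg_apply]
    refine ⟨?_, ?_, ?_, ?_, ?_, ?_, ?_, ?_⟩ <;> linarith
  · left
    simp only [InCone, push, rot, flip, Matrix.cons_val, Function.iterate_succ,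
      Function.iterate_zero, Function.comp_apply, id_eq]
    refine ⟨?_, ?_, ?_, ?_, ?_, ?_, ?_, ?_⟩ <;> linarith
  · right
    simp only [InCone, push, rot, flip, Matrix.cons_val, Function.iterate_succ,
      Function.iterate_zero, Function.comp_apply, id_eq, Pi.neg_apply]
    refine ⟨?_, ?_, ?_, ?_, ?_, ?_, ?_, ?_⟩ <;> linarith
  · left
    simp only [InCone, push, rot, flip, Matrix.cons_val, Function.iterate_succ,
      Function.iterate_zero, Function.comp_apply, id_eq]
    refine ⟨?_, ?_, ?_, ?_, ?_, ?_, ?_, ?_⟩ <;> linarith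
  · right
    simp only [InCone, push, rot, flip, Matrix.cons_val, Function.iterate_succ,
      Function.iterate_zero, Function.comp_apply, id_eq, Pi.neg_apply]
    refine ⟨?_, ?_, ?_, ?_, ?_, ?_, ?_, ?_⟩ <;> linarith

theorem InTable.push_one_rot {x : Fin 6 → ℚ} (h : InTable x) {j : ℕ}
    (hj : j ∈ Finset.Icc 1 5) : InDoubleCone (push 1 (rot^[j] x)) := by
  rcases h with (h | h) | (h | h)
  · exact h.push_rot hj
  · rw [← inDoubleCone_neg, ← push_neg_apply, ← iterate_rot_neg]
    exact h.push_rot hj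
  · rw [← flip_flip x]
    exact h.push_rot_flip hj
  · rw [← flip_flip x, ← inDoubleCone_neg, ← push_neg_apply, ← iterate_rot_neg, ← flip_neg]
    exact h.push_rot_flip hj

theorem InTable.push_natCast_succ_rot {x : Fin 6 → ℚ} (h : InTable x) {j : ℕ}
    (hj : j ∈ Finset.Icc 1 5) (m : ℕ) : InDoubleCone (push (m + 1 : ℕ) (rot^[j] x)) := by
  induction m with
  | zero => simpa using h.push_one_rot hj
  | succ m ih =>
    have := ih.push_one
    rwa [push_push, add_comm, ← Nat.cast_succ] at this

theorem InTable.push_pos_rot {x : Fin 6 → ℚ} (h : InTable x) {j : ℕ}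
    (hj : j ∈ Finset.Icc 1 5) {n : ℤ} (hn : 0 < n) : InDoubleCone (push n (rot^[j] x)) := by
  obtain ⟨m, rfl⟩ : ∃ m : ℕ, n = (m + 1 : ℕ) := ⟨(n - 1).toNat, by omega⟩
  simpa using h.push_natCast_succ_rot hj m

theorem flip_iterate_rot {j : ℕ} (hj : j ≤ 6) (x : Fin 6 → ℚ) :
    flip (rot^[j] x) = -rot^[6 - j] (flip x) := by
  rw [← iterate_rot_flip_iterate_rot j x, ← Function.iterate_add_apply, Nat.sub_add_cancel hj,
    iterate_rot_six, neg_neg]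

theorem InTable.flip_push_neg_rot {x : Fin 6 → ℚ} (h : InTable x) {j : ℕ}
    (hj : j ∈ Finset.Icc 1 5) {n : ℤ} (hn : n < 0) :
    InDoubleCone (flip (push n (rot^[j] x))) := by
  rw [Finset.mem_Icc] at hj
  rw [flip_push, flip_iterate_rot (by omega), push_neg_apply, inDoubleCone_neg, ← Int.cast_neg]
  exact (inTable_flip.2 h).push_pos_rot (Finset.mem_Icc.2 ⟨by omega, by omega⟩) (by omega)

/-- A point of the cone which is moved off the table by every nontrivial shift. -/
def basePoint : Fin 6 → ℚ := ![0, 1, -3, 4, -2, 1]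

theorem inCone_basePoint : InCone basePoint := by
  simp only [InCone, basePoint, Matrix.cons_val]
  norm_num

theorem inTable_basePoint : InTable basePoint := Or.inl (Or.inl inCone_basePoint)

theorem not_inDoubleCone_flip_basePoint : ¬ InDoubleCone (flip basePoint) := by
  simp only [InDoubleCone, InCone, flip, basePoint, Matrix.cons_val, Pi.neg_apply]
  norm_num

theorem not_inTable_iterate_rot_basePoint {k : ℕ} (hk : k % 6 ≠ 0) :
    ¬ InTable (rot^[k] basePoint) := by
  have small : ∀ j < 6, j ≠ 0 → ¬ InTable (rot^[j] basePoint) := by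
    intro j hj hj0
    interval_cases j
    · exact absurd rfl hj0
    all_goals
      simp only [InTable, InDoubleCone, InCone, flip, rot, basePoint, Matrix.cons_val,
        Pi.neg_apply, Function.iterate_succ, Function.iterate_zero, Function.comp_apply, id_eq]
      norm_num
  have shift : ∀ q : ℕ, ∀ x : Fin 6 → ℚ, InTable (rot^[6 * q] x) ↔ InTable x := by
    intro q x
    induction q with
    | zero => rfl
    | succ q ih =>
      rw [Nat.mul_succ, Nat.add_comm, Function.iterate_add_apply, iterate_rot_six, inTable_neg,
        ih]
  rw [← Nat.div_add_mod k 6, Function.iterate_add_apply, shift]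
  exact small _ (Nat.mod_lt _ (by norm_num)) hk

theorem eq_iterate_rot_of_iterate_rot_eq {i k : ℕ} (hk : k ≤ 12) {x y : Fin 6 → ℚ}
    (h : rot^[i] x = rot^[k] y) : y = rot^[12 - k + i] x := by
  rw [Function.iterate_add_apply, h, ← Function.iterate_add_apply, Nat.sub_add_cancel hk,
    iterate_rot_twelve]

theorem neg_one_smul_vec (x : Fin 6 → ℚ) : (-1 : GL (Fin 6) ℚ) • x = -x := by
  rw [Units.smul_def, Units.val_neg, Units.val_one, neg_smul, one_smul]

theorem generalLinearGroup_ext {M N : GL (Fin 6) ℚ} (h : ∀ x : Fin 6 → ℚ, M • x = N • x) :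
    M = N :=
  Units.ext (Matrix.ext_of_mulVec_single fun i => h (Pi.single i 1))

theorem smul_eq_rot {B : GL (Fin 6) ℚ} (hB : (B : Matrix (Fin 6) (Fin 6) ℚ) =
      companionMatrix 6 ((X ^ 2 + 1) * (X ^ 4 - X ^ 2 + 1))) (x : Fin 6 → ℚ) :
    B • x = rot x := by
  have hg : ((X ^ 2 + 1) * (X ^ 4 - X ^ 2 + 1) : ℚ[X]) = X ^ 6 + 1 := by ring
  rw [Units.smul_def, hB, hg, Matrix.smul_eq_mulVec]
  ext i
  fin_cases i <;>
    simp [companionMatrix, rot, Matrix.mulVec, dotProduct, Fin.sum_univ_six, coeff_X_pow,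
      coeff_one]

theorem smul_eq_push {A B : GL (Fin 6) ℚ}
    (hA : (A : Matrix (Fin 6) (Fin 6) ℚ) = companionMatrix 6 ((X - 1) ^ 6))
    (hB : ∀ x : Fin 6 → ℚ, B • x = rot x) (x : Fin 6 → ℚ) :
    (B * A⁻¹) • x = push 1 x := by
  have hf : ((X - 1) ^ 6 : ℚ[X]) = X ^ 6 - C 6 * X ^ 5 + C 15 * X ^ 4 - C 20 * X ^ 3 +
      C 15 * X ^ 2 - C 6 * X + C 1 := by
    simp only [map_ofNat, map_one]
    ring
  have key : ∀ y : Fin 6 → ℚ, push 1 (A • y) = rot y := by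
    intro y
    rw [Units.smul_def, hA, hf, Matrix.smul_eq_mulVec]
    ext i
    fin_cases i <;>
      simp [companionMatrix, rot, push, Matrix.mulVec, dotProduct, Fin.sum_univ_six,
        coeff_X_pow, coeff_X, coeff_one]
  rw [mul_smul, hB, ← key, smul_inv_smul]

theorem pow_smul_eq_iterate_rot {B : GL (Fin 6) ℚ} (hB : ∀ x : Fin 6 → ℚ, B • x = rot x)
    (k : ℕ) (x : Fin 6 → ℚ) : B ^ k • x = rot^[k] x := by
  induction k with
  | zero => rw [pow_zero, one_smul, Function.iterate_zero_apply]
  | succ k ih => rw [pow_succ', mul_smul, ih, hB, Function.iterate_succ_apply']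

theorem zpow_smul_eq_push {T : GL (Fin 6) ℚ} (hT : ∀ x : Fin 6 → ℚ, T • x = push 1 x)
    (n : ℤ) (x : Fin 6 → ℚ) : T ^ n • x = push n x := by
  have hinv : ∀ y : Fin 6 → ℚ, T⁻¹ • y = push (-1) y := by
    intro y
    rw [inv_smul_eq_iff, hT, push_push, add_neg_cancel, push_zero]
  induction n with
  | zero => rw [zpow_zero, one_smul, Int.cast_zero, push_zero]
  | succ n ih =>
    rw [add_comm, _root_.zpow_one_add, mul_smul, ih, hT, push_push]
    push_cast
    rfl
  | pred n ih =>
    rw [sub_eq_neg_add, _root_.zpow_add, _root_.zpow_neg_one, mul_smul, ih, hinv, push_push]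
    push_cast
    rfl

theorem pow_six_eq_neg_one {B : GL (Fin 6) ℚ} (hB : ∀ x : Fin 6 → ℚ, B • x = rot x) :
    B ^ 6 = -1 :=
  generalLinearGroup_ext fun x => by
    rw [pow_smul_eq_iterate_rot hB, iterate_rot_six, neg_one_smul_vec]

theorem zpow_ne_one {T : GL (Fin 6) ℚ} (hT : ∀ x : Fin 6 → ℚ, T • x = push 1 x)
    {n : ℤ} (hn : n ≠ 0) : T ^ n ≠ 1 := by
  intro h
  have := congrFun (zpow_smul_eq_push hT n (Pi.single 0 1)) 1
  rw [h, one_smul] at this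
  simp [push] at this
  exact hn this

theorem zpow_ne_neg_one {T : GL (Fin 6) ℚ} (hT : ∀ x : Fin 6 → ℚ, T • x = push 1 x)
    (n : ℤ) : T ^ n ≠ -1 := by
  intro h
  have := congrFun (zpow_smul_eq_push hT n (Pi.single 0 1)) 0
  rw [h, neg_one_smul_vec] at this
  norm_num [push] at this

theorem ampalg_injective : ∀ b, Function.Injective (ampalg b)
  | true => fun _ _ h =>
    congrArg (fun p : Multiplicative (ℤ × ZMod 2) => Multiplicative.ofAdd p.toAdd.2) h
  | false => by
    have : ∀ x y : ZMod 2, zmod2ToZmod12 x = zmod2ToZmod12 y → x = y := by decide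
    exact fun x y h => this x y h

/-- The sets into which the letters of the amalgam send their playing field. -/
def target : ∀ b, AmFactor b → Set (Fin 6 → ℚ)
  | true, g => {x | if 0 < (Multiplicative.toAdd g).1 then InDoubleCone x
      else InDoubleCone (flip x)}
  | false, k => {x | ∃ y, InTable y ∧ x = rot^[(Multiplicative.toAdd k).val] y}

/-- The playing fields of the two factors. -/
def playingField : Bool → Set (Fin 6 → ℚ)
  | true => {x | ∃ j ∈ Finset.Icc 1 5, ∃ y, InTable y ∧ x = rot^[j] y}
  | false => {x | InTable x}

theorem fst_ne_zero_of_notMem_range {g : AmFactor true} (hg : g ∉ (ampalg true).range) :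
    (Multiplicative.toAdd g).1 ≠ 0 :=
  fun h => hg ⟨Multiplicative.ofAdd (Multiplicative.toAdd g).2,
    congrArg Multiplicative.ofAdd (Prod.ext h.symm rfl)⟩

theorem val_mod_six_ne_zero_of_notMem_range {k : AmFactor false}
    (hk : k ∉ (ampalg false).range) : (Multiplicative.toAdd k).val % 6 ≠ 0 := by
  have key : ∀ k : ZMod 12, k.val % 6 = 0 → ∃ h, zmod2ToZmod12 h = k := by decide
  intro h
  obtain ⟨e, he⟩ := key _ h
  exact hk ⟨Multiplicative.ofAdd e, congrArg Multiplicative.ofAdd he⟩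

theorem neg_mem_target {b : Bool} {g : AmFactor b} {x : Fin 6 → ℚ} (hx : x ∈ target b g) :
    -x ∈ target b g := by
  cases b
  · obtain ⟨y, hy, rfl⟩ := hx
    exact ⟨-y, inTable_neg.2 hy, (iterate_rot_neg _ _).symm⟩
  · simpa only [target, Set.mem_ofPred_eq, flip_neg, inDoubleCone_neg] using hx

theorem target_subset_field : ∀ i j : Bool, i ≠ j → ∀ g : AmFactor j, g ∉ (ampalg j).range →
    target j g ⊆ playingField i := by
  rintro (_ | _) (_ | _) hij g hg x hx
  · exact absurd rfl hij
  · by_cases h : 0 < (Multiplicative.toAdd g).1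
    · exact Or.inl (by simpa only [target, Set.mem_ofPred_eq, if_pos h] using hx)
    · exact Or.inr (by simpa only [target, Set.mem_ofPred_eq, if_neg h] using hx)
  · obtain ⟨y, hy, rfl⟩ := hx
    have hk := val_mod_six_ne_zero_of_notMem_range hg
    have hlt := ZMod.val_lt (Multiplicative.toAdd g : ZMod 12)
    rcases lt_or_ge ((Multiplicative.toAdd g : ZMod 12)).val 6 with h | h
    · exact ⟨_, Finset.mem_Icc.2 ⟨by omega, by omega⟩, y, hy, rfl⟩
    · refine ⟨(Multiplicative.toAdd g : ZMod 12).val - 6, Finset.mem_Icc.2 ⟨by omega, by omega⟩,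
        -y, inTable_neg.2 hy, ?_⟩
      rw [← iterate_rot_six, ← Function.iterate_add_apply, Nat.sub_add_cancel h]
  · exact absurd rfl hij

theorem exists_mem_field_notMem_target (i j : Bool) (g : AmFactor j)
    (hg : g ∉ (ampalg j).range) : ∃ x ∈ playingField i, x ∉ target j g := by
  cases j
  · have hk := val_mod_six_ne_zero_of_notMem_range hg
    have hlt := ZMod.val_lt (Multiplicative.toAdd g : ZMod 12)
    have main : ∀ m : ℕ, (12 - (Multiplicative.toAdd g : ZMod 12).val + m) % 6 ≠ 0 →
        rot^[m] basePoint ∉ target false g := by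
      rintro m hm ⟨y, hy, h⟩
      rw [eq_iterate_rot_of_iterate_rot_eq hlt.le h] at hy
      exact not_inTable_iterate_rot_basePoint hm hy
    cases i
    · exact ⟨_, inTable_basePoint, main 0 (by omega)⟩
    · by_cases h1 : (Multiplicative.toAdd g : ZMod 12).val % 6 = 1
      · exact ⟨_, ⟨2, by decide, _, inTable_basePoint, rfl⟩, main 2 (by omega)⟩
      · exact ⟨_, ⟨1, by decide, _, inTable_basePoint, rfl⟩, main 1 (by omega)⟩
  · cases i
    · by_cases h : 0 < (Multiplicative.toAdd g).1
      · refine ⟨flip basePoint, inTable_flip.2 inTable_basePoint, ?_⟩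
        simpa only [target, Set.mem_ofPred_eq, if_pos h] using not_inDoubleCone_flip_basePoint
      · refine ⟨basePoint, inTable_basePoint, ?_⟩
        simpa only [target, Set.mem_ofPred_eq, if_neg h] using not_inDoubleCone_flip_basePoint
    · refine ⟨rot^[1] basePoint, ⟨1, by decide, _, inTable_basePoint, rfl⟩, fun h => ?_⟩
      exact not_inTable_iterate_rot_basePoint (k := 1) (by norm_num)
        (target_subset_field false true (by decide) g hg h)

section Representation

variable {B T : GL (Fin 6) ℚ} {ψ : Monoid.PushoutI ampalg →* GL (Fin 6) ℚ}

theorem map_of_true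
    (h1 : ψ (Monoid.PushoutI.of (φ := ampalg) true
      (Multiplicative.ofAdd ((1, 0) : ℤ × ZMod 2))) = T)
    (h2 : ψ (Monoid.PushoutI.of (φ := ampalg) true
      (Multiplicative.ofAdd ((0, 1) : ℤ × ZMod 2))) = -1) (g : AmFactor true) :
    ψ (Monoid.PushoutI.of (φ := ampalg) true g) =
      (-1) ^ (Multiplicative.toAdd g).2.val * T ^ (Multiplicative.toAdd g).1 := by
  have hg : g = (Multiplicative.ofAdd ((0, 1) : ℤ × ZMod 2) : AmFactor true) ^
        (Multiplicative.toAdd g).2.val *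
      (Multiplicative.ofAdd ((1, 0) : ℤ × ZMod 2) : AmFactor true) ^
        (Multiplicative.toAdd g).1 := by
    apply Multiplicative.toAdd.injective
    change Multiplicative.toAdd g = (Multiplicative.toAdd g).2.val • ((0, 1) : ℤ × ZMod 2) +
      (Multiplicative.toAdd g).1 • ((1, 0) : ℤ × ZMod 2)
    ext <;> simp
  conv_lhs => rw [hg]
  rw [map_mul, map_mul, map_pow, map_pow, map_zpow, map_zpow, h1, h2]

theorem map_of_false
    (h3 : ψ (Monoid.PushoutI.of (φ := ampalg) false
      (Multiplicative.ofAdd (1 : ZMod 12))) = B) (k : AmFactor false) :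
    ψ (Monoid.PushoutI.of (φ := ampalg) false k) = B ^ (Multiplicative.toAdd k).val := by
  have hk : k = (Multiplicative.ofAdd (1 : ZMod 12) : AmFactor false) ^
      (Multiplicative.toAdd k).val := by
    apply Multiplicative.toAdd.injective
    change Multiplicative.toAdd k = (Multiplicative.toAdd k).val • (1 : ZMod 12)
    simp
  conv_lhs => rw [hk]
  rw [map_pow, map_pow, h3]

theorem map_base
    (h1 : ψ (Monoid.PushoutI.of (φ := ampalg) true
      (Multiplicative.ofAdd ((1, 0) : ℤ × ZMod 2))) = T)
    (h2 : ψ (Monoid.PushoutI.of (φ := ampalg) true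
      (Multiplicative.ofAdd ((0, 1) : ℤ × ZMod 2))) = -1) (h : Multiplicative (ZMod 2)) :
    ψ (Monoid.PushoutI.base ampalg h) = (-1) ^ (Multiplicative.toAdd h).val := by
  rw [← Monoid.PushoutI.of_apply_eq_base ampalg true, map_of_true h1 h2]
  change _ * T ^ (0 : ℤ) = _
  rw [zpow_zero, mul_one]
  rfl

theorem neg_one_pow_smul_mem_iff (e : ℕ) {b : Bool} {g : AmFactor b} {x : Fin 6 → ℚ} :
    (-1 : GL (Fin 6) ℚ) ^ e • x ∈ target b g ↔ x ∈ target b g := by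
  rcases neg_one_pow_eq_or (GL (Fin 6) ℚ) e with h | h
  · rw [h, one_smul]
  · rw [h, neg_one_smul_vec]
    exact ⟨fun hx => neg_neg x ▸ neg_mem_target hx, neg_mem_target⟩

theorem injective_of_generators (hB : ∀ x : Fin 6 → ℚ, B • x = rot x)
    (hT : ∀ x : Fin 6 → ℚ, T • x = push 1 x)
    (h1 : ψ (Monoid.PushoutI.of (φ := ampalg) true
      (Multiplicative.ofAdd ((1, 0) : ℤ × ZMod 2))) = T)
    (h2 : ψ (Monoid.PushoutI.of (φ := ampalg) true
      (Multiplicative.ofAdd ((0, 1) : ℤ × ZMod 2))) = -1)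
    (h3 : ψ (Monoid.PushoutI.of (φ := ampalg) false
      (Multiplicative.ofAdd (1 : ZMod 12))) = B) : Function.Injective ψ := by
  refine injective_of_pingPong ampalg_injective ψ ?_ playingField target ?_ target_subset_field ?_
  · intro h hh
    rw [map_base h1 h2] at hh
    have hcases : ∀ e : ZMod 2, e = 0 ∨ e.val = 1 := by decide
    rcases hcases (Multiplicative.toAdd h) with he | he
    · exact he
    · rw [he, pow_one] at hh
      exact absurd (by rw [zpow_zero, hh]) (zpow_ne_neg_one hT 0)
  · rintro (_ | _) g hg x hx
    · rw [map_of_false h3, pow_smul_eq_iterate_rot hB]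
      exact ⟨x, hx, rfl⟩
    · rw [map_of_true h1 h2, mul_smul, neg_one_pow_smul_mem_iff, zpow_smul_eq_push hT]
      obtain ⟨j, hj, y, hy, rfl⟩ := hx
      have h0 := fst_ne_zero_of_notMem_range hg
      by_cases h : 0 < (Multiplicative.toAdd g).1
      · simpa only [target, Set.mem_ofPred_eq, if_pos h] using hy.push_pos_rot hj h
      · simpa only [target, Set.mem_ofPred_eq, if_neg h] using
          hy.flip_push_neg_rot hj (lt_of_le_of_ne (not_lt.1 h) h0)
  · intro i j g hg h
    obtain ⟨x, hx, hxg⟩ := exists_mem_field_notMem_target i j g hg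
    exact ⟨x, hx, by rwa [map_base h1 h2, neg_one_pow_smul_mem_iff]⟩

end Representation

end HypergeometricA31

/-- The hypergeometric group of case A-31 is isomorphic to
`(ℤ × ℤ/2ℤ) ∗_{ℤ/2ℤ} ℤ/12ℤ`, via `(1,0) ↦ T = B * A⁻¹`, `(0,1) ↦ -I`, `1 ↦ B`. -/
theorem thm_A31 (A B : GL (Fin 6) ℚ)
    (hA : (A : Matrix (Fin 6) (Fin 6) ℚ) = companionMatrix 6 ((X - 1) ^ 6))
    (hB : (B : Matrix (Fin 6) (Fin 6) ℚ) =
      companionMatrix 6 ((X ^ 2 + 1) * (X ^ 4 - X ^ 2 + 1))) :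
    B ^ 12 = 1 ∧ B ^ 6 = -1 ∧ ¬ IsOfFinOrder (B * A⁻¹) ∧
      (∀ n : ℤ, n ≠ 0 → (B * A⁻¹) ^ n ≠ -1) ∧
      ∀ ψ : Monoid.PushoutI ampalg →* GL (Fin 6) ℚ,
        ψ (Monoid.PushoutI.of (φ := ampalg) true
            (Multiplicative.ofAdd ((1, 0) : ℤ × ZMod 2))) = B * A⁻¹ →
        ψ (Monoid.PushoutI.of (φ := ampalg) true
            (Multiplicative.ofAdd ((0, 1) : ℤ × ZMod 2))) = -1 →
        ψ (Monoid.PushoutI.of (φ := ampalg) false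
            (Multiplicative.ofAdd (1 : ZMod 12))) = B →
        Function.Injective ψ := by
  have hB' := HypergeometricA31.smul_eq_rot hB
  have hT := HypergeometricA31.smul_eq_push hA hB'
  have h6 := HypergeometricA31.pow_six_eq_neg_one hB'
  refine ⟨?_, h6, ?_, fun n _ => HypergeometricA31.zpow_ne_neg_one hT n,
    fun ψ h1 h2 h3 => HypergeometricA31.injective_of_generators hB' hT h1 h2 h3⟩
  · rw [show 12 = 6 * 2 from rfl, pow_mul, h6, neg_one_sq]
  · rw [isOfFinOrder_iff_zpow_eq_one]
    rintro ⟨n, hn, h⟩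
    exact HypergeometricA31.zpow_ne_one hT hn h
end
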